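/- (Doubling inequality for semi-convex solutions in all dimensions.) Let u ∈ C⁴(B₄(0)) be a 2-convex solution of (σ₂/σ₁)(λ(D²u)) = ψ(x,u) in B₄(0) ⊂ ℝⁿ, with ψ positive and of class C^{1,1}. Suppose u is semi-convex: there is A > 0 with D²u ≥ −A·Id on B₄(0). Then sup_{B₂(0)} Δu ≤ C(1 + sup_{B₁(0)} Δu), where C depends only on n, A, ‖ψ‖_{C¹}, ‖1/ψ‖_{L^∞} and ‖u‖_{C¹(B₃(0))}. -/

import Mathlib

open Metric Set

/-- The Hessian matrix of `u : ℝⁿ → ℝ` at `x`, with entries the second partial derivatives. -/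
noncomputable def hessian (n : ℕ) (u : (Fin n → ℝ) → ℝ) (x : Fin n → ℝ) :
    Matrix (Fin n) (Fin n) ℝ :=
  fun i j => iteratedFDeriv ℝ 2 u x ![Pi.single i 1, Pi.single j 1]

/-- `Δu = σ₁(λ(D²u))`: the trace of the Hessian. -/
noncomputable def lapl (n : ℕ) (u : (Fin n → ℝ) → ℝ) (x : Fin n → ℝ) : ℝ :=
  ∑ i, hessian n u x i i

/-- `σ₂(λ(D²u)) = ((tr D²u)² − tr((D²u)²))/2`, the second elementary symmetric function of the
eigenvalues of the (symmetric) Hessian. -/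
noncomputable def sigma2 (n : ℕ) (u : (Fin n → ℝ) → ℝ) (x : Fin n → ℝ) : ℝ :=
  ((lapl n u x) ^ 2 - ∑ i, ∑ j, hessian n u x i j * hessian n u x j i) / 2

lemma sum_sq_rotate {n : ℕ} {O : Matrix (Fin n) (Fin n) ℝ} (hO : O * O.transpose = 1)
    (v : Fin n → ℝ) : ∑ a, (∑ i, O i a * v i) ^ 2 = ∑ i, v i ^ 2 := by
  have h1 : ∀ i j, ∑ a, O i a * O j a = if i = j then 1 else 0 := by
    intro i j
    have := congrFun (congrFun hO i) j
    simpa [Matrix.mul_apply, Matrix.one_apply] using this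
  calc ∑ a, (∑ i, O i a * v i) ^ 2
      = ∑ a, ∑ i, ∑ j, v i * v j * (O i a * O j a) := by
        refine Finset.sum_congr rfl fun a _ => ?_
        rw [sq, Finset.sum_mul_sum]
        exact Finset.sum_congr rfl fun i _ => Finset.sum_congr rfl fun j _ => by ring
    _ = ∑ i, ∑ j, v i * v j * ∑ a, O i a * O j a := by
        rw [Finset.sum_comm]
        refine Finset.sum_congr rfl fun i _ => ?_
        rw [Finset.sum_comm]
        exact Finset.sum_congr rfl fun j _ => by rw [Finset.mul_sum]
    _ = ∑ i, v i ^ 2 := by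
        simp [h1, sq]

lemma exists_orthogonal_diagonalization {n : ℕ} (h : Matrix (Fin n) (Fin n) ℝ)
    (hs : ∀ i j, h i j = h j i) :
    ∃ (O : Matrix (Fin n) (Fin n) ℝ) (l : Fin n → ℝ), O * O.transpose = 1 ∧
      O.transpose * O = 1 ∧ h = O * Matrix.diagonal l * O.transpose := by
  have hH : h.IsHermitian := by
    ext i j
    simp [Matrix.conjTranspose_apply, hs i j]
  refine ⟨hH.eigenvectorUnitary, hH.eigenvalues, ?_, ?_, ?_⟩
  · have := (Matrix.mem_unitaryGroup_iff).1 hH.eigenvectorUnitary.2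
    simpa [Matrix.star_eq_conjTranspose, Matrix.conjTranspose_eq_transpose_of_trivial] using this
  · have := (Matrix.mem_unitaryGroup_iff').1 hH.eigenvectorUnitary.2
    simpa [Matrix.star_eq_conjTranspose, Matrix.conjTranspose_eq_transpose_of_trivial] using this
  · have := hH.spectral_theorem
    rw [Unitary.conjStarAlgAut_apply] at this
    simpa [Matrix.star_eq_conjTranspose, Matrix.conjTranspose_eq_transpose_of_trivial,
      Function.comp_def] using this

/-- Scalar data: `l` is the spectrum of a Hessian satisfying `σ₂ = f σ₁` with `l ≥ -A`. -/
structure IsSpec (n : ℕ) (A K f B : ℝ) (l : Fin n → ℝ) : Prop where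
  hn : 2 ≤ n
  hA : 0 < A
  hK : 0 < K
  lower : ∀ k, -A ≤ l k
  trace : ∑ k, l k = B
  pos : 0 < B
  eqn : B ^ 2 - ∑ k, l k ^ 2 = 2 * f * B
  f_ge : 1 / K ≤ f
  f_le : f ≤ K

namespace IsSpec
variable {n : ℕ} {A K f B : ℝ} {l : Fin n → ℝ}

lemma f_pos (h : IsSpec n A K f B l) : 0 < f := lt_of_lt_of_le (by have := h.hK; positivity) h.f_ge

lemma two_f_le (h : IsSpec n A K f B l) : 2 * f ≤ B := by
  have h1 := h.eqn
  have h2 : 0 ≤ ∑ k, l k ^ 2 := Finset.sum_nonneg fun k _ => sq_nonneg _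
  have := h.pos
  by_contra! hc
  nlinarith

lemma two_div_le (h : IsSpec n A K f B l) : 2 / K ≤ B := by
  have := h.two_f_le
  have h2 := h.f_ge
  have : 2 / K = 2 * (1 / K) := by ring
  linarith

lemma a_formula (h : IsSpec n A K f B l) (i : Fin n) :
    2 * (B * (B - f - l i)) = (B - l i) ^ 2 + ((∑ k, l k ^ 2) - l i ^ 2) := by
  have := h.eqn
  linarith

lemma sub_ge (h : IsSpec n A K f B l) (i : Fin n) : f ≤ B - l i := by
  have h1 := h.eqn
  have h2 : l i ^ 2 ≤ ∑ k, l k ^ 2 :=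
    Finset.single_le_sum (f := fun k => l k ^ 2) (fun k _ => sq_nonneg _) (Finset.mem_univ i)
  have := h.pos
  have : f * B ≤ (B - l i) * B := by nlinarith [sq_nonneg (B - l i)]
  exact le_of_mul_le_mul_right this h.pos

lemma a_lower (h : IsSpec n A K f B l) (i : Fin n) :
    1 / (2 * K ^ 2) ≤ B * (B - f - l i) := by
  have h1 := h.a_formula i
  have h2 : l i ^ 2 ≤ ∑ k, l k ^ 2 :=
    Finset.single_le_sum (f := fun k => l k ^ 2) (fun k _ => sq_nonneg _) (Finset.mem_univ i)
  have h3 := h.sub_ge i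
  have h4 := h.f_ge
  have hK := h.hK
  have h5 : (1 / K) ^ 2 ≤ (B - l i) ^ 2 := by
    apply pow_le_pow_left₀ (by positivity); linarith
  have : 1 / (2 * K ^ 2) = (1 / K) ^ 2 / 2 := by field_simp
  rw [this]; linarith

lemma a_pos (h : IsSpec n A K f B l) (i : Fin n) : 0 < B - f - l i := by
  have h1 := h.a_lower i
  have hK := h.hK
  have h2 : 0 < 1 / (2 * K ^ 2) := by positivity
  exact pos_of_mul_pos_right (lt_of_lt_of_le h2 h1) h.pos.le

lemma a_upper (h : IsSpec n A K f B l) (i : Fin n) :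
    B - f - l i ≤ (1 + A * K / 2) * B := by
  have h1 := h.lower i
  have h2 := h.f_pos
  have h3 := h.two_div_le
  have hK := h.hK
  have hA := h.hA
  have : A ≤ A * K / 2 * B := by
    calc A = A * K / 2 * (2 / K) := by field_simp
      _ ≤ _ := by gcongr
  linarith

lemma exists_max (h : IsSpec n A K f B l) :
    ∃ i0, (∀ k, k ≠ i0 → l k ≤ n * (n * A + K)) ∧ ∀ k, l k ≤ l i0 := by
  have hn := h.hn
  have : Nonempty (Fin n) := ⟨⟨0, by omega⟩⟩
  obtain ⟨i0, hi0⟩ := Finite.exists_max l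
  refine ⟨i0, ?_, hi0⟩
  set p : Fin n → ℝ := fun k => l k + A with hp
  have p0 : ∀ k, 0 ≤ p k := fun k => by have := h.lower k; simp only [hp]; linarith
  set s := ∑ k, p k with hs
  have hsB : s = B + n * A := by
    simp [hs, hp, Finset.sum_add_distrib, h.trace]
  have hA := h.hA
  have hB := h.pos
  have hK := h.hK
  have n2 : (2:ℝ) ≤ n := by exact_mod_cast hn
  have spos : 0 < s := by rw [hsB]; positivity
  have hsq : ∑ k, p k ^ 2 = (∑ k, l k ^ 2) + 2 * A * B + n * A ^ 2 := by
    have : ∀ k, p k ^ 2 = l k ^ 2 + 2 * A * l k + A ^ 2 := fun k => by simp only [hp]; ring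
    simp only [this, Finset.sum_add_distrib, ← Finset.mul_sum, h.trace]
    simp
  have hle : ∑ k, p k ^ 2 ≤ p i0 * s := by
    rw [hs, Finset.mul_sum]
    refine Finset.sum_le_sum fun k _ => ?_
    have : p k ≤ p i0 := by simp only [hp]; linarith [hi0 k]
    nlinarith [p0 k]
  have hmax : s ≤ n * p i0 := by
    calc s ≤ ∑ _k : Fin n, p i0 := Finset.sum_le_sum fun k _ => by
            simp only [hp]; linarith [hi0 k]
      _ = n * p i0 := by simp
  have key : s * (s - p i0) ≤ 2 * (n * A + K) * s := by
    have e := h.eqn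
    have f1 := h.f_le
    have : s * (s - p i0) ≤ s ^ 2 - ∑ k, p k ^ 2 := by nlinarith
    have e2 : s ^ 2 - ∑ k, p k ^ 2 ≤ 2 * f * B + 2 * n * A * B + n ^ 2 * A ^ 2 := by
      rw [hsq, hsB]; nlinarith [mul_pos hA hB, mul_pos hA hA]
    have e3 : 2 * f * B ≤ 2 * K * B := by nlinarith
    have : 0 ≤ K * (n * A) := by positivity
    rw [hsB] at *
    nlinarith [sq_nonneg ((n:ℝ) * A)]
  have key2 : s - p i0 ≤ 2 * (n * A + K) := by
    have : (s - p i0) * s ≤ 2 * (n * A + K) * s := by linarith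
    exact le_of_mul_le_mul_right this spos
  intro k hk
  have : p k + p i0 ≤ s := by
    rw [hs]
    calc p k + p i0 = ∑ j ∈ {k, i0}, p j := by rw [Finset.sum_pair hk]
      _ ≤ _ := Finset.sum_le_sum_of_subset_of_nonneg (Finset.subset_univ _) fun j _ _ => p0 j
  have : p k ≤ 2 * (n * A + K) := by linarith
  have h3 : 2 * (n * A + K) ≤ n * (n * A + K) := by gcongr
  simp only [hp] at this
  linarith

end IsSpec

/-- Upper bound for all but the largest eigenvalue (and for `f + l k`). -/
noncomputable def offBound (n : ℕ) (A K : ℝ) : ℝ := n * (n * A + K) + K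

namespace IsSpec
variable {n : ℕ} {A K f B : ℝ} {l : Fin n → ℝ}

lemma offBound_ge (h : IsSpec n A K f B l) :
    4 * A ≤ offBound n A K ∧ 3 * K ≤ offBound n A K := by
  have n2 : (2:ℝ) ≤ n := by exact_mod_cast h.hn
  have hA := h.hA
  have hK := h.hK
  unfold offBound
  constructor <;> nlinarith [mul_pos hA hK, mul_le_mul_of_nonneg_right n2 hA.le,
    mul_le_mul_of_nonneg_right n2 hK.le]

lemma jacobi_off_top {α x g y t0 Y S q B2 C : ℝ} (hα : 1 + 5 / 4 * α ≤ 23 / 10)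
    (hS : S = x + g + y) (hx : x ^ 2 ≤ t0 ^ 2) (hy : y ^ 2 ≤ Y / 60) (hq : q ≤ Y)
    (hC : 51 ≤ C * B2) :
    (1 + 5 / 4 * α) * S ^ 2 ≤ 3 * (t0 ^ 2 + Y) - 2 * q + C * g ^ 2 * B2 := by
  have h1 : S ^ 2 ≤ 11 / 10 * x ^ 2 + 22 * (g ^ 2 + y ^ 2) := by
    rw [hS]; nlinarith [sq_nonneg (x - 10 * (g + y)), sq_nonneg (g - y)]
  have h2 : (1 + 5 / 4 * α) * S ^ 2 ≤ 23 / 10 * S ^ 2 := by gcongr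
  have h3 : 51 * g ^ 2 ≤ C * g ^ 2 * B2 := by nlinarith [sq_nonneg g]
  nlinarith [sq_nonneg t0, sq_nonneg g]

lemma jacobi_top {α x g y t0 Y S B2 K : ℝ} (hα : 0 < α) (hα1 : α ≤ 1 / 100)
    (hαB : 1 ≤ 2 * K ^ 2 * B2 * α)
    (hS : S = x * t0 + g + y) (hx0 : 0 ≤ x) (hx : x ≤ 1 - α) (hy : y ^ 2 ≤ 21 / 10 * α * Y) (hY : 0 ≤ Y) :
    (1 + 5 / 4 * α) * S ^ 2 ≤ t0 ^ 2 + 3 * Y + 300 * K ^ 2 * g ^ 2 * B2 := by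
  have hc : (x * t0 + y) ^ 2 ≤ (1 - 129 / 100 * α) * (t0 ^ 2 + 3 * Y) := by
    have hx2 : x ^ 2 ≤ (1 - α) ^ 2 := by gcongr
    have h1 : (x * t0 + y) ^ 2 ≤ (x ^ 2 + 7 / 10 * α) * (t0 ^ 2 + 3 * Y) := by
      -- Cauchy–Schwarz
      have h2 : 2 * (x * t0) * y ≤ 3 * Y * x ^ 2 + 7 / 10 * α * t0 ^ 2 := by
        have h3 : (2 * (x * t0) * y) ^ 2 ≤ (3 * Y * x ^ 2 + 7 / 10 * α * t0 ^ 2) ^ 2 := by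
          have h4 : (2 * (x * t0) * y) ^ 2 ≤ 4 * (x * t0) ^ 2 * (21 / 10 * α * Y) := by
            nlinarith [sq_nonneg (x * t0)]
          nlinarith [sq_nonneg (3 * Y * x ^ 2 - 7 / 10 * α * t0 ^ 2)]
        exact le_of_sq_le_sq h3 (by positivity)
      nlinarith
    refine h1.trans ?_
    gcongr
    nlinarith
  have hδ : α * S ^ 2 ≤ α * (1 + α / 100) * (x * t0 + y) ^ 2 + (α + 100) * g ^ 2 := by
    rw [hS]
    nlinarith [sq_nonneg (α * (x * t0 + y) - 100 * g)]
  have hU : 0 ≤ t0 ^ 2 + 3 * Y := by positivity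
  have e1 : (1 + 5 / 4 * α) * (α * (1 + α / 100) * (x * t0 + y) ^ 2) ≤ α * (t0 ^ 2 + 3 * Y) := by
    calc (1 + 5 / 4 * α) * (α * (1 + α / 100) * (x * t0 + y) ^ 2)
        ≤ (1 + 5 / 4 * α) * (α * (1 + α / 100) * ((1 - 129 / 100 * α) * (t0 ^ 2 + 3 * Y))) := by
          gcongr
      _ = α * ((1 + 5 / 4 * α) * (1 + α / 100) * (1 - 129 / 100 * α)) * (t0 ^ 2 + 3 * Y) := by ring
      _ ≤ α * 1 * (t0 ^ 2 + 3 * Y) := by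
          gcongr
          nlinarith [mul_pos hα hα, mul_pos (mul_pos hα hα) hα]
      _ = _ := by ring
  have e2 : (1 + 5 / 4 * α) * ((α + 100) * g ^ 2) ≤ α * (300 * K ^ 2 * g ^ 2 * B2) := by
    have : (1 + 5 / 4 * α) * (α + 100) ≤ 150 := by nlinarith
    calc (1 + 5 / 4 * α) * ((α + 100) * g ^ 2) = ((1 + 5 / 4 * α) * (α + 100)) * g ^ 2 := by ring
      _ ≤ 150 * g ^ 2 := by gcongr
      _ ≤ (150 * (2 * K ^ 2 * B2 * α)) * g ^ 2 := by
          gcongr; linarith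
      _ = _ := by ring
  have e3 : α * ((1 + 5 / 4 * α) * S ^ 2) ≤ α * (t0 ^ 2 + 3 * Y + 300 * K ^ 2 * g ^ 2 * B2) := by
    have : (1 + 5 / 4 * α) * (α * S ^ 2) ≤ (1 + 5 / 4 * α) * (α * (1 + α / 100) * (x * t0 + y) ^ 2 + (α + 100) * g ^ 2) := by
      gcongr
    linarith
  exact le_of_mul_le_mul_left e3 hα

lemma exists_max_bounds (h : IsSpec n A K f B l) :
    ∃ i0, 0 ≤ l i0 ∧
      ∀ k, k ≠ i0 → |l k| ≤ offBound n A K ∧ |f + l k| ≤ offBound n A K := by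
  obtain ⟨i0, hoff, hmax⟩ := h.exists_max
  obtain ⟨hP1, hP2⟩ := h.offBound_ge
  have hA := h.hA
  have hK := h.hK
  have hBp := h.pos
  refine ⟨i0, ?_, fun k hk => ?_⟩
  · by_contra! hc
    have : ∑ k, l k ≤ 0 := Finset.sum_nonpos fun k _ => (hmax k).trans hc.le
    rw [h.trace] at this; linarith
  · have h1 := hoff k hk
    have h2 := h.lower k
    have h3 := h.f_pos
    have h4 := h.f_le
    have h5 : offBound n A K = n * (n * A + K) + K := rfl
    constructor <;> rw [abs_le] <;> constructor <;> linarith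

lemma sum_split (i0 : Fin n) (F : Fin n → ℝ) :
    ∑ k, F k = F i0 + ∑ k ∈ Finset.univ.erase i0, F k :=
  (Finset.add_sum_erase _ _ (Finset.mem_univ i0)).symm

lemma card_erase_le' (i0 : Fin n) : ((Finset.univ.erase i0).card : ℝ) ≤ n := by
  have := Finset.card_erase_le (s := Finset.univ) (a := i0)
  simp only [Finset.card_univ, Fintype.card_fin] at this
  exact_mod_cast this

lemma four_le (h : IsSpec n A K f B l) : 4 ≤ K ^ 2 * B ^ 2 := by
  have h1 := h.two_div_le
  have hK := h.hK
  have : 2 ≤ K * B := by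
    calc (2:ℝ) = K * (2 / K) := by field_simp
      _ ≤ _ := by gcongr
  nlinarith

lemma B_ge (h : IsSpec n A K f B l) (hB : 100 * n * offBound n A K ≤ B) :
    0 < offBound n A K ∧ 200 * offBound n A K ≤ B ∧ 600 * f ≤ B ∧ 800 * A ≤ B := by
  obtain ⟨hP1, hP2⟩ := h.offBound_ge
  have n2 : (2:ℝ) ≤ n := by exact_mod_cast h.hn
  have hA := h.hA
  have hf := h.f_le
  have h1 : 2 * offBound n A K ≤ n * offBound n A K := by gcongr; linarith
  refine ⟨by linarith, by linarith, by linarith, by linarith⟩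

lemma alpha_top_le (h : IsSpec n A K f B l) (hB : 100 * n * offBound n A K ≤ B) (i : Fin n)
    (hlP : ∀ k, k ≠ i → |l k| ≤ offBound n A K) : (B - f - l i) / B ≤ 1 / 100 := by
  obtain ⟨hP0, hPB, -, -⟩ := h.B_ge hB
  set P := offBound n A K with hP
  have n2 : (2:ℝ) ≤ n := by exact_mod_cast h.hn
  have hBp := h.pos
  have h0 : B * (B - f - l i) ≤ (n * P) ^ 2 := by
    have h1 : B - l i = ∑ k ∈ Finset.univ.erase i, l k := by
      have := sum_split i l; rw [h.trace] at this; linarith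
    have h2 : |B - l i| ≤ n * P := by
      rw [h1]
      calc |∑ k ∈ Finset.univ.erase i, l k| ≤ ∑ k ∈ Finset.univ.erase i, |l k| :=
            Finset.abs_sum_le_sum_abs _ _
        _ ≤ ∑ k ∈ Finset.univ.erase i, P :=
            Finset.sum_le_sum fun k hk => hlP k (Finset.ne_of_mem_erase hk)
        _ = (Finset.univ.erase i).card * P := by simp
        _ ≤ n * P := by exact mul_le_mul_of_nonneg_right (card_erase_le' i) (by positivity)
    have h3 : ∑ k ∈ Finset.univ.erase i, l k ^ 2 ≤ n * P ^ 2 := by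
      calc _ ≤ ∑ k ∈ Finset.univ.erase i, P ^ 2 := Finset.sum_le_sum fun k hk => by
            rw [← sq_abs]; gcongr; exact hlP k (Finset.ne_of_mem_erase hk)
        _ = (Finset.univ.erase i).card * P ^ 2 := by simp
        _ ≤ n * P ^ 2 := by exact mul_le_mul_of_nonneg_right (card_erase_le' i) (by positivity)
    have h4 : (B - l i) ^ 2 ≤ (n * P) ^ 2 := by rw [← sq_abs]; gcongr
    have h5 := h.a_formula i
    rw [sum_split i (fun k => l k ^ 2)] at h5
    have : n * P ^ 2 ≤ (n * P) ^ 2 := by nlinarith [sq_nonneg P]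
    linarith
  have h5 : (100 * (n * P)) ^ 2 ≤ B ^ 2 := by gcongr; linarith
  rw [div_le_iff₀ hBp]
  refine le_of_mul_le_mul_left (a := B) ?_ hBp
  have : 0 ≤ (n * P) ^ 2 := by positivity
  linarith

lemma jacobi_index_top (h : IsSpec n A K f B l) (hB : 100 * n * offBound n A K ≤ B)
    (t : Fin n → ℝ) (g : ℝ) (ht : ∑ k, (B - f - l k) * t k = g * B) (i : Fin n)
    (hlP : ∀ k, k ≠ i → |l k| ≤ offBound n A K) (hli : 0 ≤ l i) :
    (1 + 5 / 4 * ((B - f - l i) / B)) * (∑ k, t k) ^ 2 ≤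
      3 * ∑ k, t k ^ 2 - 2 * t i ^ 2 + 320 * K ^ 2 * g ^ 2 * B ^ 2 := by
  obtain ⟨-, -, hfB, -⟩ := h.B_ge hB
  have hBp := h.pos
  have hK := h.hK
  have hα1 := h.alpha_top_le hB i hlP
  have hY0 : 0 ≤ ∑ k ∈ Finset.univ.erase i, t k ^ 2 := Finset.sum_nonneg fun k _ => sq_nonneg _
  have haB : (B - f - l i) / B * B = B - f - l i := by field_simp
  have hα0 : 0 < (B - f - l i) / B := div_pos (h.a_pos i) hBp
  have hform := h.a_formula i
  have hlow := h.a_lower i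
  rw [sum_split i (fun k => l k ^ 2), ← haB, add_sub_cancel_left] at hform
  rw [div_le_iff₀ (by positivity), ← haB] at hlow
  rw [sum_split i (fun k => t k ^ 2)]
  have hL2 : (∑ k ∈ Finset.univ.erase i, l k * t k) ^ 2 ≤ (∑ k ∈ Finset.univ.erase i, l k ^ 2) *
      ∑ k ∈ Finset.univ.erase i, t k ^ 2 := Finset.sum_mul_sq_le_sq_mul_sq _ _ _
  have hid : (B - f) * ∑ k, t k = l i * t i + g * B + ∑ k ∈ Finset.univ.erase i, l k * t k := by
    have e1 : ∑ k, (B - f - l k) * t k = (B - f) * (∑ k, t k) - ∑ k, l k * t k := by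
      rw [Finset.mul_sum, ← Finset.sum_sub_distrib]
      exact Finset.sum_congr rfl fun k _ => by ring
    rw [e1, sum_split i (fun k => l k * t k)] at ht
    linarith
  generalize (∑ k, t k) = S at *
  generalize ∑ k ∈ Finset.univ.erase i, t k ^ 2 = Y at *
  generalize ∑ k ∈ Finset.univ.erase i, l k * t k = L at *
  generalize ∑ k ∈ Finset.univ.erase i, l k ^ 2 = Q at *
  have haB2 : l i = B - f - (B - f - l i) / B * B := by rw [haB]; ring
  have hli2 : l i ≤ B - f := by linarith [h.a_pos i]
  clear hlP ht
  generalize (B - f - l i) / B = α at *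
  generalize l i = b at *
  generalize t i = t0 at *
  have hf := h.f_pos
  clear h hB
  have hL3 : L ^ 2 ≤ 2 * (B ^ 2 * α) * Y := by
    refine hL2.trans ?_
    gcongr
    nlinarith [sq_nonneg (B - b)]
  have hBf : 0 < B - f := by linarith
  have hS2 : S = (b / (B - f)) * t0 + g * B / (B - f) + L / (B - f) := by
    field_simp; linarith
  have hy : (L / (B - f)) ^ 2 ≤ 21 / 10 * α * Y := by
    rw [div_pow, div_le_iff₀ (by positivity)]
    refine hL3.trans ?_
    have : B ^ 2 ≤ 21 / 20 * (B - f) ^ 2 := by nlinarith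
    have := mul_le_mul_of_nonneg_left this (by positivity : 0 ≤ α * Y)
    linarith
  have hx : b / (B - f) ≤ 1 - α := by
    rw [div_le_iff₀ hBf]; nlinarith [mul_pos hα0 hf]
  have key := jacobi_top (α := α) (x := b / (B - f)) (g := g * B / (B - f))
    (y := L / (B - f)) (t0 := t0) (Y := Y) (S := S) (B2 := B ^ 2) (K := K) hα0 hα1
    (by linarith) hS2 (div_nonneg hli hBf.le) hx hy hY0
  refine key.trans ?_
  have : (g * B / (B - f)) ^ 2 ≤ g ^ 2 * (101 / 100) := by
    rw [div_pow, div_le_iff₀ (by positivity), mul_pow, mul_assoc]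
    gcongr
    nlinarith
  have e4 : 300 * K ^ 2 * (g * B / (B - f)) ^ 2 * B ^ 2 ≤
     300 * K ^ 2 * (g ^ 2 * (101 / 100)) * B ^ 2 := by gcongr
  have e5 : 0 ≤ K ^ 2 * g ^ 2 * B ^ 2 := by positivity
  linarith

lemma jacobi_index_off (h : IsSpec n A K f B l) (hB : 100 * n * offBound n A K ≤ B)
    (t : Fin n → ℝ) (g : ℝ) (ht : ∑ k, (B - f - l k) * t k = g * B) (i i0 : Fin n) (hi : i ≠ i0)
    (hlP : ∀ k, k ≠ i0 → |f + l k| ≤ offBound n A K) (hli : 0 ≤ l i0) :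
    (1 + 5 / 4 * ((B - f - l i) / B)) * (∑ k, t k) ^ 2 ≤
      3 * ∑ k, t k ^ 2 - 2 * t i ^ 2 + 320 * K ^ 2 * g ^ 2 * B ^ 2 := by
  obtain ⟨hP0, hPB, hfB, hAB⟩ := h.B_ge hB
  have hBp := h.pos
  have hf := h.f_pos
  set P := offBound n A K with hP
  have n2 : (2:ℝ) ≤ n := by exact_mod_cast h.hn
  have hid : ∑ k, t k = (f + l i0) / B * t i0 + g +
      (∑ k ∈ Finset.univ.erase i0, (f + l k) * t k) / B := by
    have e1 : ∑ k, (B - f - l k) * t k = B * (∑ k, t k) - ∑ k, (f + l k) * t k := by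
      rw [Finset.mul_sum, ← Finset.sum_sub_distrib]
      exact Finset.sum_congr rfl fun k _ => by ring
    rw [e1, sum_split i0 (fun k => (f + l k) * t k)] at ht
    field_simp
    linarith
  have hx : ((f + l i0) / B * t i0) ^ 2 ≤ t i0 ^ 2 := by
    rw [mul_pow]
    have h1 : (f + l i0) / B ≤ 1 := by
      rw [div_le_one hBp]; linarith [h.a_pos i0]
    have h2 : 0 ≤ (f + l i0) / B := by positivity
    have : ((f + l i0) / B) ^ 2 ≤ 1 := pow_le_one₀ h2 h1
    nlinarith [sq_nonneg (t i0)]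
  have hy : ((∑ k ∈ Finset.univ.erase i0, (f + l k) * t k) / B) ^ 2 ≤
      (∑ k ∈ Finset.univ.erase i0, t k ^ 2) / 60 := by
    have h1 : (∑ k ∈ Finset.univ.erase i0, (f + l k) * t k) ^ 2 ≤
      (∑ k ∈ Finset.univ.erase i0, (f + l k) ^ 2) * ∑ k ∈ Finset.univ.erase i0, t k ^ 2 :=
        Finset.sum_mul_sq_le_sq_mul_sq _ _ _
    have h3 : ∑ k ∈ Finset.univ.erase i0, (f + l k) ^ 2 ≤ n * P ^ 2 := by
      calc _ ≤ ∑ k ∈ Finset.univ.erase i0, P ^ 2 := Finset.sum_le_sum fun k hk => by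
            rw [← sq_abs]; gcongr; exact hlP k (Finset.ne_of_mem_erase hk)
        _ = (Finset.univ.erase i0).card * P ^ 2 := by simp
        _ ≤ n * P ^ 2 := by exact mul_le_mul_of_nonneg_right (card_erase_le' i0) (by positivity)
    have h5 : (100 * (n * P)) ^ 2 ≤ B ^ 2 := by gcongr; linarith
    have h6 : n * P ^ 2 ≤ B ^ 2 / 60 := by nlinarith [sq_nonneg P]
    rw [div_pow, div_le_iff₀ (by positivity)]
    refine h1.trans ?_
    calc _ ≤ B ^ 2 / 60 * ∑ k ∈ Finset.univ.erase i0, t k ^ 2 := by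
          gcongr
          exact h3.trans h6
      _ = _ := by ring
  have hq : t i ^ 2 ≤ ∑ k ∈ Finset.univ.erase i0, t k ^ 2 :=
    Finset.single_le_sum (f := fun k => t k ^ 2) (fun k _ => sq_nonneg _)
      (Finset.mem_erase.2 ⟨hi, Finset.mem_univ i⟩)
  have hα : 1 + 5 / 4 * ((B - f - l i) / B) ≤ 23 / 10 := by
    have : (B - f - l i) / B ≤ 26 / 25 := by
      rw [div_le_iff₀ hBp]; linarith [h.lower i]
    linarith
  have := h.four_le
  have key := jacobi_off_top hα hid hx hy hq (C := 320 * K ^ 2) (B2 := B ^ 2) (by linarith)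
  rw [sum_split i0 (fun k => t k ^ 2)]
  exact key

lemma jacobi_index (h : IsSpec n A K f B l) (hB : 100 * n * offBound n A K ≤ B)
    (t : Fin n → ℝ) (g : ℝ) (ht : ∑ k, (B - f - l k) * t k = g * B) (i : Fin n) :
    (1 + 5 / 4 * ((B - f - l i) / B)) * (∑ k, t k) ^ 2 ≤
      3 * ∑ k, t k ^ 2 - 2 * t i ^ 2 + 320 * K ^ 2 * g ^ 2 * B ^ 2 := by
  obtain ⟨i0, hli, hlP⟩ := h.exists_max_bounds
  by_cases hi : i = i0
  · subst hi
    exact h.jacobi_index_top hB t g ht i (fun k hk => (hlP k hk).1) hli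
  · exact h.jacobi_index_off hB t g ht i i0 hi (fun k hk => (hlP k hk).2) hli

/-- Jacobi inequality for the third derivatives, in an eigenbasis. -/
lemma jacobi_diag (h : IsSpec n A K f B l) (hB : 100 * n * offBound n A K ≤ B)
    (T : Fin n → Fin n → Fin n → ℝ) (hT1 : ∀ i j k, T i j k = T j i k)
    (hT2 : ∀ i j k, T i j k = T i k j) (g : Fin n → ℝ)
    (hg : ∀ i, ∑ k, (B - f - l k) * T k k i = g i * B) :
    ∑ i, (1 + 5 / 4 * ((B - f - l i) / B)) * (∑ k, T k k i) ^ 2 ≤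
      ∑ a, ∑ b, ∑ c, T a b c ^ 2 + 320 * K ^ 2 * (∑ i, g i ^ 2) * B ^ 2 := by
  have h1 : ∑ i, (3 * ∑ k, T k k i ^ 2 - 2 * T i i i ^ 2) ≤ ∑ a, ∑ b, ∑ c, T a b c ^ 2 := by
    have hpt : ∀ a b c, T a b c ^ 2 ≥ (if b = c then T a b c ^ 2 else 0) +
        (if a = c then T a b c ^ 2 else 0) + (if a = b then T a b c ^ 2 else 0) -
        2 * (if a = b then if b = c then T a b c ^ 2 else 0 else 0) := by
      intro a b c
      have := sq_nonneg (T a b c)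
      by_cases h1 : a = b
      · subst h1
        by_cases h2 : a = c
        · subst h2; simp; linarith
        · simp [h2]
      · by_cases h2 : b = c
        · subst h2; simp [h1]
        · by_cases h3 : a = c
          · subst h3; simp [h1, h2]
          · simp [h1, h2, h3, this]
    have hsum : ∑ a, ∑ b, ∑ c, ((if b = c then T a b c ^ 2 else 0) +
        (if a = c then T a b c ^ 2 else 0) + (if a = b then T a b c ^ 2 else 0) -
        2 * (if a = b then if b = c then T a b c ^ 2 else 0 else 0)) =
        ∑ i, (3 * ∑ k, T k k i ^ 2 - 2 * T i i i ^ 2) := by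
      simp only [Finset.sum_sub_distrib, Finset.sum_add_distrib, ← Finset.mul_sum]
      have e1 : ∑ a, ∑ b, ∑ c, (if b = c then T a b c ^ 2 else 0) = ∑ i, ∑ k, T k k i ^ 2 := by
        simp only [Finset.sum_ite_eq, Finset.mem_univ, if_true]
        refine Finset.sum_congr rfl fun a _ => Finset.sum_congr rfl fun b _ => ?_
        rw [hT1 a b b, hT2 b a b]
      have e2 : ∑ a, ∑ b, ∑ c, (if a = c then T a b c ^ 2 else 0) = ∑ i, ∑ k, T k k i ^ 2 := by
        simp only [Finset.sum_ite_eq, Finset.mem_univ, if_true]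
        rw [Finset.sum_comm]
        refine Finset.sum_congr rfl fun a _ => Finset.sum_congr rfl fun b _ => ?_
        rw [hT2 b a b]
      have e3 : ∑ a, ∑ b, ∑ c, (if a = b then T a b c ^ 2 else 0) = ∑ i, ∑ k, T k k i ^ 2 := by
        rw [Finset.sum_comm (s := (Finset.univ : Finset (Fin n))) (t := (Finset.univ : Finset (Fin n)))
          (f := fun i k => T k k i ^ 2)]
        refine Finset.sum_congr rfl fun a _ => ?_
        rw [Finset.sum_comm]
        simp
      have e4 : ∑ a, ∑ b, ∑ c, (if a = b then if b = c then T a b c ^ 2 else 0 else 0) =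
          ∑ i, T i i i ^ 2 := by
        refine Finset.sum_congr rfl fun a _ => ?_
        rw [Finset.sum_comm]
        simp
      rw [e1, e2, e3, e4]; ring
    rw [← hsum]
    exact Finset.sum_le_sum fun a _ => Finset.sum_le_sum fun b _ => Finset.sum_le_sum fun c _ =>
      hpt a b c
  calc _ ≤ ∑ i, (3 * ∑ k, T k k i ^ 2 - 2 * T i i i ^ 2 + 320 * K ^ 2 * g i ^ 2 * B ^ 2) :=
        Finset.sum_le_sum fun i _ => h.jacobi_index hB (fun k => T k k i) (g i) (hg i) i
    _ = ∑ i, (3 * ∑ k, T k k i ^ 2 - 2 * T i i i ^ 2) + 320 * K ^ 2 * (∑ i, g i ^ 2) * B ^ 2 := by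
        rw [Finset.sum_add_distrib, Finset.mul_sum, Finset.sum_mul]
    _ ≤ _ := by linarith

end IsSpec

namespace IsSpec
variable {n : ℕ} {A K f B : ℝ} {l : Fin n → ℝ}

lemma prod_shift_ge (h : IsSpec n A K f B l) : B / n ≤ ∏ k, (l k + (A + 1)) := by
  obtain ⟨i0, -, hmax⟩ := h.exists_max
  have hA := h.hA
  have hB := h.pos
  have n0 : (0:ℝ) < n := by have := h.hn; positivity
  rw [← Finset.mul_prod_erase _ _ (Finset.mem_univ i0)]
  have h1 : 1 ≤ ∏ k ∈ Finset.univ.erase i0, (l k + (A + 1)) := by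
    calc (1:ℝ) = ∏ k ∈ Finset.univ.erase i0, 1 := by simp
      _ ≤ _ := Finset.prod_le_prod (fun _ _ => zero_le_one) fun k _ => by linarith [h.lower k]
  have h2 : B / n ≤ l i0 := by
    rw [div_le_iff₀ n0, ← h.trace]
    calc ∑ k, l k ≤ ∑ _k : Fin n, l i0 := Finset.sum_le_sum fun k _ => hmax k
      _ = _ := by simp [mul_comm]
  have h3 : 0 < B / n := by positivity
  nlinarith

end IsSpec

/-- Constant comparing the cofactors of the shifted Hessian with the linearized operator. -/
noncomputable def cofBound (n : ℕ) (A K : ℝ) : ℝ :=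
  (offBound n A K + A + 2) ^ (2 * n) * (4 + 4 * (A + 1) ^ 2 * K ^ 2 + 2 * K ^ 2)

namespace IsSpec
variable {n : ℕ} {A K f B : ℝ} {l : Fin n → ℝ}

lemma cofactor_sq_le (h : IsSpec n A K f B l) (i : Fin n) :
    (∏ k ∈ Finset.univ.erase i, (l k + (A + 1))) ^ 2 ≤ cofBound n A K * (B * (B - f - l i)) := by
  obtain ⟨i0, hli, hP⟩ := h.exists_max_bounds
  obtain ⟨hP1, hP2⟩ := h.offBound_ge
  have hA := h.hA
  have hK := h.hK
  set D := offBound n A K + A + 2 with hD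
  have hD1 : 1 ≤ D := by linarith
  have hlow := h.a_lower i
  have hform := h.a_formula i
  rw [div_le_iff₀ (by positivity)] at hlow
  have hprod : ∀ s : Finset (Fin n), i0 ∉ s → 0 ≤ ∏ k ∈ s, (l k + (A + 1)) ∧
      (∏ k ∈ s, (l k + (A + 1))) ^ 2 ≤ D ^ (2 * n) := by
    intro s hs
    have h0 : 0 ≤ ∏ k ∈ s, (l k + (A + 1)) :=
      Finset.prod_nonneg fun k _ => by linarith [h.lower k]
    refine ⟨h0, ?_⟩
    have h1 : ∏ k ∈ s, (l k + (A + 1)) ≤ D ^ n := by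
      calc ∏ k ∈ s, (l k + (A + 1)) ≤ ∏ k ∈ s, D :=
            Finset.prod_le_prod (fun k _ => by linarith [h.lower k]) fun k hk => by
              have := (hP k (fun e => hs (e ▸ hk))).1
              linarith [le_abs_self (l k)]
        _ = D ^ s.card := by simp
        _ ≤ D ^ n := pow_le_pow_right₀ hD1 (by simpa using Finset.card_le_univ s)
    calc _ ≤ (D ^ n) ^ 2 := by gcongr
      _ = D ^ (2 * n) := by ring
  have hX : 0 ≤ B * (B - f - l i) := (mul_pos h.pos (h.a_pos i)).le
  unfold cofBound
  rw [← hD]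
  by_cases hi : i = i0
  · subst hi
    obtain ⟨-, h2⟩ := hprod (Finset.univ.erase i) (Finset.notMem_erase i _)
    calc _ ≤ D ^ (2 * n) * 1 := by rw [mul_one]; exact h2
      _ ≤ D ^ (2 * n) * ((4 + 4 * (A + 1) ^ 2 * K ^ 2 + 2 * K ^ 2) * (B * (B - f - l i))) := by
          gcongr
          have : 0 ≤ (4 + 4 * (A + 1) ^ 2 * K ^ 2) * (B * (B - f - l i)) := by positivity
          linarith
      _ = _ := by ring
  · have hmem : i0 ∈ Finset.univ.erase i := Finset.mem_erase.2 ⟨fun e => hi e.symm, Finset.mem_univ _⟩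
    rw [← Finset.mul_prod_erase _ _ hmem, mul_pow]
    obtain ⟨-, h2⟩ := hprod ((Finset.univ.erase i).erase i0) (Finset.notMem_erase i0 _)
    have h3 : l i0 ^ 2 ≤ (∑ k, l k ^ 2) - l i ^ 2 := by
      have := Finset.sum_erase_eq_sub (f := fun k => l k ^ 2) (Finset.mem_univ i)
      rw [← this]
      exact Finset.single_le_sum (f := fun k => l k ^ 2) (fun k _ => sq_nonneg _) hmem
    have h4 : (l i0 + (A + 1)) ^ 2 ≤ (4 + 4 * (A + 1) ^ 2 * K ^ 2 + 2 * K ^ 2) * (B * (B - f - l i)) := by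
      have e1 : (l i0 + (A + 1)) ^ 2 ≤ 2 * l i0 ^ 2 + 2 * (A + 1) ^ 2 := by
        nlinarith [sq_nonneg (l i0 - (A + 1))]
      have e2 : 2 * (A + 1) ^ 2 * 1 ≤ 2 * (A + 1) ^ 2 * (B * (B - f - l i) * (2 * K ^ 2)) := by gcongr
      have e3 : 0 ≤ 2 * K ^ 2 * (B * (B - f - l i)) := by positivity
      nlinarith [sq_nonneg (B - l i)]
    calc _ ≤ ((4 + 4 * (A + 1) ^ 2 * K ^ 2 + 2 * K ^ 2) * (B * (B - f - l i))) * D ^ (2 * n) := by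
          gcongr
      _ = _ := by ring

end IsSpec

/-- Pointwise algebraic data of the equation `σ₂ = f σ₁` for a semi-convex Hessian `h`. -/
structure IsHess (n : ℕ) (A K f B : ℝ) (h : Matrix (Fin n) (Fin n) ℝ) : Prop where
  hn : 2 ≤ n
  hA : 0 < A
  hK : 0 < K
  symm : ∀ i j, h i j = h j i
  lower : ∀ v : Fin n → ℝ, -A * ∑ i, v i ^ 2 ≤ ∑ i, ∑ j, v i * h i j * v j
  trace : ∑ k, h k k = B
  pos : 0 < B
  eqn : B ^ 2 - ∑ i, ∑ j, h i j * h j i = 2 * f * B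
  f_ge : 1 / K ≤ f
  f_le : f ≤ K

/-- Coefficients of the linearized operator. -/
def linCoef {n : ℕ} (c : ℝ) (h : Matrix (Fin n) (Fin n) ℝ) (i j : Fin n) : ℝ :=
  (if i = j then c else 0) - h i j

/-- The quadratic form of the linearized operator. -/
def linForm {n : ℕ} (c : ℝ) (h : Matrix (Fin n) (Fin n) ℝ) (v w : Fin n → ℝ) : ℝ :=
  ∑ i, ∑ j, v i * linCoef c h i j * w j

section rotation
variable {n : ℕ} {O h : Matrix (Fin n) (Fin n) ℝ} {l : Fin n → ℝ}

lemma orth_rows (hO : O * O.transpose = 1) (i j : Fin n) :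
    ∑ a, O i a * O j a = if i = j then 1 else 0 := by
  have := congrFun (congrFun hO i) j
  simpa [Matrix.mul_apply, Matrix.one_apply] using this

lemma diag_entry (hd : h = O * Matrix.diagonal l * O.transpose) (i j : Fin n) :
    h i j = ∑ a, l a * (O i a * O j a) := by
  rw [hd]
  rw [Matrix.mul_apply]
  simp only [Matrix.mul_diagonal, Matrix.transpose_apply]
  exact Finset.sum_congr rfl fun a _ => by ring

lemma sum_diag_quad (hd : h = O * Matrix.diagonal l * O.transpose) (F : Fin n → Fin n → ℝ) :
    ∑ i, ∑ j, h i j * F i j = ∑ a, l a * ∑ i, ∑ j, O i a * (O j a * F i j) := by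
  simp only [diag_entry hd, Finset.sum_mul, Finset.mul_sum]
  rw [Finset.sum_comm_cycle]
  refine Finset.sum_congr rfl fun a _ => Finset.sum_congr rfl fun i _ =>
    Finset.sum_congr rfl fun j _ => by ring

lemma sum_trace_rot (hO : O * O.transpose = 1) (F : Fin n → Fin n → ℝ) :
    ∑ a, ∑ i, ∑ j, O i a * (O j a * F i j) = ∑ i, F i i := by
  rw [← Finset.sum_comm_cycle]
  have : ∀ i j, ∑ a, O i a * (O j a * F i j) = if i = j then F i j else 0 := by
    intro i j
    simp only [← mul_assoc, ← Finset.sum_mul, orth_rows hO]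
    simp
  simp [this]

lemma quad_diag (hd : h = O * Matrix.diagonal l * O.transpose) (v : Fin n → ℝ) :
    ∑ i, ∑ j, v i * h i j * v j = ∑ a, l a * (∑ i, O i a * v i) ^ 2 := by
  have := sum_diag_quad hd (fun i j => v i * v j)
  calc _ = ∑ i, ∑ j, h i j * (v i * v j) :=
        Finset.sum_congr rfl fun i _ => Finset.sum_congr rfl fun j _ => by ring
    _ = _ := by
        rw [this]
        refine Finset.sum_congr rfl fun a _ => ?_
        rw [sq, Finset.sum_mul_sum]
        congr 1
        exact Finset.sum_congr rfl fun i _ => Finset.sum_congr rfl fun j _ => by ring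

lemma linForm_self (c : ℝ) (h : Matrix (Fin n) (Fin n) ℝ) (v : Fin n → ℝ) :
    linForm c h v v = c * ∑ i, v i ^ 2 - ∑ i, ∑ j, v i * h i j * v j := by
  unfold linForm linCoef
  simp only [mul_sub, sub_mul, Finset.sum_sub_distrib, Finset.mul_sum]
  congr 1
  refine Finset.sum_congr rfl fun i _ => ?_
  simp
  ring

lemma linForm_diag (hO : O * O.transpose = 1) (hd : h = O * Matrix.diagonal l * O.transpose)
    (c : ℝ) (v : Fin n → ℝ) :
    linForm c h v v = ∑ a, (c - l a) * (∑ i, O i a * v i) ^ 2 := by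
  rw [linForm_self, quad_diag hd, ← sum_sq_rotate hO v, Finset.mul_sum, ← Finset.sum_sub_distrib]
  exact Finset.sum_congr rfl fun a _ => by ring

lemma mulVec_rot (hO' : O.transpose * O = 1) (hd : h = O * Matrix.diagonal l * O.transpose)
    (v : Fin n → ℝ) (a : Fin n) :
    ∑ i, O i a * (h.mulVec v) i = l a * ∑ i, O i a * v i := by
  have h1 : O.transpose.mulVec (h.mulVec v) = (Matrix.diagonal l).mulVec (O.transpose.mulVec v) := by
    rw [hd, Matrix.mulVec_mulVec, Matrix.mulVec_mulVec, ← Matrix.mul_assoc, ← Matrix.mul_assoc, hO',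
      Matrix.one_mul]
  have := congrFun h1 a
  rw [Matrix.mulVec_diagonal] at this
  simpa [Matrix.mulVec, dotProduct] using this

lemma sum_sq_rotate₃ (hO : O * O.transpose = 1) (T : Fin n → Fin n → Fin n → ℝ) :
    ∑ a, ∑ b, ∑ c, (∑ i, O i a * ∑ j, O j b * ∑ k, O k c * T i j k) ^ 2 =
      ∑ i, ∑ j, ∑ k, T i j k ^ 2 := by
  calc ∑ a, ∑ b, ∑ c, (∑ i, O i a * ∑ j, O j b * ∑ k, O k c * T i j k) ^ 2
      = ∑ b, ∑ c, ∑ a, (∑ i, O i a * ∑ j, O j b * ∑ k, O k c * T i j k) ^ 2 := by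
        rw [Finset.sum_comm_cycle, Finset.sum_comm_cycle, Finset.sum_comm]
    _ = ∑ b, ∑ c, ∑ i, (∑ j, O j b * ∑ k, O k c * T i j k) ^ 2 :=
        Finset.sum_congr rfl fun b _ => Finset.sum_congr rfl fun c _ =>
          sum_sq_rotate hO fun i => ∑ j, O j b * ∑ k, O k c * T i j k
    _ = ∑ i, ∑ c, ∑ b, (∑ j, O j b * ∑ k, O k c * T i j k) ^ 2 := by
        rw [Finset.sum_comm_cycle]
        exact Finset.sum_congr rfl fun _ _ => Finset.sum_comm
    _ = ∑ i, ∑ c, ∑ j, (∑ k, O k c * T i j k) ^ 2 :=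
        Finset.sum_congr rfl fun i _ => Finset.sum_congr rfl fun c _ =>
          sum_sq_rotate hO fun j => ∑ k, O k c * T i j k
    _ = ∑ i, ∑ j, ∑ c, (∑ k, O k c * T i j k) ^ 2 :=
        Finset.sum_congr rfl fun i _ => Finset.sum_comm
    _ = ∑ i, ∑ j, ∑ k, T i j k ^ 2 :=
        Finset.sum_congr rfl fun i _ => Finset.sum_congr rfl fun j _ =>
          sum_sq_rotate hO fun k => T i j k

end rotation

namespace IsHess
variable {n : ℕ} {A K f B : ℝ} {h : Matrix (Fin n) (Fin n) ℝ}

lemma exists_spec (H : IsHess n A K f B h) :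
    ∃ (O : Matrix (Fin n) (Fin n) ℝ) (l : Fin n → ℝ), O * O.transpose = 1 ∧
      O.transpose * O = 1 ∧ h = O * Matrix.diagonal l * O.transpose ∧ IsSpec n A K f B l := by
  obtain ⟨O, l, hO, hO', hd⟩ := exists_orthogonal_diagonalization h H.symm
  have hO2 : O.transpose * O.transpose.transpose = 1 := by rw [Matrix.transpose_transpose]; exact hO'
  refine ⟨O, l, hO, hO', hd, H.hn, H.hA, H.hK, ?_, ?_, H.pos, ?_, H.f_ge, H.f_le⟩
  · intro k
    have h1 := H.lower (fun i => O i k)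
    rw [quad_diag hd] at h1
    have h2 : ∀ a, ∑ i, O i a * O i k = if a = k then 1 else 0 := fun a => orth_rows hO2 a k
    have h3 : ∑ i, O i k ^ 2 = 1 := by
      simpa [sq] using h2 k
    simp [h2, h3] at h1
    exact h1
  · have := congrArg Matrix.trace hd
    rw [Matrix.mul_assoc, Matrix.trace_mul_comm, Matrix.mul_assoc, hO', Matrix.mul_one,
      Matrix.trace_diagonal] at this
    rw [← this, ← H.trace]; rfl
  · have h1 : h * h = O * Matrix.diagonal (fun a => l a ^ 2) * O.transpose := by
      have : Matrix.diagonal (fun a => l a ^ 2) = Matrix.diagonal l * Matrix.diagonal l := by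
        rw [Matrix.diagonal_mul_diagonal]; congr 1; ext a; ring
      rw [this]
      nth_rewrite 1 [hd]
      nth_rewrite 1 [hd]
      calc _ = O * Matrix.diagonal l * (O.transpose * O) * Matrix.diagonal l * O.transpose := by
            simp only [Matrix.mul_assoc]
        _ = _ := by rw [hO', Matrix.mul_one]; simp only [Matrix.mul_assoc]
    have h2 := congrArg Matrix.trace h1
    rw [Matrix.mul_assoc O, Matrix.trace_mul_comm O, Matrix.mul_assoc, hO', Matrix.mul_one,
      Matrix.trace_diagonal] at h2
    have h3 : (h * h).trace = ∑ i, ∑ j, h i j * h j i := by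
      simp [Matrix.trace, Matrix.mul_apply]
    rw [← h2, h3]; exact H.eqn

lemma linForm_lower (H : IsHess n A K f B h) (v : Fin n → ℝ) :
    ∑ i, v i ^ 2 ≤ 2 * K ^ 2 * (B * linForm (B - f) h v v) := by
  obtain ⟨O, l, hO, hO', hd, S⟩ := H.exists_spec
  have hK := H.hK
  rw [linForm_diag hO hd, ← sum_sq_rotate hO v, Finset.mul_sum, Finset.mul_sum]
  refine Finset.sum_le_sum fun a _ => ?_
  have := S.a_lower a
  rw [div_le_iff₀ (by positivity)] at this
  calc _ = 1 * (∑ i, O i a * v i) ^ 2 := by ring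
    _ ≤ (B * (B - f - l a) * (2 * K ^ 2)) * (∑ i, O i a * v i) ^ 2 := by gcongr
    _ = _ := by ring

lemma linForm_nonneg (H : IsHess n A K f B h) (v : Fin n → ℝ) : 0 ≤ linForm (B - f) h v v := by
  have h1 := H.linForm_lower v
  have hK := H.hK
  have hB := H.pos
  have h2 : 0 ≤ ∑ i, v i ^ 2 := Finset.sum_nonneg fun i _ => sq_nonneg _
  by_contra! hc
  have : 2 * K ^ 2 * (B * linForm (B - f) h v v) < 0 :=
    mul_neg_of_pos_of_neg (by positivity) (mul_neg_of_pos_of_neg hB hc)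
  linarith

lemma linForm_upper (H : IsHess n A K f B h) (v : Fin n → ℝ) :
    linForm (B - f) h v v ≤ (1 + A * K / 2) * B * ∑ i, v i ^ 2 := by
  obtain ⟨O, l, hO, hO', hd, S⟩ := H.exists_spec
  rw [linForm_diag hO hd, ← sum_sq_rotate hO v, Finset.mul_sum]
  refine Finset.sum_le_sum fun a _ => ?_
  have := S.a_upper a
  gcongr

lemma det_shift_eq {O : Matrix (Fin n) (Fin n) ℝ} {l : Fin n → ℝ} (hO : O * O.transpose = 1)
    (hd : h = O * Matrix.diagonal l * O.transpose) (κ : ℝ) :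
    (h + κ • (1 : Matrix (Fin n) (Fin n) ℝ)).det = ∏ k, (l k + κ) := by
  have : h + κ • (1 : Matrix (Fin n) (Fin n) ℝ) =
      O * Matrix.diagonal (fun k => l k + κ) * O.transpose := by
    have e : Matrix.diagonal (fun k => l k + κ) = Matrix.diagonal l + κ • (1 : Matrix (Fin n) (Fin n) ℝ) := by
      ext i j
      by_cases hij : i = j
      · subst hij; simp
      · simp [hij]
    rw [e, Matrix.mul_add, Matrix.add_mul, ← hd]
    simp [hO]
  rw [this, Matrix.det_mul, Matrix.det_mul, Matrix.det_diagonal, mul_right_comm, ← Matrix.det_mul, hO]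
  simp

lemma det_shift_ge (H : IsHess n A K f B h) :
    B / n ≤ (h + (A + 1) • (1 : Matrix (Fin n) (Fin n) ℝ)).det := by
  obtain ⟨O, l, hO, hO', hd, S⟩ := H.exists_spec
  rw [det_shift_eq hO hd]
  exact S.prod_shift_ge

lemma inv_shift_le (H : IsHess n A K f B h) (v w : Fin n → ℝ)
    (hvw : (h + (A + 1) • (1 : Matrix (Fin n) (Fin n) ℝ)).mulVec v = w) :
    (h + (A + 1) • (1 : Matrix (Fin n) (Fin n) ℝ)).det ^ 2 * ∑ i, v i ^ 2 ≤
      cofBound n A K * (B * linForm (B - f) h w w) := by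
  obtain ⟨O, l, hO, hO', hd, S⟩ := H.exists_spec
  rw [det_shift_eq hO hd, linForm_diag hO hd, ← sum_sq_rotate hO v, Finset.mul_sum, Finset.mul_sum,
    Finset.mul_sum]
  refine Finset.sum_le_sum fun a _ => ?_
  have h1 : ∑ i, O i a * w i = (l a + (A + 1)) * ∑ i, O i a * v i := by
    rw [← hvw, add_mul, ← mulVec_rot hO' hd]
    simp only [Matrix.add_mulVec, Matrix.smul_mulVec, Matrix.one_mulVec, Pi.add_apply, Pi.smul_apply,
      smul_eq_mul, mul_add, Finset.sum_add_distrib, Finset.mul_sum]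
    congr 1
    simp only [add_mul, mul_add, one_mul, Finset.sum_add_distrib]
    congr 1
    exact Finset.sum_congr rfl fun i _ => by ring
  have h2 := S.cofactor_sq_le a
  rw [← Finset.mul_prod_erase _ _ (Finset.mem_univ a), h1]
  calc _ = (∏ k ∈ Finset.univ.erase a, (l k + (A + 1))) ^ 2 *
        ((l a + (A + 1)) * ∑ i, O i a * v i) ^ 2 := by ring
    _ ≤ (cofBound n A K * (B * (B - f - l a))) * ((l a + (A + 1)) * ∑ i, O i a * v i) ^ 2 := by gcongr
    _ = _ := by ring

/-- Jacobi inequality. -/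
lemma jacobi (H : IsHess n A K f B h) (hB : 100 * n * offBound n A K ≤ B)
    (T : Fin n → Fin n → Fin n → ℝ) (hT1 : ∀ i j k, T i j k = T j i k)
    (hT2 : ∀ i j k, T i j k = T i k j) (g b : Fin n → ℝ) (hb : ∀ k, b k = ∑ i, T i i k)
    (hg : ∀ k, ∑ i, ∑ j, linCoef (B - f) h i j * T i j k = g k * B) :
    ∑ k, b k ^ 2 + 5 / 4 * (linForm (B - f) h b b / B) ≤
      ∑ i, ∑ j, ∑ k, T i j k ^ 2 + 320 * K ^ 2 * (∑ k, g k ^ 2) * B ^ 2 := by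
  obtain ⟨O, l, hO, hO', hd, S⟩ := H.exists_spec
  have htr : ∀ c, ∑ a, ∑ i, O i a * ∑ j, O j a * ∑ k, O k c * T i j k = ∑ k, O k c * b k := by
    intro c
    have := sum_trace_rot hO (fun i j => ∑ k, O k c * T i j k)
    simp only [Finset.mul_sum] at this ⊢
    rw [this, Finset.sum_comm]
    exact Finset.sum_congr rfl fun k _ => by rw [hb, Finset.mul_sum]
  have hl : ∀ c, ∑ a, l a * ∑ i, O i a * ∑ j, O j a * ∑ k, O k c * T i j k =
      ∑ k, O k c * ∑ i, ∑ j, h i j * T i j k := by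
    intro c
    have := sum_diag_quad hd (fun i j => ∑ k, O k c * T i j k)
    simp only [Finset.mul_sum] at this ⊢
    rw [← this, Finset.sum_comm_cycle]
    exact Finset.sum_congr rfl fun k _ => Finset.sum_congr rfl fun i _ =>
      Finset.sum_congr rfl fun j _ => by ring
  have key := S.jacobi_diag hB (fun a b c => ∑ i, O i a * ∑ j, O j b * ∑ k, O k c * T i j k)
    (by
      intro a b c
      simp only [Finset.mul_sum]
      rw [Finset.sum_comm]
      exact Finset.sum_congr rfl fun i _ => Finset.sum_congr rfl fun j _ =>
        Finset.sum_congr rfl fun k _ => by rw [hT1 i j k]; ring)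
    (by
      intro a b c
      simp only [Finset.mul_sum]
      refine Finset.sum_congr rfl fun i _ => ?_
      rw [Finset.sum_comm]
      exact Finset.sum_congr rfl fun j _ =>
        Finset.sum_congr rfl fun k _ => by rw [hT2 i j k]; ring)
    (fun c => ∑ k, O k c * g k)
    (by
      intro c
      have e1 : ∑ k, (B - f - l k) * ∑ i, O i k * ∑ j, O j k * ∑ m, O m c * T i j m =
          (B - f) * (∑ k, O k c * b k) - ∑ k, O k c * ∑ i, ∑ j, h i j * T i j k := by
        rw [← htr, ← hl, Finset.mul_sum, ← Finset.sum_sub_distrib]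
        exact Finset.sum_congr rfl fun k _ => by ring
      rw [e1, Finset.sum_mul, Finset.mul_sum, ← Finset.sum_sub_distrib]
      refine Finset.sum_congr rfl fun k _ => ?_
      have e2 := hg k
      have e3 : ∑ i, ∑ j, linCoef (B - f) h i j * T i j k =
          (B - f) * b k - ∑ i, ∑ j, h i j * T i j k := by
        unfold linCoef
        simp only [sub_mul _ (h _ _), Finset.sum_sub_distrib, hb, Finset.mul_sum]
        simp
      rw [e3] at e2
      rw [mul_assoc, ← e2]; ring)
  rw [sum_sq_rotate₃ hO, sum_sq_rotate hO] at key
  refine le_trans (le_of_eq ?_) key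
  simp only [htr]
  rw [linForm_diag hO hd, ← sum_sq_rotate hO b, Finset.sum_div, Finset.mul_sum, ← Finset.sum_add_distrib]
  exact Finset.sum_congr rfl fun k _ => by ring

end IsHess

/-- Partial derivative in the direction of the `i`-th basis vector. -/
noncomputable def pd {n : ℕ} (i : Fin n) (g : (Fin n → ℝ) → ℝ) (x : Fin n → ℝ) : ℝ :=
  fderiv ℝ g x (Pi.single i 1)

section pd
variable {n : ℕ} {U : Set (Fin n → ℝ)} {g k : (Fin n → ℝ) → ℝ} {x : Fin n → ℝ}

lemma ContDiffOn.pd_of_isOpen {m m' : WithTop ℕ∞} (hg : ContDiffOn ℝ m' g U) (hU : IsOpen U)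
    (hm : m + 1 ≤ m') (i : Fin n) : ContDiffOn ℝ m (pd i g) U :=
  (hg.fderiv_of_isOpen hU hm).clm_apply contDiffOn_const

lemma ContDiffOn.diffAt {m : WithTop ℕ∞} (hg : ContDiffOn ℝ m g U) (hU : IsOpen U)
    (hm : m ≠ 0) (hx : x ∈ U) : DifferentiableAt ℝ g x :=
  (hg.contDiffAt (hU.mem_nhds hx)).differentiableAt hm

lemma pd_congr (hU : IsOpen U) (h : EqOn g k U) (hx : x ∈ U) (i : Fin n) : pd i g x = pd i k x := by
  unfold pd
  rw [(h.eventuallyEq_of_mem (hU.mem_nhds hx)).fderiv_eq]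

lemma pd_comm (hg : ContDiffOn ℝ 2 g U) (hU : IsOpen U) (hx : x ∈ U) (i j : Fin n) :
    pd i (pd j g) x = pd j (pd i g) x := by
  have h1 : ContDiffAt ℝ 2 g x := hg.contDiffAt (hU.mem_nhds hx)
  have h2 : DifferentiableAt ℝ (fderiv ℝ g) x :=
    ((hg.fderiv_of_isOpen hU (m := 1) (by norm_num)).contDiffAt (hU.mem_nhds hx)).differentiableAt
      (by norm_num)
  have h3 := (h1.isSymmSndFDerivAt (by simp)) (Pi.single i 1) (Pi.single j 1)
  unfold pd
  rw [fderiv_clm_apply h2 (differentiableAt_const _), fderiv_clm_apply h2 (differentiableAt_const _)]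
  simpa using h3

lemma pd_add (hg : DifferentiableAt ℝ g x) (hk : DifferentiableAt ℝ k x) (i : Fin n) :
    pd i (fun y => g y + k y) x = pd i g x + pd i k x := by
  unfold pd
  rw [fderiv_fun_add hg hk]; rfl

lemma pd_sub (hg : DifferentiableAt ℝ g x) (hk : DifferentiableAt ℝ k x) (i : Fin n) :
    pd i (fun y => g y - k y) x = pd i g x - pd i k x := by
  unfold pd
  rw [fderiv_fun_sub hg hk]; rfl

lemma pd_mul (hg : DifferentiableAt ℝ g x) (hk : DifferentiableAt ℝ k x) (i : Fin n) :
    pd i (fun y => g y * k y) x = pd i g x * k x + g x * pd i k x := by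
  unfold pd
  rw [fderiv_fun_mul hg hk]
  simp only [add_apply, smul_apply, smul_eq_mul]
  ring

lemma pd_const_mul (hg : DifferentiableAt ℝ g x) (c : ℝ) (i : Fin n) :
    pd i (fun y => c * g y) x = c * pd i g x := by
  unfold pd
  rw [fderiv_const_mul hg]; rfl

lemma pd_sum {ι : Type*} {s : Finset ι} {G : ι → (Fin n → ℝ) → ℝ}
    (hG : ∀ a ∈ s, DifferentiableAt ℝ (G a) x) (i : Fin n) :
    pd i (fun y => ∑ a ∈ s, G a y) x = ∑ a ∈ s, pd i (G a) x := by
  unfold pd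
  rw [fderiv_fun_sum hG]
  simp

lemma pd_comp {φ : ℝ → ℝ} {φ' : ℝ} (hφ : HasDerivAt φ φ' (g x)) (hg : DifferentiableAt ℝ g x)
    (i : Fin n) : pd i (fun y => φ (g y)) x = φ' * pd i g x := by
  unfold pd
  have := (hφ.comp_hasFDerivAt x hg.hasFDerivAt).fderiv
  rw [show (fun y => φ (g y)) = φ ∘ g from rfl, this]; rfl

lemma pd_inv (hg : DifferentiableAt ℝ g x) (h0 : g x ≠ 0) (i : Fin n) :
    pd i (fun y => (g y)⁻¹) x = - pd i g x / g x ^ 2 := by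
  rw [pd_comp (hasDerivAt_inv h0) hg]
  ring

end pd

noncomputable def hessFn {n : ℕ} (u : (Fin n → ℝ) → ℝ) (x : Fin n → ℝ) :
    Matrix (Fin n) (Fin n) ℝ := fun i j => pd j (pd i u) x

noncomputable def lapFn {n : ℕ} (u : (Fin n → ℝ) → ℝ) (x : Fin n → ℝ) : ℝ := ∑ i, hessFn u x i i

/-- `σ₂/σ₁` of the Hessian. -/
noncomputable def quotFn {n : ℕ} (u : (Fin n → ℝ) → ℝ) (x : Fin n → ℝ) : ℝ :=
  ((lapFn u x) ^ 2 - ∑ i, ∑ j, hessFn u x i j * hessFn u x j i) / 2 / lapFn u x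

noncomputable def thirdFn {n : ℕ} (u : (Fin n → ℝ) → ℝ) (i j k : Fin n) (x : Fin n → ℝ) : ℝ :=
  pd k (pd j (pd i u)) x

/-- Logarithmic gradient of the Laplacian. -/
noncomputable def dlogLap {n : ℕ} (u : (Fin n → ℝ) → ℝ) (x : Fin n → ℝ) (i : Fin n) : ℝ :=
  pd i (lapFn u) x / lapFn u x

/-- The flux field of `log Δu`. -/
noncomputable def fluxFn {n : ℕ} (u : (Fin n → ℝ) → ℝ) (i : Fin n) (x : Fin n → ℝ) : ℝ :=
  (∑ j, linCoef (lapFn u x - quotFn u x) (hessFn u x) i j * dlogLap u x j) - pd i (quotFn u) x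

section identities
variable {n : ℕ} {U : Set (Fin n → ℝ)} {u : (Fin n → ℝ) → ℝ} {x : Fin n → ℝ}

lemma contDiffOn_hessFn (hu : ContDiffOn ℝ 4 u U) (hU : IsOpen U) (i j : Fin n) :
    ContDiffOn ℝ 2 (fun x => hessFn u x i j) U :=
  (hu.pd_of_isOpen (m := 3) hU (by norm_num) i).pd_of_isOpen hU (by norm_num) j

lemma contDiffOn_lapFn (hu : ContDiffOn ℝ 4 u U) (hU : IsOpen U) : ContDiffOn ℝ 2 (lapFn u) U :=
  ContDiffOn.sum fun i _ => contDiffOn_hessFn hu hU i i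

lemma contDiffOn_quotFn (hu : ContDiffOn ℝ 4 u U) (hU : IsOpen U) (hB : ∀ x ∈ U, 0 < lapFn u x) :
    ContDiffOn ℝ 2 (quotFn u) U := by
  refine ContDiffOn.div (ContDiffOn.div_const (((contDiffOn_lapFn hu hU).pow 2).sub ?_) 2)
    (contDiffOn_lapFn hu hU) fun x hx => (hB x hx).ne'
  exact ContDiffOn.sum fun i _ => ContDiffOn.sum fun j _ =>
    (contDiffOn_hessFn hu hU i j).mul (contDiffOn_hessFn hu hU j i)

lemma contDiffOn_thirdFn (hu : ContDiffOn ℝ 4 u U) (hU : IsOpen U) (i j k : Fin n) :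
    ContDiffOn ℝ 1 (thirdFn u i j k) U :=
  (contDiffOn_hessFn hu hU i j).pd_of_isOpen hU (by norm_num) k

lemma hessFn_symm (hu : ContDiffOn ℝ 4 u U) (hU : IsOpen U) (hx : x ∈ U) (i j : Fin n) :
    hessFn u x i j = hessFn u x j i :=
  pd_comm (hu.of_le (by norm_num)) hU hx j i

lemma thirdFn_symm₁ (hu : ContDiffOn ℝ 4 u U) (hU : IsOpen U) (hx : x ∈ U) (i j k : Fin n) :
    thirdFn u i j k x = thirdFn u j i k x :=
  pd_congr hU (fun _ hy => hessFn_symm hu hU hy i j) hx k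

lemma thirdFn_symm₂ (hu : ContDiffOn ℝ 4 u U) (hU : IsOpen U) (hx : x ∈ U) (i j k : Fin n) :
    thirdFn u i j k x = thirdFn u i k j x :=
  pd_comm (hu.pd_of_isOpen (m := 2) hU (by norm_num) i) hU hx k j

lemma pd_lapFn (hu : ContDiffOn ℝ 4 u U) (hU : IsOpen U) (hx : x ∈ U) (k : Fin n) :
    pd k (lapFn u) x = ∑ i, thirdFn u i i k x :=
  pd_sum (fun i _ => (contDiffOn_hessFn hu hU i i).diffAt hU (by norm_num) hx) k

lemma pd_pd_lapFn (hu : ContDiffOn ℝ 4 u U) (hU : IsOpen U) (hx : x ∈ U) (k l : Fin n) :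
    pd l (pd k (lapFn u)) x = ∑ i, pd l (thirdFn u i i k) x := by
  rw [pd_congr hU (fun y hy => pd_lapFn hu hU hy k) hx]
  exact pd_sum (fun i _ => (contDiffOn_thirdFn hu hU i i k).diffAt hU (by norm_num) hx) l

lemma fourth_symm (hu : ContDiffOn ℝ 4 u U) (hU : IsOpen U) (hx : x ∈ U) (i j k : Fin n) :
    pd k (thirdFn u i j k) x = pd j (thirdFn u k k i) x := by
  have h1 : EqOn (thirdFn u i j k) (thirdFn u k i j) U := fun y hy => by
    rw [thirdFn_symm₂ hu hU hy, thirdFn_symm₁ hu hU hy]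
  rw [pd_congr hU h1 hx]
  have h2 := pd_comm (contDiffOn_hessFn hu hU k i) hU hx k j
  have h3 : pd k (thirdFn u k i j) x = pd j (thirdFn u k i k) x := h2
  rw [h3]
  exact pd_congr hU (fun y hy => thirdFn_symm₂ hu hU hy k i k) hx j

lemma quot_eqn (hB : ∀ x ∈ U, 0 < lapFn u x) (hx : x ∈ U) :
    (lapFn u x) ^ 2 - ∑ i, ∑ j, hessFn u x i j * hessFn u x j i = 2 * quotFn u x * lapFn u x := by
  have := (hB x hx).ne'
  unfold quotFn
  field_simp

lemma first_identity (hu : ContDiffOn ℝ 4 u U) (hU : IsOpen U) (hB : ∀ x ∈ U, 0 < lapFn u x)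
    (hx : x ∈ U) (k : Fin n) :
    (lapFn u x - quotFn u x) * pd k (lapFn u) x - ∑ i, ∑ j, hessFn u x i j * thirdFn u i j k x =
      pd k (quotFn u) x * lapFn u x := by
  have dB := (contDiffOn_lapFn hu hU).diffAt hU (by norm_num) hx
  have dq := (contDiffOn_quotFn hu hU hB).diffAt hU (by norm_num) hx
  have dh := fun i j => (contDiffOn_hessFn hu hU i j).diffAt hU (by norm_num) hx
  have e : EqOn (fun y => lapFn u y * lapFn u y - ∑ i, ∑ j, hessFn u y i j * hessFn u y i j)
      (fun y => 2 * (quotFn u y * lapFn u y)) U := fun y hy => by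
    have := quot_eqn hB hy
    simp only
    rw [← mul_assoc, ← this, sq]
    congr 1
    exact Finset.sum_congr rfl fun i _ => Finset.sum_congr rfl fun j _ => by
      rw [hessFn_symm hu hU hy j i]
  have e2 := pd_congr hU e hx k
  rw [pd_const_mul (dq.fun_mul dB), pd_mul dq dB, pd_sub (dB.fun_mul dB), pd_mul dB dB, pd_sum] at e2
  · have : ∀ i, pd k (fun y => ∑ j, hessFn u y i j * hessFn u y i j) x =
        ∑ j, 2 * (hessFn u x i j * thirdFn u i j k x) := by
      intro i
      rw [pd_sum fun j _ => (dh i j).fun_mul (dh i j)]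
      refine Finset.sum_congr rfl fun j _ => ?_
      rw [pd_mul (dh i j) (dh i j)]
      change pd k (pd j (pd i u)) x * _ + _ * pd k (pd j (pd i u)) x = _
      unfold thirdFn; ring
    simp only [this, ← Finset.mul_sum] at e2
    linarith
  · exact fun i _ => DifferentiableAt.fun_sum fun j _ => (dh i j).fun_mul (dh i j)
  · exact DifferentiableAt.fun_sum fun i _ => DifferentiableAt.fun_sum fun j _ => (dh i j).fun_mul (dh i j)

lemma second_identity (hu : ContDiffOn ℝ 4 u U) (hU : IsOpen U) (hB : ∀ x ∈ U, 0 < lapFn u x)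
    (hx : x ∈ U) :
    (lapFn u x - quotFn u x) * (∑ k, pd k (pd k (lapFn u)) x) -
      ∑ i, ∑ j, hessFn u x i j * pd j (pd i (lapFn u)) x =
      (∑ k, pd k (pd k (quotFn u)) x) * lapFn u x + 2 * (∑ k, pd k (quotFn u) x * pd k (lapFn u) x)
      + ∑ i, ∑ j, ∑ k, thirdFn u i j k x ^ 2 - ∑ k, pd k (lapFn u) x ^ 2 := by
  have cB := contDiffOn_lapFn hu hU
  have cq := contDiffOn_quotFn hu hU hB
  have dB := cB.diffAt hU (by norm_num) hx
  have dq := cq.diffAt hU (by norm_num) hx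
  have dB1 := fun k => (cB.pd_of_isOpen (m := 1) hU (by norm_num) k).diffAt hU (by norm_num) hx
  have dq1 := fun k => (cq.pd_of_isOpen (m := 1) hU (by norm_num) k).diffAt hU (by norm_num) hx
  have dh := fun i j => (contDiffOn_hessFn hu hU i j).diffAt hU (by norm_num) hx
  have dT := fun i j k => (contDiffOn_thirdFn hu hU i j k).diffAt hU (by norm_num) hx
  have e : ∀ k, (pd k (lapFn u) x - pd k (quotFn u) x) * pd k (lapFn u) x +
      (lapFn u x - quotFn u x) * pd k (pd k (lapFn u)) x -
      ∑ i, ∑ j, (thirdFn u i j k x ^ 2 + hessFn u x i j * pd j (thirdFn u k k i) x) =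
      pd k (pd k (quotFn u)) x * lapFn u x + pd k (quotFn u) x * pd k (lapFn u) x := by
    intro k
    have e2 := pd_congr hU (fun y hy => first_identity hu hU hB hy k) hx k
    rw [pd_mul (dq1 k) dB, pd_sub ((dB.fun_sub dq).fun_mul (dB1 k)), pd_mul (dB.fun_sub dq) (dB1 k),
      pd_sub dB dq, pd_sum] at e2
    · rw [← e2]
      congr 1
      refine Finset.sum_congr rfl fun i _ => ?_
      rw [pd_sum fun j _ => (dh i j).fun_mul (dT i j k)]
      refine Finset.sum_congr rfl fun j _ => ?_
      rw [pd_mul (dh i j) (dT i j k), ← fourth_symm hu hU hx, sq]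
      rfl
    · exact fun i _ => DifferentiableAt.fun_sum fun j _ => (dh i j).fun_mul (dT i j k)
    · exact DifferentiableAt.fun_sum fun i _ => DifferentiableAt.fun_sum fun j _ =>
        (dh i j).fun_mul (dT i j k)
  have e3 := Finset.sum_congr (rfl : (Finset.univ : Finset (Fin n)) = _) fun k _ => e k
  simp only [Finset.sum_add_distrib, Finset.sum_sub_distrib, sub_mul] at e3
  have e4 : ∑ i, ∑ j, hessFn u x i j * pd j (pd i (lapFn u)) x =
      ∑ k, ∑ i, ∑ j, hessFn u x i j * pd j (thirdFn u k k i) x := by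
    have : ∀ i j, hessFn u x i j * pd j (pd i (lapFn u)) x =
        ∑ k, hessFn u x i j * pd j (thirdFn u k k i) x := fun i j => by
      rw [pd_pd_lapFn hu hU hx, Finset.mul_sum]
    simp only [this]
    rw [Finset.sum_comm_cycle]
  have e5 : ∑ i, ∑ j, ∑ k, thirdFn u i j k x ^ 2 = ∑ k, ∑ i, ∑ j, thirdFn u i j k x ^ 2 := by
    rw [Finset.sum_comm_cycle]
  rw [e4, e5, Finset.sum_mul, Finset.mul_sum]
  simp only [sq, sub_mul, Finset.sum_sub_distrib] at *
  linarith

end identities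

section flux
variable {n : ℕ} {U : Set (Fin n → ℝ)} {u : (Fin n → ℝ) → ℝ} {x : Fin n → ℝ}

lemma contDiffOn_dlogLap (hu : ContDiffOn ℝ 4 u U) (hU : IsOpen U) (hB : ∀ x ∈ U, 0 < lapFn u x)
    (j : Fin n) : ContDiffOn ℝ 1 (fun x => dlogLap u x j) U :=
  ((contDiffOn_lapFn hu hU).pd_of_isOpen (m := 1) hU (by norm_num) j).div
    ((contDiffOn_lapFn hu hU).of_le (by norm_num)) fun x hx => (hB x hx).ne'

lemma contDiffOn_linCoef (hu : ContDiffOn ℝ 4 u U) (hU : IsOpen U) (hB : ∀ x ∈ U, 0 < lapFn u x)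
    (i j : Fin n) :
    ContDiffOn ℝ 1 (fun x => linCoef (lapFn u x - quotFn u x) (hessFn u x) i j) U := by
  unfold linCoef
  refine ContDiffOn.sub ?_ ((contDiffOn_hessFn hu hU i j).of_le (by norm_num))
  split_ifs
  · exact ((contDiffOn_lapFn hu hU).sub (contDiffOn_quotFn hu hU hB)).of_le (by norm_num)
  · exact contDiffOn_const

lemma contDiffOn_fluxFn (hu : ContDiffOn ℝ 4 u U) (hU : IsOpen U) (hB : ∀ x ∈ U, 0 < lapFn u x)
    (i : Fin n) : ContDiffOn ℝ 1 (fluxFn u i) U :=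
  (ContDiffOn.sum fun j _ => (contDiffOn_linCoef hu hU hB i j).mul
    (contDiffOn_dlogLap hu hU hB j)).sub
    ((contDiffOn_quotFn hu hU hB).pd_of_isOpen hU (by norm_num) i)

lemma pd_linCoef (hu : ContDiffOn ℝ 4 u U) (hU : IsOpen U) (hB : ∀ x ∈ U, 0 < lapFn u x)
    (hx : x ∈ U) (i j k : Fin n) :
    pd k (fun x => linCoef (lapFn u x - quotFn u x) (hessFn u x) i j) x =
      (if i = j then pd k (lapFn u) x - pd k (quotFn u) x else 0) - thirdFn u i j k x := by
  have dB := (contDiffOn_lapFn hu hU).diffAt hU (by norm_num) hx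
  have dq := (contDiffOn_quotFn hu hU hB).diffAt hU (by norm_num) hx
  have dh := fun i j => (contDiffOn_hessFn hu hU i j).diffAt hU (by norm_num) hx
  unfold linCoef
  split_ifs with h
  · rw [pd_sub (dB.fun_sub dq) (dh i j), pd_sub dB dq]; rfl
  · rw [pd_sub (differentiableAt_const _) (dh i j)]
    have : pd k (fun _ => (0:ℝ)) x = 0 := by simp [pd]
    rw [this]; rfl

lemma pd_dlogLap (hu : ContDiffOn ℝ 4 u U) (hU : IsOpen U) (hB : ∀ x ∈ U, 0 < lapFn u x)
    (hx : x ∈ U) (j k : Fin n) :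
    pd k (fun x => dlogLap u x j) x =
      pd k (pd j (lapFn u)) x / lapFn u x - dlogLap u x j * dlogLap u x k := by
  have cB := contDiffOn_lapFn hu hU
  have dB := cB.diffAt hU (by norm_num) hx
  have dB1 := (cB.pd_of_isOpen (m := 1) hU (by norm_num) j).diffAt hU (by norm_num) hx
  have h0 := (hB x hx).ne'
  unfold dlogLap
  simp only [div_eq_mul_inv]
  rw [pd_mul dB1 (dB.fun_inv h0), pd_inv dB h0]
  field_simp
  ring

lemma div_fluxFn (hu : ContDiffOn ℝ 4 u U) (hU : IsOpen U) (hB : ∀ x ∈ U, 0 < lapFn u x)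
    (hx : x ∈ U) :
    ∑ i, pd i (fluxFn u i) x =
      (∑ i, ∑ j, ∑ k, thirdFn u i j k x ^ 2 - ∑ k, pd k (lapFn u) x ^ 2) / lapFn u x -
      linForm (lapFn u x - quotFn u x) (hessFn u x) (dlogLap u x) (dlogLap u x) +
      ∑ k, pd k (quotFn u) x * dlogLap u x k := by
  have h0 := (hB x hx).ne'
  have dl := fun j => (contDiffOn_dlogLap hu hU hB j).diffAt hU (by norm_num) hx
  have da := fun i j => (contDiffOn_linCoef hu hU hB i j).diffAt hU (by norm_num) hx
  have dq1 := fun k => ((contDiffOn_quotFn hu hU hB).pd_of_isOpen (m := 1) hU (by norm_num) k).diffAt hU (by norm_num) hx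
  have e1 : ∀ i, pd i (fluxFn u i) x =
      (∑ j, (((if i = j then pd i (lapFn u) x - pd i (quotFn u) x else 0) - thirdFn u i j i x) *
        dlogLap u x j + linCoef (lapFn u x - quotFn u x) (hessFn u x) i j *
        (pd i (pd j (lapFn u)) x / lapFn u x - dlogLap u x j * dlogLap u x i))) -
        pd i (pd i (quotFn u)) x := by
    intro i
    have := pd_sub (DifferentiableAt.fun_sum fun j (_ : j ∈ Finset.univ) => (da i j).fun_mul (dl j)) (dq1 i) i
    refine this.trans ?_
    rw [pd_sum fun j _ => (da i j).fun_mul (dl j)]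
    congr 1
    refine Finset.sum_congr rfl fun j _ => ?_
    rw [pd_mul (da i j) (dl j), pd_linCoef hu hU hB hx, pd_dlogLap hu hU hB hx]
  simp only [e1, Finset.sum_sub_distrib, sub_mul, Finset.sum_add_distrib, mul_sub]
  have e2 : ∑ i, ∑ j, thirdFn u i j i x * dlogLap u x j = ∑ j, pd j (lapFn u) x * dlogLap u x j := by
    rw [Finset.sum_comm]
    refine Finset.sum_congr rfl fun j _ => ?_
    rw [pd_lapFn hu hU hx, Finset.sum_mul]
    exact Finset.sum_congr rfl fun i _ => by rw [thirdFn_symm₂ hu hU hx]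
  have e3 : ∑ i, ∑ j, (if i = j then pd i (lapFn u) x - pd i (quotFn u) x else 0) * dlogLap u x j =
      ∑ j, pd j (lapFn u) x * dlogLap u x j - ∑ j, pd j (quotFn u) x * dlogLap u x j := by
    rw [← Finset.sum_sub_distrib]
    refine Finset.sum_congr rfl fun j _ => ?_
    simp [sub_mul]
  have e4 : ∑ i, ∑ j, linCoef (lapFn u x - quotFn u x) (hessFn u x) i j *
      (pd i (pd j (lapFn u)) x / lapFn u x) =
      ((lapFn u x - quotFn u x) * (∑ k, pd k (pd k (lapFn u)) x) -
      ∑ i, ∑ j, hessFn u x i j * pd j (pd i (lapFn u)) x) / lapFn u x := by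
    rw [sub_div, mul_div_assoc, Finset.sum_div, Finset.sum_div, Finset.mul_sum, ← Finset.sum_sub_distrib]
    refine Finset.sum_congr rfl fun i _ => ?_
    unfold linCoef
    simp only [sub_mul _ (hessFn _ _ _ _), Finset.sum_sub_distrib]
    congr 1
    · simp
    · rw [Finset.sum_div]
      refine Finset.sum_congr rfl fun j _ => ?_
      rw [pd_comm (contDiffOn_lapFn hu hU) hU hx i j]
      ring
  have e5 : ∑ i, ∑ j, linCoef (lapFn u x - quotFn u x) (hessFn u x) i j *
      (dlogLap u x j * dlogLap u x i) =
      linForm (lapFn u x - quotFn u x) (hessFn u x) (dlogLap u x) (dlogLap u x) := by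
    unfold linForm
    exact Finset.sum_congr rfl fun i _ => Finset.sum_congr rfl fun j _ => by ring
  rw [e2, e3, e4, e5, second_identity hu hU hB hx]
  have e6 : ∑ k, pd k (quotFn u) x * pd k (lapFn u) x = (∑ k, pd k (quotFn u) x * dlogLap u x k) * lapFn u x := by
    rw [Finset.sum_mul]
    refine Finset.sum_congr rfl fun k _ => ?_
    unfold dlogLap; field_simp
  rw [e6]
  field_simp
  ring

end flux

/-- A `C⁴` function on `B₄` with a `2`-convex, semi-convex Hessian, whose quotient `σ₂/σ₁` is
controlled in `C¹`. -/
structure IsAdm (n : ℕ) (A K M Λ : ℝ) (u : (Fin n → ℝ) → ℝ) : Prop where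
  hM : 0 < M
  hΛ : 0 < Λ
  smooth : ContDiffOn ℝ 4 u (ball 0 4)
  grad : ∀ x ∈ ball (0 : Fin n → ℝ) 3, ∀ i, |pd i u x| ≤ M
  gradq : ∀ x ∈ ball (0 : Fin n → ℝ) 3, ∀ i, |pd i (quotFn u) x| ≤ Λ
  hess : ∀ x ∈ ball (0 : Fin n → ℝ) 4, IsHess n A K (quotFn u x) (lapFn u x) (hessFn u x)

/-- The energy density `a(D log Δu, D log Δu)`. -/
noncomputable def energy {n : ℕ} (u : (Fin n → ℝ) → ℝ) (x : Fin n → ℝ) : ℝ :=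
  linForm (lapFn u x - quotFn u x) (hessFn u x) (dlogLap u x) (dlogLap u x)

namespace IsAdm
variable {n : ℕ} {A K M Λ : ℝ} {u : (Fin n → ℝ) → ℝ} {x : Fin n → ℝ}

lemma lap_pos (h : IsAdm n A K M Λ u) : ∀ x ∈ ball (0 : Fin n → ℝ) 4, 0 < lapFn u x :=
  fun x hx => (h.hess x hx).pos

lemma sub34 : ball (0 : Fin n → ℝ) 3 ⊆ ball 0 4 := ball_subset_ball (by norm_num)

lemma energy_nonneg (h : IsAdm n A K M Λ u) (hx : x ∈ ball (0 : Fin n → ℝ) 4) : 0 ≤ energy u x :=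
  (h.hess x hx).linForm_nonneg _

lemma gradq_sq (h : IsAdm n A K M Λ u) (hx : x ∈ ball (0 : Fin n → ℝ) 3) :
    ∑ k, pd k (quotFn u) x ^ 2 ≤ n * Λ ^ 2 := by
  calc _ ≤ ∑ _k : Fin n, Λ ^ 2 := Finset.sum_le_sum fun k _ => by
        rw [← sq_abs]; have := h.gradq x hx k; gcongr
    _ = _ := by simp

/-- Weighted Cauchy-Schwarz for `Df · ξ`. -/
lemma gradq_inner (h : IsAdm n A K M Λ u) (hx : x ∈ ball (0 : Fin n → ℝ) 3) (v : Fin n → ℝ)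
    {c : ℝ} (hc : 0 < c) :
    |∑ k, pd k (quotFn u) x * v k| ≤ c * (n * Λ ^ 2) + (∑ k, v k ^ 2) / (4 * c) := by
  calc _ ≤ ∑ k, |pd k (quotFn u) x * v k| := Finset.abs_sum_le_sum_abs _ _
    _ ≤ ∑ k, (c * pd k (quotFn u) x ^ 2 + v k ^ 2 / (4 * c)) := Finset.sum_le_sum fun k _ => by
        rw [abs_mul, ← sq_abs (pd k (quotFn u) x), ← sq_abs (v k), ← sub_nonneg]
        have : c * |pd k (quotFn u) x| ^ 2 + |v k| ^ 2 / (4 * c) - |pd k (quotFn u) x| * |v k| =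
          (2 * c * |pd k (quotFn u) x| - |v k|) ^ 2 / (4 * c) := by field_simp; ring
        rw [this]; positivity
    _ = c * (∑ k, pd k (quotFn u) x ^ 2) + (∑ k, v k ^ 2) / (4 * c) := by
        rw [Finset.sum_add_distrib, Finset.mul_sum, Finset.sum_div]
    _ ≤ _ := by have := h.gradq_sq hx; gcongr

lemma dlog_sq_le (h : IsAdm n A K M Λ u) (hx : x ∈ ball (0 : Fin n → ℝ) 4) :
    ∑ k, dlogLap u x k ^ 2 ≤ 2 * K ^ 2 * (lapFn u x * energy u x) :=
  (h.hess x hx).linForm_lower _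

lemma div_flux_ge (h : IsAdm n A K M Λ u) (hx : x ∈ ball (0 : Fin n → ℝ) 3)
    (hB : 100 * n * offBound n A K ≤ lapFn u x) :
    energy u x / 8 - 324 * K ^ 2 * (n * Λ ^ 2) * lapFn u x ≤ ∑ i, pd i (fluxFn u i) x := by
  have hx4 := sub34 hx
  have H := h.hess x hx4
  have hBp := H.pos
  have hK := H.hK
  rw [div_fluxFn h.smooth isOpen_ball h.lap_pos hx4]
  have J := H.jacobi hB (fun i j k => thirdFn u i j k x)
    (fun i j k => thirdFn_symm₁ h.smooth isOpen_ball hx4 i j k)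
    (fun i j k => thirdFn_symm₂ h.smooth isOpen_ball hx4 i j k)
    (fun k => pd k (quotFn u) x) (fun k => pd k (lapFn u) x)
    (fun k => pd_lapFn h.smooth isOpen_ball hx4 k)
    (fun k => by
      rw [← first_identity h.smooth isOpen_ball h.lap_pos hx4 k, pd_lapFn h.smooth isOpen_ball hx4 k]
      unfold linCoef
      simp only [sub_mul _ (hessFn _ _ _ _), Finset.sum_sub_distrib, Finset.mul_sum]
      simp)
  have e1 : linForm (lapFn u x - quotFn u x) (hessFn u x) (fun k => pd k (lapFn u) x)
      (fun k => pd k (lapFn u) x) = lapFn u x ^ 2 * energy u x := by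
    unfold energy linForm dlogLap
    simp only [Finset.mul_sum]
    exact Finset.sum_congr rfl fun i _ => Finset.sum_congr rfl fun j _ => by field_simp
  rw [e1] at J
  have J2 : 5 / 4 * energy u x - 320 * K ^ 2 * (n * Λ ^ 2) * lapFn u x ≤
      (∑ i, ∑ j, ∑ k, thirdFn u i j k x ^ 2 - ∑ k, pd k (lapFn u) x ^ 2) / lapFn u x := by
    rw [le_div_iff₀ hBp]
    have e2 : 5 / 4 * (lapFn u x ^ 2 * energy u x / lapFn u x) = 5 / 4 * energy u x * lapFn u x := by
      field_simp
    rw [e2] at J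
    have : 320 * K ^ 2 * (∑ k, pd k (quotFn u) x ^ 2) * lapFn u x ^ 2 ≤
        320 * K ^ 2 * (n * Λ ^ 2) * lapFn u x ^ 2 := by
      have := h.gradq_sq hx; gcongr
    linarith
  have G := h.gradq_inner hx (dlogLap u x) (c := 4 * K ^ 2 * lapFn u x) (by positivity)
  have D := h.dlog_sq_le hx4
  have D2 : (∑ k, dlogLap u x k ^ 2) / (4 * (4 * K ^ 2 * lapFn u x)) ≤ energy u x / 8 := by
    rw [div_le_iff₀ (by positivity)]
    linarith
  have G2 := (abs_le.1 G).1
  change _ ≤ _ - energy u x + _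
  linarith

end IsAdm

section integration
open MeasureTheory
variable {n : ℕ} {U : Set (Fin n → ℝ)} {g w : (Fin n → ℝ) → ℝ} 

lemma continuous_mul_of_tsupport (hU : IsOpen U) (hg : ContinuousOn g U) (hw : Continuous w)
    (hs : tsupport w ⊆ U) : Continuous fun x => g x * w x :=
  continuous_of_tsupport fun x hx =>
    (hg.continuousAt (hU.mem_nhds (hs (tsupport_mul_subset_right hx)))).mul hw.continuousAt

lemma integrable_mul_of_tsupport (hU : IsOpen U) (hg : ContinuousOn g U) (hw : Continuous w)
    (hc : HasCompactSupport w) (hs : tsupport w ⊆ U) : Integrable fun x => g x * w x :=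
  (continuous_mul_of_tsupport hU hg hw hs).integrable_of_hasCompactSupport hc.mul_left

lemma contDiff_mul_of_tsupport (hU : IsOpen U) (hg : ContDiffOn ℝ 1 g U) (hw : ContDiff ℝ 1 w)
    (hs : tsupport w ⊆ U) : ContDiff ℝ 1 fun x => g x * w x := by
  rw [contDiff_iff_contDiffAt]
  intro x
  by_cases hx : x ∈ tsupport w
  · exact (hg.contDiffAt (hU.mem_nhds (hs hx))).mul hw.contDiffAt
  · have : (fun x => g x * w x) =ᶠ[nhds x] fun _ => 0 := by
      filter_upwards [notMem_tsupport_iff_eventuallyEq.1 hx] with y hy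
      simp [hy]
    exact contDiffAt_const.congr_of_eventuallyEq this

lemma continuous_pd (hg : ContDiff ℝ 1 g) (i : Fin n) : Continuous (pd i g) := by
  unfold pd
  exact (hg.continuous_fderiv (by norm_num)).clm_apply continuous_const

lemma tsupport_pd_subset (i : Fin n) : tsupport (pd i g) ⊆ tsupport g :=
  tsupport_fderiv_apply_subset ℝ _

lemma integral_pd_eq_zero (hg : ContDiff ℝ 1 g) (hc : HasCompactSupport g) (i : Fin n) :
    ∫ x, pd i g x = 0 := by
  have h1 : Integrable (pd i g) := (continuous_pd hg i).integrable_of_hasCompactSupport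
    (hc.of_isClosed_subset (isClosed_tsupport _) (tsupport_pd_subset i))
  have h2 := hg.continuous.integrable_of_hasCompactSupport (μ := volume) hc
  have := integral_mul_fderiv_eq_neg_fderiv_mul_of_integrable (μ := volume) (f := fun _ : Fin n → ℝ => (1:ℝ)) (g := g)
    (v := Pi.single i 1) (by simp) (by simp only [one_mul]; exact h1) (by simpa using h2)
    (fun x _ => differentiableAt_const _) (fun x _ => hg.differentiable (by norm_num) x)
  simpa [pd] using this

/-- The divergence theorem for a compactly supported field. -/
lemma integral_div_eq_zero {V : Fin n → (Fin n → ℝ) → ℝ} (hV : ∀ i, ContDiff ℝ 1 (V i))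
    (hc : ∀ i, HasCompactSupport (V i)) : ∫ x, ∑ i, pd i (V i) x = 0 := by
  rw [integral_finsetSum]
  · exact Finset.sum_eq_zero fun i _ => integral_pd_eq_zero (hV i) (hc i) i
  · exact fun i _ => (continuous_pd (hV i) i).integrable_of_hasCompactSupport
      ((hc i).of_isClosed_subset (isClosed_tsupport _) (tsupport_pd_subset i))

end integration

section gam

lemma hasDerivAt_sq_max (t : ℝ) : HasDerivAt (fun t : ℝ => max t 0 ^ 2) (2 * max t 0) t := by
  rcases lt_trichotomy t 0 with h | h | h
  · rw [max_eq_right h.le, mul_zero]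
    refine (hasDerivAt_const t (0:ℝ)).congr_of_eventuallyEq ?_
    filter_upwards [Iio_mem_nhds h] with s hs
    simp [max_eq_right (le_of_lt (mem_Iio.1 hs))]
  · subst h
    rw [hasDerivAt_iff_isLittleO]
    simp only [max_self, mul_zero, sub_zero, smul_eq_mul, ne_eq, OfNat.ofNat_ne_zero,
      not_false_eq_true, zero_pow]
    have : (fun t : ℝ => max t 0 ^ 2) =O[nhds 0] fun t => t ^ 2 := by
      refine Asymptotics.isBigO_of_le _ fun t => ?_
      rw [Real.norm_of_nonneg (by positivity), Real.norm_of_nonneg (by positivity), ← sq_abs t]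
      gcongr
      exact max_le (le_abs_self t) (abs_nonneg t)
    exact this.trans_isLittleO (by simpa using Asymptotics.isLittleO_pow_id (𝕜 := ℝ) (n := 2) (by norm_num))
  · rw [max_eq_left h.le]
    have := hasDerivAt_pow 2 t
    simp only [Nat.cast_ofNat, Nat.add_one_sub_one, pow_one] at this
    refine this.congr_of_eventuallyEq ?_
    filter_upwards [Ioi_mem_nhds h] with s hs
    rw [max_eq_left (le_of_lt (mem_Ioi.1 hs))]

/-- A `C¹` regularization of `1 + t₊`. -/
noncomputable def gam (t : ℝ) : ℝ := √(1 + max t 0 ^ 2)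

/-- The derivative of `gam`. -/
noncomputable def gamD (t : ℝ) : ℝ := max t 0 / gam t

lemma one_le_gam (t : ℝ) : 1 ≤ gam t := Real.one_le_sqrt.2 (by nlinarith [sq_nonneg (max t 0)])

lemma gam_pos (t : ℝ) : 0 < gam t := zero_lt_one.trans_le (one_le_gam t)

lemma gam_sq (t : ℝ) : gam t ^ 2 = 1 + max t 0 ^ 2 := Real.sq_sqrt (by positivity)

lemma hasDerivAt_gam (t : ℝ) : HasDerivAt gam (gamD t) t := by
  have := ((hasDerivAt_sq_max t).const_add 1).sqrt (by positivity)
  refine HasDerivAt.congr_deriv this ?_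
  unfold gamD gam
  field_simp

lemma continuous_gam : Continuous gam := by unfold gam; fun_prop

lemma continuous_gamD : Continuous gamD :=
  (continuous_id.max continuous_const).div continuous_gam fun t => (gam_pos t).ne'

lemma gamD_nonneg (t : ℝ) : 0 ≤ gamD t := div_nonneg (le_max_right _ _) (gam_pos t).le

lemma gamD_le_one (t : ℝ) : gamD t ≤ 1 := by
  unfold gamD
  rw [div_le_one (gam_pos t)]
  exact Real.le_sqrt_of_sq_le (by linarith)

lemma gamD_sq (t : ℝ) : gamD t ^ 2 = 1 - (gam t ^ 2)⁻¹ := by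
  have h := gam_sq t
  have := gam_pos t
  unfold gamD
  rw [div_pow]
  field_simp
  linarith

lemma gamD_of_nonpos {t : ℝ} (h : t ≤ 0) : gamD t = 0 := by simp [gamD, max_eq_right h]

lemma gam_of_nonpos {t : ℝ} (h : t ≤ 0) : gam t = 1 := by simp [gam, max_eq_right h]

lemma le_gam (t : ℝ) : t ≤ gam t :=
  (le_max_left t 0).trans (Real.le_sqrt_of_sq_le (by linarith))

lemma contDiff_gam : ContDiff ℝ 1 gam := by
  rw [contDiff_one_iff_deriv]
  refine ⟨fun t => (hasDerivAt_gam t).differentiableAt, ?_⟩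
  rw [show deriv gam = gamD from funext fun t => (hasDerivAt_gam t).deriv]
  exact continuous_gamD

/-- The weight `(γ')² γ^p`. -/
noncomputable def gamW (p t : ℝ) : ℝ := gam t ^ p - gam t ^ (p - 2)

/-- The derivative of `gamW`. -/
noncomputable def gamW' (p t : ℝ) : ℝ :=
  (p * gam t ^ (p - 1) - (p - 2) * gam t ^ (p - 2 - 1)) * gamD t

lemma gamW_eq (p t : ℝ) : gamW p t = gamD t ^ 2 * gam t ^ p := by
  have := gam_pos t
  unfold gamW
  rw [gamD_sq, Real.rpow_sub this, Real.rpow_two]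
  field_simp

lemma gamW_nonneg (p t : ℝ) : 0 ≤ gamW p t := by
  have := gam_pos t
  rw [gamW_eq]; positivity

lemma gamW_le (p t : ℝ) : gamW p t ≤ gam t ^ p := by
  have := gam_pos t
  unfold gamW
  have : 0 < gam t ^ (p - 2) := by positivity
  linarith

lemma hasDerivAt_gamW (p t : ℝ) : HasDerivAt (gamW p) (gamW' p t) t := by
  have h := (gam_pos t).ne'
  have := ((hasDerivAt_gam t).rpow_const (p := p) (Or.inl h)).sub
    ((hasDerivAt_gam t).rpow_const (p := p - 2) (Or.inl h))
  refine this.congr_deriv ?_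
  unfold gamW'
  ring

lemma gamW'_nonneg {p : ℝ} (hp : 0 ≤ p) (t : ℝ) : 0 ≤ gamW' p t := by
  have h := gam_pos t
  refine mul_nonneg ?_ (gamD_nonneg t)
  have : gam t ^ (p - 1) = gam t ^ (p - 2 - 1) * gam t ^ 2 := by
    rw [← Real.rpow_two, ← Real.rpow_add h]; ring_nf
  rw [this, gam_sq]
  have h2 : 0 < gam t ^ (p - 2 - 1) := by positivity
  nlinarith [mul_nonneg hp (mul_nonneg h2.le (sq_nonneg (max t 0)))]

lemma gamW'_le {p : ℝ} (hp : 0 ≤ p) (t : ℝ) : gamW' p t ≤ (p + 2) * gam t ^ p := by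
  have h1 : gam t ^ (p - 1) ≤ gam t ^ p := Real.rpow_le_rpow_of_exponent_le (one_le_gam t) (by linarith)
  have h2 : gam t ^ (p - 2 - 1) ≤ gam t ^ p := Real.rpow_le_rpow_of_exponent_le (one_le_gam t) (by linarith)
  have h := gam_pos t
  have h3 : 0 < gam t ^ (p - 2 - 1) := by positivity
  have h4 : 0 < gam t ^ p := by positivity
  have hD := gamD_nonneg t
  have hD1 := gamD_le_one t
  unfold gamW'
  have : p * gam t ^ (p - 1) - (p - 2) * gam t ^ (p - 2 - 1) ≤ (p + 2) * gam t ^ p := by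
    nlinarith [mul_le_mul_of_nonneg_left h1 hp, mul_nonneg hp h3.le]
  calc _ ≤ ((p + 2) * gam t ^ p) * gamD t := by gcongr
    _ ≤ ((p + 2) * gam t ^ p) * 1 := by gcongr
    _ = _ := mul_one _

lemma contDiff_gam_rpow (p : ℝ) : ContDiff ℝ 1 fun t => gam t ^ p :=
  contDiff_gam.rpow_const_of_ne fun t => (gam_pos t).ne'

lemma contDiff_gamW (p : ℝ) : ContDiff ℝ 1 (gamW p) :=
  (contDiff_gam_rpow p).sub (contDiff_gam_rpow (p - 2))

end gam

/-- A `C¹` cutoff function supported in `B₃`. -/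
structure IsCut (n : ℕ) (L : ℝ) (η : (Fin n → ℝ) → ℝ) : Prop where
  hL : 0 < L
  smooth : ContDiff ℝ 1 η
  nonneg : ∀ x, 0 ≤ η x
  le_one : ∀ x, η x ≤ 1
  compact : HasCompactSupport η
  sub : tsupport η ⊆ ball 0 3
  grad : ∀ x i, |pd i η x| ≤ L

namespace IsCut
variable {n : ℕ} {L s : ℝ} {η : (Fin n → ℝ) → ℝ} {x : Fin n → ℝ}

lemma diff (h : IsCut n L η) : DifferentiableAt ℝ η x := h.smooth.differentiable (by norm_num) x

lemma smooth_rpow (h : IsCut n L η) (hs : 1 ≤ s) : ContDiff ℝ 1 fun x => η x ^ s :=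
  ContDiff.rpow_const_of_le (m := 1) h.smooth (by simpa using hs)

lemma tsupport_rpow (_h : IsCut n L η) (hs : s ≠ 0) : tsupport (fun x => η x ^ s) ⊆ tsupport η := by
  refine closure_mono fun x hx => ?_
  contrapose! hx
  simp only [Function.mem_support, not_not] at hx
  simp [hx, Real.zero_rpow hs]

lemma compact_rpow (h : IsCut n L η) (hs : s ≠ 0) : HasCompactSupport fun x => η x ^ s :=
  h.compact.of_isClosed_subset (isClosed_tsupport _) (h.tsupport_rpow hs)

lemma sub_rpow (h : IsCut n L η) (hs : s ≠ 0) : tsupport (fun x => η x ^ s) ⊆ ball 0 3 :=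
  (h.tsupport_rpow hs).trans h.sub

lemma pd_rpow (h : IsCut n L η) (hs : 1 ≤ s) (i : Fin n) :
    pd i (fun x => η x ^ s) x = s * η x ^ (s - 1) * pd i η x :=
  pd_comp (Real.hasDerivAt_rpow_const (Or.inr hs)) h.diff i

lemma grad_sq (h : IsCut n L η) : ∑ i, pd i η x ^ 2 ≤ n * L ^ 2 := by
  calc _ ≤ ∑ _k : Fin n, L ^ 2 := Finset.sum_le_sum fun k _ => by
        rw [← sq_abs]; have := h.grad x k; gcongr
    _ = _ := by simp

lemma eq_zero (h : IsCut n L η) (hx : x ∉ ball (0 : Fin n → ℝ) 3) : η x = 0 := by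
  by_contra h0
  exact hx (h.sub (subset_tsupport _ h0))

lemma continuous_rpow (h : IsCut n L η) (hs : 0 ≤ s) : Continuous fun x => η x ^ s :=
  h.smooth.continuous.rpow_const fun _ => Or.inr hs

end IsCut

/-- `log (Δu / m)`. -/
noncomputable def logLap {n : ℕ} (u : (Fin n → ℝ) → ℝ) (m : ℝ) (x : Fin n → ℝ) : ℝ :=
  Real.log (lapFn u x / m)

/-- The constant in the weighted energy inequality. -/
noncomputable def cacConst (n : ℕ) (A K Λ L : ℝ) : ℝ :=
  324 * K ^ 2 * (n * Λ ^ 2) + K ^ 2 * (n * Λ ^ 2) / 2 + 4 * (1 + A * K / 2) * (n * L ^ 2) +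
    n * Λ * L * K / 2

lemma linForm_add_smul {n : ℕ} {c : ℝ} {h : Matrix (Fin n) (Fin n) ℝ} (hs : ∀ i j, h i j = h j i)
    (v w : Fin n → ℝ) (r q : ℝ) :
    linForm c h (fun i => r * v i + q * w i) (fun i => r * v i + q * w i) =
      r ^ 2 * linForm c h v v + 2 * r * q * linForm c h w v + q ^ 2 * linForm c h w w := by
  have e : linForm c h v w = linForm c h w v := by
    unfold linForm
    rw [Finset.sum_comm]
    refine Finset.sum_congr rfl fun i _ => Finset.sum_congr rfl fun j _ => ?_
    have : linCoef c h i j = linCoef c h j i := by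
      unfold linCoef; rw [hs i j]; simp only [eq_comm]
    rw [this]; ring
  have : 2 * r * q * linForm c h w v = r * q * linForm c h w v + r * q * linForm c h v w := by
    rw [e]; ring
  rw [this]
  unfold linForm
  simp only [Finset.mul_sum, ← Finset.sum_add_distrib]
  exact Finset.sum_congr rfl fun i _ => Finset.sum_congr rfl fun j _ => by ring

namespace IsAdm
variable {n : ℕ} {A K M Λ L m s p : ℝ} {u η : (Fin n → ℝ) → ℝ} {x : Fin n → ℝ}

lemma K_pos (h : IsAdm n A K M Λ u) : 0 < K := (h.hess 0 (by simp)).hK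

lemma A_pos (h : IsAdm n A K M Λ u) : 0 < A := (h.hess 0 (by simp)).hA

lemma one_le_n (h : IsAdm n A K M Λ u) : 1 ≤ n := by
  have := (h.hess 0 (by simp)).hn; omega

lemma one_le_lap (h : IsAdm n A K M Λ u) (hx : x ∈ ball (0 : Fin n → ℝ) 4) :
    1 ≤ K * lapFn u x / 2 := by
  obtain ⟨O, l, -, -, -, hl⟩ := (h.hess x hx).exists_spec
  have := hl.two_div_le
  rw [div_le_iff₀ h.K_pos] at this
  linarith

lemma cacConst_pos (h : IsAdm n A K M Λ u) (c : IsCut n L η) : 0 < cacConst n A K Λ L := by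
  have := h.K_pos
  have := h.A_pos
  have := h.hΛ
  have := c.hL
  have h1 := h.one_le_n
  have : (0 : ℝ) < n := by exact_mod_cast h1
  unfold cacConst
  positivity

lemma contDiffOn_energy (h : IsAdm n A K M Λ u) : ContDiffOn ℝ 1 (energy u) (ball 0 4) := by
  unfold energy linForm
  exact ContDiffOn.sum fun i _ => ContDiffOn.sum fun j _ =>
    ((contDiffOn_dlogLap h.smooth isOpen_ball h.lap_pos i).mul
      (contDiffOn_linCoef h.smooth isOpen_ball h.lap_pos i j)).mul
      (contDiffOn_dlogLap h.smooth isOpen_ball h.lap_pos j)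

lemma contDiffOn_lap (h : IsAdm n A K M Λ u) : ContDiffOn ℝ 1 (lapFn u) (ball 0 4) :=
  (contDiffOn_lapFn h.smooth isOpen_ball).of_le (by norm_num)

lemma contDiffOn_logLap (h : IsAdm n A K M Λ u) (hm : 0 < m) :
    ContDiffOn ℝ 1 (logLap u m) (ball 0 4) :=
  (h.contDiffOn_lap.div_const m).log fun x hx => (div_pos (h.lap_pos x hx) hm).ne'

lemma diff_logLap (h : IsAdm n A K M Λ u) (hm : 0 < m) (hx : x ∈ ball (0 : Fin n → ℝ) 4) :
    DifferentiableAt ℝ (logLap u m) x :=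
  (h.contDiffOn_logLap hm).diffAt isOpen_ball (by norm_num) hx

lemma pd_logLap (h : IsAdm n A K M Λ u) (hm : 0 < m) (hx : x ∈ ball (0 : Fin n → ℝ) 4) (i : Fin n) :
    pd i (logLap u m) x = dlogLap u x i := by
  have hB := h.lap_pos x hx
  have hd : DifferentiableAt ℝ (lapFn u) x := h.contDiffOn_lap.diffAt isOpen_ball (by norm_num) hx
  have h1 : HasDerivAt (fun t => Real.log (t / m)) (1 / lapFn u x) (lapFn u x) := by
    have := ((hasDerivAt_id (lapFn u x)).div_const m).log (div_pos hB hm).ne'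
    refine this.congr_deriv ?_
    simp only [id]
    field_simp
  have := pd_comp h1 hd i
  unfold dlogLap
  rw [show logLap u m = fun y => Real.log (lapFn u y / m) from rfl, this]
  ring

lemma lap_ge_of_logLap_pos (h : IsAdm n A K M Λ u) (hm : 0 < m) (hx : x ∈ ball (0 : Fin n → ℝ) 4)
    (ht : 0 < logLap u m x) : m ≤ lapFn u x := by
  have := (Real.log_pos_iff (div_pos (h.lap_pos x hx) hm).le).1 ht
  rw [lt_div_iff₀ hm, one_mul] at this
  exact this.le

lemma dlog_flux_ge (h : IsAdm n A K M Λ u) (hx : x ∈ ball (0 : Fin n → ℝ) 3) :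
    -(K ^ 2 * (n * Λ ^ 2) / 2 * lapFn u x) ≤ ∑ i, dlogLap u x i * fluxFn u i x := by
  have hB := h.lap_pos x (sub34 hx)
  have hK := h.K_pos
  have e1 : ∑ i, dlogLap u x i * fluxFn u i x =
      energy u x - ∑ k, pd k (quotFn u) x * dlogLap u x k := by
    unfold energy linForm fluxFn
    rw [← Finset.sum_sub_distrib]
    refine Finset.sum_congr rfl fun i _ => ?_
    rw [mul_sub, Finset.mul_sum]
    simp only [mul_assoc]
    ring
  have G := h.gradq_inner hx (dlogLap u x) (c := K ^ 2 * lapFn u x / 2) (by positivity)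
  have D := h.dlog_sq_le (sub34 hx)
  have D2 : (∑ k, dlogLap u x k ^ 2) / (4 * (K ^ 2 * lapFn u x / 2)) ≤ energy u x := by
    rw [div_le_iff₀ (by positivity)]
    linarith
  have G2 := (abs_le.1 G).2
  rw [e1]
  linarith

lemma grad_flux_ge (h : IsAdm n A K M Λ u) (c : IsCut n L η) (hx : x ∈ ball (0 : Fin n → ℝ) 3)
    (hs : 0 < s) :
    -(η x ^ 2 * energy u x / 16) - 4 * s ^ 2 * ((1 + A * K / 2) * (n * L ^ 2)) * lapFn u x -
      s * η x * (n * Λ * L * K / 2) * lapFn u x ≤ s * η x * ∑ i, pd i η x * fluxFn u i x := by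
  have hB := h.lap_pos x (sub34 hx)
  have hK := h.K_pos
  have hA := h.A_pos
  have hη := c.nonneg x
  have e1 : ∑ i, pd i η x * fluxFn u i x =
      linForm (lapFn u x - quotFn u x) (hessFn u x) (fun i => pd i η x) (dlogLap u x) -
      ∑ k, pd k η x * pd k (quotFn u) x := by
    unfold linForm fluxFn
    rw [← Finset.sum_sub_distrib]
    refine Finset.sum_congr rfl fun i _ => ?_
    rw [mul_sub, Finset.mul_sum]
    simp only [mul_assoc]
  have H := h.hess x (sub34 hx)
  have P := H.linForm_nonneg (fun i => η x / 4 * dlogLap u x i + 2 * s * pd i η x)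
  rw [linForm_add_smul H.symm] at P
  have Q := H.linForm_upper (fun i => pd i η x)
  have Q2 : (1 + A * K / 2) * lapFn u x * ∑ i, pd i η x ^ 2 ≤
      (1 + A * K / 2) * lapFn u x * (n * L ^ 2) := by
    have := c.grad_sq (x := x); gcongr
  have R : ∑ k, pd k η x * pd k (quotFn u) x ≤ n * Λ * L * K / 2 * lapFn u x := by
    calc _ ≤ ∑ _k : Fin n, L * Λ := Finset.sum_le_sum fun k _ => by
          refine (le_abs_self _).trans ?_
          rw [abs_mul]
          exact mul_le_mul (c.grad x k) (h.gradq x hx k) (abs_nonneg _) c.hL.le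
      _ = n * Λ * L * 1 := by simp; ring
      _ ≤ n * Λ * L * (K * lapFn u x / 2) := by
          have := h.one_le_lap (sub34 hx)
          have := h.hΛ
          have := c.hL
          gcongr
      _ = _ := by ring
  have R2 := mul_le_mul_of_nonneg_left R (by positivity : 0 ≤ s * η x)
  have Q3 := mul_le_mul_of_nonneg_left (Q.trans Q2) (by positivity : 0 ≤ 4 * s ^ 2)
  rw [e1]
  unfold energy
  nlinarith [P, Q3, R2]

set_option maxHeartbeats 1000000 in
/-- Pointwise divergence lower bound behind the weighted energy inequality. -/
lemma div_weighted_ge (h : IsAdm n A K M Λ u) (c : IsCut n L η) (hm0 : 0 < m)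
    (hm : 100 * n * offBound n A K ≤ m) (hp : 0 ≤ p) (hs : 3 ≤ s) (x : Fin n → ℝ) :
    gamD (logLap u m x) ^ 2 * energy u x * gam (logLap u m x) ^ p * η x ^ s / 16 -
      cacConst n A K Λ L * (p + s ^ 2) * (lapFn u x * gam (logLap u m x) ^ p * η x ^ (s - 2)) ≤
    ∑ i, pd i (fun x => gamW p (logLap u m x) * fluxFn u i x * η x ^ s) x := by
  by_cases hx : x ∈ ball (0 : Fin n → ℝ) 3
  swap
  · have h0 := c.eq_zero hx
    have : ∀ i, pd i (fun x => gamW p (logLap u m x) * fluxFn u i x * η x ^ s) x = 0 := by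
      intro i
      refine image_eq_zero_of_notMem_tsupport fun hh => hx ?_
      exact c.sub_rpow (by linarith) (tsupport_mul_subset_right (tsupport_pd_subset i hh))
    simp only [this, h0]
    rw [Real.zero_rpow (by linarith), Real.zero_rpow (by linarith)]
    simp
  have hx4 := sub34 hx
  have hη := c.nonneg x
  have hη1 := c.le_one x
  have hB := h.lap_pos x hx4
  have hC := h.cacConst_pos c
  set t := logLap u m x with ht
  have hg := gam_pos t
  have key : ∑ i, pd i (fun x => gamW p (logLap u m x) * fluxFn u i x * η x ^ s) x =
      gamW p t * η x ^ s * ∑ i, pd i (fluxFn u i) x +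
      gamW' p t * η x ^ s * ∑ i, dlogLap u x i * fluxFn u i x +
      gamW p t * (s * η x ^ (s - 1) * ∑ i, pd i η x * fluxFn u i x) := by
    simp only [Finset.mul_sum, ← Finset.sum_add_distrib]
    refine Finset.sum_congr rfl fun i _ => ?_
    have d1 : DifferentiableAt ℝ (fun x => gamW p (logLap u m x)) x :=
      (hasDerivAt_gamW p _).differentiableAt.comp x (h.diff_logLap hm0 hx4)
    have d2 : DifferentiableAt ℝ (fluxFn u i) x :=
      (contDiffOn_fluxFn h.smooth isOpen_ball h.lap_pos i).diffAt isOpen_ball (by norm_num) hx4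
    have d3 : DifferentiableAt ℝ (fun x => η x ^ s) x :=
      (c.smooth_rpow (by linarith)).differentiable (by norm_num) x
    rw [pd_mul (d1.fun_mul d2) d3, pd_mul d1 d2, c.pd_rpow (by linarith),
      pd_comp (hasDerivAt_gamW p _) (h.diff_logLap hm0 hx4), h.pd_logLap hm0 hx4]
    ring
  rw [key]
  have eE : η x ^ s = η x ^ (s - 2) * η x ^ 2 := by
    rw [← Real.rpow_two, ← Real.rpow_add_of_nonneg hη (by linarith) (by norm_num)]
    ring_nf
  have eE1 : η x ^ (s - 1) = η x ^ (s - 2) * η x := by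
    nth_rewrite 3 [← Real.rpow_one (η x)]
    rw [← Real.rpow_add_of_nonneg hη (by linarith) (by norm_num)]
    ring_nf
  have hE : 0 ≤ η x ^ (s - 2) := by positivity
  rw [eE, eE1]
  set E := η x ^ (s - 2) with hEd
  set G := gam t ^ p with hGd
  have hG : 0 < G := by positivity
  rcases le_or_gt t 0 with h0 | h0
  · have z : gamD t = 0 := gamD_of_nonpos h0
    rw [gamW_eq, z]
    unfold gamW'
    rw [z]
    have : 0 ≤ cacConst n A K Λ L * (p + s ^ 2) * (lapFn u x * G * E) := by positivity
    simp only [ne_eq, OfNat.ofNat_ne_zero, not_false_eq_true, zero_pow, zero_mul, mul_zero, zero_div,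
      add_zero]
    linarith
  have hBm := hm.trans (h.lap_ge_of_logLap_pos hm0 hx4 h0)
  have I1 := h.div_flux_ge hx hBm
  have I2 := h.dlog_flux_ge hx
  have I3 := h.grad_flux_ge c hx (s := s) (by linarith)
  have hW : 0 ≤ gamW p t := gamW_nonneg p t
  have hW1 : gamW p t ≤ G := gamW_le p t
  have hW' := gamW'_nonneg hp t
  have hW1' : gamW' p t ≤ (p + 2) * G := gamW'_le hp t
  rw [← mul_right_comm (gamD t ^ 2) G (energy u x), ← gamW_eq]
  have J1 := mul_le_mul_of_nonneg_left I1 (by positivity : 0 ≤ gamW p t * (E * η x ^ 2))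
  have J2 := mul_le_mul_of_nonneg_left I2 (by positivity : 0 ≤ gamW' p t * (E * η x ^ 2))
  have J3 := mul_le_mul_of_nonneg_left I3 (by positivity : 0 ≤ gamW p t * E)
  have hK := h.K_pos
  have hA := h.A_pos
  have hΛ := h.hΛ
  have hL := c.hL
  have hη2 : η x ^ 2 ≤ 1 := pow_le_one₀ hη hη1
  set C1 := 324 * K ^ 2 * (n * Λ ^ 2) with hC1
  set C2 := K ^ 2 * (n * Λ ^ 2) / 2 with hC2
  set C3 := (1 + A * K / 2) * (n * L ^ 2) with hC3
  set C4 := n * Λ * L * K / 2 with hC4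
  have p1 : 0 ≤ C1 := by positivity
  have p2 : 0 ≤ C2 := by positivity
  have p3 : 0 ≤ C3 := by positivity
  have p4 : 0 ≤ C4 := by positivity
  have eC : cacConst n A K Λ L = C1 + C2 + 4 * C3 + C4 := by unfold cacConst; ring
  rw [eC]
  have hs2 : 3 ^ 2 ≤ s ^ 2 := by gcongr
  have hs3 : s * 1 ≤ s * s := by gcongr; linarith
  rw [← sq] at hs3
  have k1 : gamW p t * (E * η x ^ 2) * (C1 * lapFn u x) ≤ C1 * (p + s ^ 2) * (lapFn u x * G * E) := by
    calc _ ≤ G * (E * 1) * (C1 * lapFn u x) := by gcongr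
      _ = C1 * 1 * (lapFn u x * G * E) := by ring
      _ ≤ _ := by gcongr; linarith
  have k2 : gamW' p t * (E * η x ^ 2) * (C2 * lapFn u x) ≤ C2 * (p + s ^ 2) * (lapFn u x * G * E) := by
    calc _ ≤ ((p + 2) * G) * (E * 1) * (C2 * lapFn u x) := by gcongr
      _ = C2 * (p + 2) * (lapFn u x * G * E) := by ring
      _ ≤ _ := by gcongr; linarith
  have k3 : gamW p t * E * (4 * s ^ 2 * C3 * lapFn u x) ≤
      4 * C3 * (p + s ^ 2) * (lapFn u x * G * E) := by
    calc _ ≤ G * E * (4 * s ^ 2 * C3 * lapFn u x) := by gcongr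
      _ = 4 * C3 * (s ^ 2) * (lapFn u x * G * E) := by ring
      _ ≤ _ := by gcongr; linarith
  have k4 : gamW p t * E * (s * η x * C4 * lapFn u x) ≤
      C4 * (p + s ^ 2) * (lapFn u x * G * E) := by
    calc _ ≤ G * E * (s * 1 * C4 * lapFn u x) := by gcongr
      _ = C4 * s * (lapFn u x * G * E) := by ring
      _ ≤ _ := by gcongr; linarith
  have hfin : gamW p t * energy u x * (E * η x ^ 2) / 16 -
      (C1 + C2 + 4 * C3 + C4) * (p + s ^ 2) * (lapFn u x * G * E) ≤
      gamW p t * (E * η x ^ 2) * (energy u x / 8 - C1 * lapFn u x) +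
      gamW' p t * (E * η x ^ 2) * -(C2 * lapFn u x) +
      gamW p t * E * (-(η x ^ 2 * energy u x / 16) - 4 * s ^ 2 * C3 * lapFn u x -
        s * η x * C4 * lapFn u x) := by
    linarith
  refine hfin.trans ((add_le_add (add_le_add J1 J2) J3).trans_eq ?_)
  ring

end IsAdm

lemma IsCut.integrable {n : ℕ} {L s : ℝ} {η g : (Fin n → ℝ) → ℝ} (c : IsCut n L η)
    (hg : ContinuousOn g (ball 0 4)) (hs : 0 < s) :
    MeasureTheory.Integrable fun x => g x * η x ^ s :=
  integrable_mul_of_tsupport isOpen_ball hg (c.continuous_rpow hs.le) (c.compact_rpow hs.ne')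
    ((c.sub_rpow hs.ne').trans IsAdm.sub34)

namespace IsAdm
variable {n : ℕ} {A K M Λ L m s p : ℝ} {u η : (Fin n → ℝ) → ℝ} {x : Fin n → ℝ}

lemma continuousOn_lap (h : IsAdm n A K M Λ u) : ContinuousOn (lapFn u) (ball 0 4) :=
  h.contDiffOn_lap.continuousOn

lemma continuousOn_gam (h : IsAdm n A K M Λ u) (hm : 0 < m) :
    ContinuousOn (fun x => gam (logLap u m x)) (ball 0 4) :=
  continuous_gam.comp_continuousOn (h.contDiffOn_logLap hm).continuousOn

lemma continuousOn_gam_rpow (h : IsAdm n A K M Λ u) (hm : 0 < m) (p : ℝ) :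
    ContinuousOn (fun x => gam (logLap u m x) ^ p) (ball 0 4) :=
  (contDiff_gam_rpow p).continuous.comp_continuousOn (h.contDiffOn_logLap hm).continuousOn

lemma continuousOn_lap_gam (h : IsAdm n A K M Λ u) (hm : 0 < m) (p : ℝ) :
    ContinuousOn (fun x => lapFn u x * gam (logLap u m x) ^ p) (ball 0 4) :=
  h.continuousOn_lap.mul (h.continuousOn_gam_rpow hm p)

lemma continuousOn_energy_gam (h : IsAdm n A K M Λ u) (hm : 0 < m) (p : ℝ) :
    ContinuousOn (fun x => gamD (logLap u m x) ^ 2 * energy u x * gam (logLap u m x) ^ p)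
      (ball 0 4) :=
  (((continuous_gamD.comp_continuousOn (h.contDiffOn_logLap hm).continuousOn).pow 2).mul
    h.contDiffOn_energy.continuousOn).mul (h.continuousOn_gam_rpow hm p)

/-- Weighted energy (Caccioppoli) inequality. -/
lemma energy_integral_le (h : IsAdm n A K M Λ u) (c : IsCut n L η) (hm0 : 0 < m)
    (hm : 100 * n * offBound n A K ≤ m) (hp : 0 ≤ p) (hs : 3 ≤ s) :
    ∫ x, gamD (logLap u m x) ^ 2 * energy u x * gam (logLap u m x) ^ p * η x ^ s ≤
      16 * cacConst n A K Λ L * (p + s ^ 2) *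
        ∫ x, lapFn u x * gam (logLap u m x) ^ p * η x ^ (s - 2) := by
  have i1 := c.integrable (h.continuousOn_energy_gam hm0 p) (s := s) (by linarith)
  have i2 := c.integrable (h.continuousOn_lap_gam hm0 p) (s := s - 2) (by linarith)
  have hV : ∀ i, ContDiff ℝ 1 (fun x => gamW p (logLap u m x) * fluxFn u i x * η x ^ s) := fun i =>
    contDiff_mul_of_tsupport isOpen_ball
      (((contDiff_gamW p).comp_contDiffOn (h.contDiffOn_logLap hm0)).mul
        (contDiffOn_fluxFn h.smooth isOpen_ball h.lap_pos i)) (c.smooth_rpow (by linarith))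
      ((c.sub_rpow (by linarith)).trans sub34)
  have hc : ∀ i, HasCompactSupport (fun x => gamW p (logLap u m x) * fluxFn u i x * η x ^ s) :=
    fun i => (c.compact_rpow (by linarith)).mul_left
  have h0 := integral_div_eq_zero hV hc
  have i3 : MeasureTheory.Integrable
      fun x => ∑ i, pd i (fun x => gamW p (logLap u m x) * fluxFn u i x * η x ^ s) x :=
    MeasureTheory.integrable_finsetSum _ fun i _ =>
      (continuous_pd (hV i) i).integrable_of_hasCompactSupport
        ((hc i).of_isClosed_subset (isClosed_tsupport _) (tsupport_pd_subset i))
  have := MeasureTheory.integral_mono ((i1.div_const 16).sub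
    (i2.const_mul (cacConst n A K Λ L * (p + s ^ 2)))) i3
    fun x => h.div_weighted_ge c hm0 hm hp hs x
  rw [h0] at this
  simp only [Pi.sub_apply] at this
  rw [MeasureTheory.integral_sub (i1.div_const 16) (i2.const_mul _),
    MeasureTheory.integral_const_mul, MeasureTheory.integral_div] at this
  linarith

end IsAdm

section transport
variable {n : ℕ} {U : Set (Fin n → ℝ)} {T : (Fin n → ℝ) → Fin n → ℝ} {ϕ : (Fin n → ℝ) → ℝ}

lemma clm_apply_eq_sum (l : (Fin n → ℝ) →L[ℝ] ℝ) (w : Fin n → ℝ) :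
    l w = ∑ j, w j * l (Pi.single j 1) := by
  conv_lhs => rw [pi_eq_sum_univ' w]
  rw [map_sum]
  refine Finset.sum_congr rfl fun j _ => ?_
  rw [map_smul, smul_eq_mul]

lemma norm_clm_le_sum (l : (Fin n → ℝ) →L[ℝ] ℝ) : ‖l‖ ≤ ∑ j, |l (Pi.single j 1)| := by
  refine l.opNorm_le_bound (Finset.sum_nonneg fun _ _ => abs_nonneg _) fun w => ?_
  rw [clm_apply_eq_sum l w, Finset.sum_mul]
  refine (norm_sum_le _ _).trans (Finset.sum_le_sum fun j _ => ?_)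
  rw [norm_mul, mul_comm]
  exact mul_le_mul_of_nonneg_left (norm_le_pi_norm w j) (abs_nonneg _)

lemma sq_norm_clm_le (l : (Fin n → ℝ) →L[ℝ] ℝ) : ‖l‖ ^ 2 ≤ n * ∑ j, l (Pi.single j 1) ^ 2 := by
  calc ‖l‖ ^ 2 ≤ (∑ j, |l (Pi.single j 1)|) ^ 2 := by have := norm_clm_le_sum l; gcongr
    _ ≤ (Finset.univ : Finset (Fin n)).card * ∑ j, |l (Pi.single j 1)| ^ 2 := sq_sum_le_card_mul_sum_sq
    _ = _ := by simp

/-- Push-forward of a compactly supported function under an injective local diffeomorphism. -/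
lemma exists_pushforward (hU : IsOpen U) (hT : ContDiffOn ℝ 1 T U) (hinj : InjOn T U)
    (hdet : ∀ x ∈ U, (fderiv ℝ T x).det ≠ 0) (hϕ : ContDiff ℝ 1 ϕ) (hc : HasCompactSupport ϕ)
    (hs : tsupport ϕ ⊆ U) :
    ∃ Φ : (Fin n → ℝ) → ℝ, ContDiff ℝ 1 Φ ∧ HasCompactSupport Φ ∧ (∀ x ∈ U, Φ (T x) = ϕ x) ∧
      tsupport Φ ⊆ T '' U := by
  classical
  let Φ : (Fin n → ℝ) → ℝ := fun y => if y ∈ T '' U then ϕ (Function.invFunOn T U y) else 0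
  have h1 : ∀ x ∈ U, Φ (T x) = ϕ x := fun x hx => by
    have hm : T x ∈ T '' U := mem_image_of_mem T hx
    simp only [Φ, if_pos hm]
    rw [hinj (Function.invFunOn_mem ⟨x, hx, rfl⟩) hx (Function.invFunOn_eq ⟨x, hx, rfl⟩)]
  have hK : IsCompact (T '' tsupport ϕ) := hc.isCompact.image_of_continuousOn (hT.continuousOn.mono hs)
  have h2 : ∀ y ∉ T '' tsupport ϕ, Φ y = 0 := fun y hy => by
    by_cases hyU : y ∈ T '' U
    · obtain ⟨x, hx, rfl⟩ := hyU
      rw [h1 x hx]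
      exact image_eq_zero_of_notMem_tsupport fun hh => hy (mem_image_of_mem T hh)
    · simp only [Φ, if_neg hyU]
  have h3 : tsupport Φ ⊆ T '' tsupport ϕ := by
    refine closure_minimal (fun y hy => ?_) hK.isClosed
    by_contra h
    exact hy (h2 y h)
  refine ⟨Φ, ?_, HasCompactSupport.intro hK h2, h1, h3.trans (image_mono hs)⟩
  rw [contDiff_iff_contDiffAt]
  intro y
  by_cases hy : y ∈ T '' U
  · obtain ⟨x, hx, rfl⟩ := hy
    have cT : ContDiffAt ℝ 1 T x := hT.contDiffAt (hU.mem_nhds hx)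
    let f' := (fderiv ℝ T x).toContinuousLinearEquivOfDetNeZero (hdet x hx)
    have hf' : HasFDerivAt T (f' : (Fin n → ℝ) →L[ℝ] (Fin n → ℝ)) x := by
      have : (f' : (Fin n → ℝ) →L[ℝ] (Fin n → ℝ)) = fderiv ℝ T x := by ext; simp [f']
      rw [this]
      exact (cT.differentiableAt (by norm_num)).hasFDerivAt
    have hst := cT.hasStrictFDerivAt' hf' (by norm_num)
    have g1 : ContDiffAt ℝ 1 (cT.localInverse hf' (by norm_num)) (T x) := cT.to_localInverse hf' (by norm_num)
    have g2 := hst.eventually_right_inverse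
    have g3 := hst.localInverse_tendsto
    have : Φ =ᶠ[nhds (T x)] fun y => ϕ (cT.localInverse hf' (by norm_num) y) := by
      filter_upwards [g2, g3 (hU.mem_nhds hx)] with z hz hzU
      have := h1 _ hzU
      rw [hz] at this
      exact this
    exact (hϕ.contDiffAt.comp (T x) g1).congr_of_eventuallyEq this
  · have : Φ =ᶠ[nhds y] fun _ => 0 := by
      filter_upwards [hK.isClosed.isOpen_compl.mem_nhds (fun hh => hy (image_mono hs hh))] with z hz
      exact h2 z hz
    exact contDiffAt_const.congr_of_eventuallyEq this

open MeasureTheory in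
/-- The Gagliardo–Nirenberg–Sobolev inequality in transported coordinates. -/
lemma lintegral_sobolev_transport (hn : 2 ≤ n) (hU : IsOpen U) (hT : ContDiffOn ℝ 1 T U)
    (hinj : InjOn T U) (hdet : ∀ x ∈ U, (fderiv ℝ T x).det ≠ 0) (hϕ : ContDiff ℝ 1 ϕ)
    (hc : HasCompactSupport ϕ) (hs : tsupport ϕ ⊆ U) {G : (Fin n → ℝ) → ENNReal}
    (hG : ∀ x ∈ U, ∀ l : (Fin n → ℝ) →L[ℝ] ℝ, l.comp (fderiv ℝ T x) = fderiv ℝ ϕ x →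
      ENNReal.ofReal |(fderiv ℝ T x).det| * ‖l‖ₑ ≤ G x) :
    ∫⁻ x in U, ENNReal.ofReal |(fderiv ℝ T x).det| * ‖ϕ x‖ₑ ^ ((n : ℝ) / (n - 1)) ≤
      (∫⁻ x in U, G x) ^ ((n : ℝ) / (n - 1)) := by
  obtain ⟨Φ, hΦ, hΦc, hΦT, hΦs⟩ := exists_pushforward hU hT hinj hdet hϕ hc hs
  have hn' : (1 : ℝ) < n := by exact_mod_cast hn
  have hconj : ((Fintype.card (Fin n) : ℕ) : ℝ).HolderConjugate ((n : ℝ) / (n - 1)) := by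
    rw [Fintype.card_fin]
    exact Real.HolderConjugate.conjExponent hn'
  have S := lintegral_pow_le_pow_lintegral_fderiv_aux hconj hΦ hΦc
  have hd : ∀ x ∈ U, HasFDerivAt T (fderiv ℝ T x) x := fun x hx =>
    ((hT.contDiffAt (hU.mem_nhds hx)).differentiableAt (by norm_num)).hasFDerivAt
  have hd' : ∀ x ∈ U, HasFDerivWithinAt T (fderiv ℝ T x) U x := fun x hx =>
    (hd x hx).hasFDerivWithinAt
  have c1 := lintegral_image_eq_lintegral_abs_det_fderiv_mul volume hU.measurableSet hd' hinj
    (fun y => ‖Φ y‖ₑ ^ ((n : ℝ) / (n - 1)))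
  have c2 := lintegral_image_eq_lintegral_abs_det_fderiv_mul volume hU.measurableSet hd' hinj
    (fun y => ‖fderiv ℝ Φ y‖ₑ)
  calc _ = ∫⁻ y in T '' U, ‖Φ y‖ₑ ^ ((n : ℝ) / (n - 1)) := by
        rw [c1]
        exact setLIntegral_congr_fun hU.measurableSet fun x hx => by simp only [hΦT x hx]
    _ ≤ ∫⁻ y, ‖Φ y‖ₑ ^ ((n : ℝ) / (n - 1)) := setLIntegral_le_lintegral _ _
    _ ≤ (∫⁻ y, ‖fderiv ℝ Φ y‖ₑ) ^ ((n : ℝ) / (n - 1)) := S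
    _ = (∫⁻ y in T '' U, ‖fderiv ℝ Φ y‖ₑ) ^ ((n : ℝ) / (n - 1)) := by
        rw [setLIntegral_eq_of_support_subset]
        intro y hy
        refine hΦs ?_
        by_contra h
        refine hy ?_
        have : fderiv ℝ Φ y = 0 := by
          by_contra h2
          exact h (support_fderiv_subset ℝ h2)
        show ‖fderiv ℝ Φ y‖ₑ = 0
        rw [this]
        exact enorm_zero (E := (Fin n → ℝ) →L[ℝ] ℝ)
    _ ≤ _ := by
        refine ENNReal.rpow_le_rpow ?_ (by have : (0:ℝ) < n - 1 := by linarith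
                                           positivity)
        rw [c2]
        refine setLIntegral_mono' hU.measurableSet fun x hx => hG x hx _ ?_
        have h1 : (fun z => Φ (T z)) =ᶠ[nhds x] ϕ := by
          filter_upwards [hU.mem_nhds hx] with z hz using hΦT z hz
        rw [← h1.fderiv_eq]
        exact (((hΦ.differentiable (by norm_num) _).hasFDerivAt.comp x (hd x hx)).fderiv).symm

end transport

/-- The gradient of `u + (A+1)|x|²/2`. -/
noncomputable def shiftGrad {n : ℕ} (A : ℝ) (u : (Fin n → ℝ) → ℝ) (x : Fin n → ℝ) : Fin n → ℝ :=
  fun i => pd i u x + (A + 1) * x i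

namespace IsAdm
variable {n : ℕ} {A K M Λ : ℝ} {u ϕ : (Fin n → ℝ) → ℝ} {x : Fin n → ℝ}

lemma contDiffOn_pd (h : IsAdm n A K M Λ u) (i : Fin n) : ContDiffOn ℝ 3 (pd i u) (ball 0 4) :=
  h.smooth.pd_of_isOpen isOpen_ball (by norm_num) i

lemma contDiffOn_shiftGrad (h : IsAdm n A K M Λ u) : ContDiffOn ℝ 1 (shiftGrad A u) (ball 0 4) :=
  contDiffOn_pi.2 fun i => ((h.contDiffOn_pd i).of_le (by norm_num)).add
    (contDiffOn_const.mul (contDiff_apply ℝ ℝ i).contDiffOn)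

lemma hasFDerivAt_shiftGrad (h : IsAdm n A K M Λ u) (hx : x ∈ ball (0 : Fin n → ℝ) 4) :
    HasFDerivAt (shiftGrad A u)
      (LinearMap.toContinuousLinearMap (Matrix.toLin' (hessFn u x + (A + 1) • 1))) x := by
  rw [hasFDerivAt_pi']
  intro i
  have h1 := ((h.contDiffOn_pd i).diffAt isOpen_ball (by norm_num) hx).hasFDerivAt.add
    (((ContinuousLinearMap.proj (R := ℝ) (φ := fun _ : Fin n => ℝ) i).hasFDerivAt (x := x)).const_mul (A + 1))
  refine h1.congr_fderiv ?_
  ext w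
  simp only [add_apply, smul_apply, ContinuousLinearMap.proj_apply, ContinuousLinearMap.comp_apply,
    LinearMap.coe_toContinuousLinearMap', Matrix.toLin'_apply, Matrix.add_mulVec, Matrix.smul_mulVec,
    Matrix.one_mulVec, Pi.add_apply, Pi.smul_apply, smul_eq_mul]
  congr 1
  rw [clm_apply_eq_sum]
  unfold Matrix.mulVec dotProduct
  exact Finset.sum_congr rfl fun j _ => mul_comm _ _

lemma det_shiftGrad (h : IsAdm n A K M Λ u) (hx : x ∈ ball (0 : Fin n → ℝ) 4) :
    (fderiv ℝ (shiftGrad A u) x).det = (hessFn u x + (A + 1) • 1).det := by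
  rw [(h.hasFDerivAt_shiftGrad hx).fderiv]
  unfold ContinuousLinearMap.det
  rw [LinearMap.coe_toContinuousLinearMap, LinearMap.det_toLin']

lemma det_shiftGrad_ge (h : IsAdm n A K M Λ u) (hx : x ∈ ball (0 : Fin n → ℝ) 4) :
    lapFn u x / n ≤ (fderiv ℝ (shiftGrad A u) x).det := by
  rw [h.det_shiftGrad hx]
  exact (h.hess x hx).det_shift_ge

lemma det_shiftGrad_pos (h : IsAdm n A K M Λ u) (hx : x ∈ ball (0 : Fin n → ℝ) 4) :
    0 < (fderiv ℝ (shiftGrad A u) x).det := by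
  have h1 := h.one_le_n
  exact (div_pos (h.lap_pos x hx) (by exact_mod_cast h1)).trans_le (h.det_shiftGrad_ge hx)

lemma injOn_shiftGrad (h : IsAdm n A K M Λ u) : InjOn (shiftGrad A u) (ball 0 4) := by
  intro y hy x hx hxy
  set w := x - y with hw
  have hseg : ∀ t ∈ Icc (0:ℝ) 1, y + t • w ∈ ball (0 : Fin n → ℝ) 4 := fun t ht => by
    have := (convex_ball (0 : Fin n → ℝ) 4) hy hx (sub_nonneg.2 ht.2) ht.1 (by ring)
    convert this using 1
    rw [hw]; module
  have hd : ∀ t ∈ Icc (0:ℝ) 1, HasDerivAt (fun t => ∑ i, shiftGrad A u (y + t • w) i * w i)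
      (∑ i, ((hessFn u (y + t • w) + (A + 1) • 1).mulVec w) i * w i) t := fun t ht => by
    have l : HasDerivAt (fun t : ℝ => y + t • w) w t := by
      have := ((hasDerivAt_id t).smul_const w).const_add y
      simpa using this
    have := (h.hasFDerivAt_shiftGrad (hseg t ht)).comp_hasDerivAt t l
    rw [hasDerivAt_pi] at this
    have := HasDerivAt.fun_sum fun i (_ : i ∈ Finset.univ) => (this i).mul_const (w i)
    exact this
  have hC := (convex_Icc (0:ℝ) 1).mul_sub_le_image_sub_of_le_deriv
    (fun t ht => (hd t ht).continuousAt.continuousWithinAt)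
    (fun t ht => (hd t (interior_subset ht)).differentiableAt.differentiableWithinAt)
    (C := ∑ i, w i ^ 2) (fun t ht => by
      rw [(hd t (interior_subset ht)).deriv]
      have := (h.hess _ (hseg t (interior_subset ht))).lower w
      have e : ∑ i, ((hessFn u (y + t • w) + (A + 1) • 1).mulVec w) i * w i =
        ∑ i, ∑ j, w i * hessFn u (y + t • w) i j * w j + (A + 1) * ∑ i, w i ^ 2 := by
        rw [Finset.mul_sum, ← Finset.sum_add_distrib]
        refine Finset.sum_congr rfl fun i _ => ?_
        simp only [Matrix.add_mulVec, Matrix.smul_mulVec, Matrix.one_mulVec, Pi.add_apply,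
          Pi.smul_apply, smul_eq_mul]
        unfold Matrix.mulVec dotProduct
        rw [add_mul, Finset.sum_mul]
        congr 1
        · exact Finset.sum_congr rfl fun j _ => by ring
        · ring
      rw [e]
      linarith) 0 (by simp) 1 (by simp) zero_le_one
  have e1 : y + (1:ℝ) • w = x := by rw [hw]; module
  have e0 : y + (0:ℝ) • w = y := by module
  rw [e1, e0, hxy, sub_self] at hC
  have h0 : ∑ i, w i ^ 2 = 0 := le_antisymm (by linarith) (Finset.sum_nonneg fun i _ => sq_nonneg _)
  have h1 : w = 0 := by
    ext i
    have := (Finset.sum_eq_zero_iff_of_nonneg fun i _ => sq_nonneg (w i)).1 h0 i (Finset.mem_univ i)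
    simpa using this
  exact (sub_eq_zero.1 h1).symm

lemma det_mul_norm_sq_le (h : IsAdm n A K M Λ u) (hx : x ∈ ball (0 : Fin n → ℝ) 4)
    (l : (Fin n → ℝ) →L[ℝ] ℝ) (hl : l.comp (fderiv ℝ (shiftGrad A u) x) = fderiv ℝ ϕ x) :
    ((fderiv ℝ (shiftGrad A u) x).det * ‖l‖) ^ 2 ≤ n * cofBound n A K * (lapFn u x *
      linForm (lapFn u x - quotFn u x) (hessFn u x) (fun i => pd i ϕ x) (fun i => pd i ϕ x)) := by
  have H := h.hess x hx
  have hv : (hessFn u x + (A + 1) • 1).mulVec (fun j => l (Pi.single j 1)) = fun i => pd i ϕ x := by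
    ext i
    unfold pd
    rw [← hl, ContinuousLinearMap.comp_apply, clm_apply_eq_sum l, (h.hasFDerivAt_shiftGrad hx).fderiv]
    unfold Matrix.mulVec dotProduct
    refine Finset.sum_congr rfl fun j _ => ?_
    simp only [LinearMap.coe_toContinuousLinearMap', Matrix.toLin'_apply, Matrix.mulVec_single_one]
    congr 1
    simp only [Matrix.col_apply, Matrix.add_apply, Matrix.smul_apply, Matrix.one_apply, H.symm i j, eq_comm (a := i)]
  have J := H.inv_shift_le _ _ hv
  rw [h.det_shiftGrad hx, mul_pow]
  calc _ ≤ (hessFn u x + (A + 1) • 1).det ^ 2 * (n * ∑ j, l (Pi.single j 1) ^ 2) := by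
        gcongr; exact sq_norm_clm_le l
    _ = n * ((hessFn u x + (A + 1) • 1).det ^ 2 * ∑ j, l (Pi.single j 1) ^ 2) := by ring
    _ ≤ n * (cofBound n A K * (lapFn u x *
      linForm (lapFn u x - quotFn u x) (hessFn u x) (fun i => pd i ϕ x) (fun i => pd i ϕ x))) := by
        gcongr
    _ = _ := by ring

open MeasureTheory in
/-- The Sobolev inequality weighted by the Laplacian. -/
lemma sobolev (h : IsAdm n A K M Λ u) (hϕ : ContDiff ℝ 1 ϕ) (hϕ0 : ∀ x, 0 ≤ ϕ x)
    (hc : HasCompactSupport ϕ) (hs : tsupport ϕ ⊆ ball 0 4) {G : (Fin n → ℝ) → ℝ}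
    (hGi : Integrable G) (hG0 : ∀ x, 0 ≤ G x)
    (hG : ∀ x ∈ ball (0 : Fin n → ℝ) 4, n * cofBound n A K * (lapFn u x *
      linForm (lapFn u x - quotFn u x) (hessFn u x) (fun i => pd i ϕ x) (fun i => pd i ϕ x)) ≤
        G x ^ 2) :
    ∫ x, lapFn u x * ϕ x ^ ((n : ℝ) / (n - 1)) ≤ n * (∫ x, G x) ^ ((n : ℝ) / (n - 1)) := by
  have hn := (h.hess 0 (by simp)).hn
  have hn' : (1 : ℝ) < n := by exact_mod_cast hn
  have hn1 : (0 : ℝ) < n - 1 := by linarith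
  have hχ : 0 < (n : ℝ) / (n - 1) := by positivity
  set χ := (n : ℝ) / (n - 1) with hχd
  have S := lintegral_sobolev_transport hn isOpen_ball h.contDiffOn_shiftGrad h.injOn_shiftGrad
    (fun x hx => (h.det_shiftGrad_pos hx).ne') hϕ hc hs (G := fun x => ENNReal.ofReal (G x))
    (fun x hx l hl => by
      rw [← ofReal_norm, ← ENNReal.ofReal_mul (abs_nonneg _), abs_of_pos (h.det_shiftGrad_pos hx)]
      exact ENNReal.ofReal_le_ofReal
        (le_of_sq_le_sq ((h.det_mul_norm_sq_le hx l hl).trans (hG x hx)) (hG0 x)))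
  have hϕz : ∀ x ∉ ball (0 : Fin n → ℝ) 4, ϕ x = 0 := fun x hx =>
    image_eq_zero_of_notMem_tsupport fun hh => hx (hs hh)
  have hnn : ∀ x, 0 ≤ lapFn u x * ϕ x ^ χ := fun x => by
    by_cases hx : x ∈ ball (0 : Fin n → ℝ) 4
    · exact mul_nonneg (h.lap_pos x hx).le (Real.rpow_nonneg (hϕ0 x) _)
    · rw [hϕz x hx, Real.zero_rpow hχ.ne', mul_zero]
  have hts : tsupport (fun x => ϕ x ^ χ) ⊆ tsupport ϕ := by
    refine closure_mono fun x hx => ?_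
    contrapose! hx
    simp only [Function.mem_support, not_not] at hx
    simp [hx, Real.zero_rpow hχ.ne']
  have hcont : Continuous fun x => lapFn u x * ϕ x ^ χ :=
    continuous_mul_of_tsupport isOpen_ball h.continuousOn_lap
      (hϕ.continuous.rpow_const fun _ => Or.inr hχ.le) (hts.trans hs)
  rw [integral_eq_lintegral_of_nonneg_ae (Filter.Eventually.of_forall hnn) hcont.aestronglyMeasurable]
  have hI : 0 ≤ ∫ x, G x := integral_nonneg hG0
  refine ENNReal.toReal_le_of_le_ofReal (by positivity) ?_
  calc ∫⁻ x, ENNReal.ofReal (lapFn u x * ϕ x ^ χ)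
      = ∫⁻ x in ball 0 4, ENNReal.ofReal (lapFn u x * ϕ x ^ χ) := by
        refine (setLIntegral_eq_of_support_subset fun x hx => ?_).symm
        by_contra h0
        refine hx ?_
        simp only [hϕz x h0, Real.zero_rpow hχ.ne', mul_zero, ENNReal.ofReal_zero]
    _ ≤ ∫⁻ x in ball 0 4, ENNReal.ofReal n *
        (ENNReal.ofReal |(fderiv ℝ (shiftGrad A u) x).det| * ‖ϕ x‖ₑ ^ χ) := by
        refine setLIntegral_mono' isOpen_ball.measurableSet fun x hx => ?_
        rw [← ofReal_norm, ENNReal.ofReal_rpow_of_nonneg (norm_nonneg _) hχ.le,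
          ← ENNReal.ofReal_mul (abs_nonneg _), ← ENNReal.ofReal_mul (by positivity),
          Real.norm_of_nonneg (hϕ0 x), abs_of_pos (h.det_shiftGrad_pos hx)]
        refine ENNReal.ofReal_le_ofReal ?_
        rw [← mul_assoc]
        refine mul_le_mul_of_nonneg_right ?_ (Real.rpow_nonneg (hϕ0 x) _)
        have := h.det_shiftGrad_ge hx
        rw [div_le_iff₀ (by linarith)] at this
        linarith
    _ = ENNReal.ofReal n * ∫⁻ x in ball 0 4,
        (ENNReal.ofReal |(fderiv ℝ (shiftGrad A u) x).det| * ‖ϕ x‖ₑ ^ χ) :=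
        lintegral_const_mul' _ _ ENNReal.ofReal_ne_top
    _ ≤ ENNReal.ofReal n * (∫⁻ x in ball 0 4, ENNReal.ofReal (G x)) ^ χ := by gcongr
    _ ≤ ENNReal.ofReal n * (∫⁻ x, ENNReal.ofReal (G x)) ^ χ := by
        gcongr; exact Measure.restrict_le_self
    _ = ENNReal.ofReal (n * (∫ x, G x) ^ χ) := by
        rw [← ofReal_integral_eq_lintegral_ofReal hGi (Filter.Eventually.of_forall hG0),
          ENNReal.ofReal_rpow_of_nonneg hI hχ.le, ENNReal.ofReal_mul (by positivity)]

end IsAdm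

section weight

lemma contDiff_sq_max : ContDiff ℝ 1 fun t : ℝ => max t 0 ^ 2 := by
  rw [contDiff_one_iff_deriv]
  refine ⟨fun t => (hasDerivAt_sq_max t).differentiableAt, ?_⟩
  rw [show deriv (fun t : ℝ => max t 0 ^ 2) = fun t => 2 * max t 0 from
    funext fun t => (hasDerivAt_sq_max t).deriv]
  fun_prop

/-- A decreasing cutoff profile vanishing on `[R, ∞)`. -/
noncomputable def profile (R l r : ℝ) : ℝ := max (R - r) 0 ^ 2 * Real.exp (-(l * r))

lemma contDiff_profile (R l : ℝ) : ContDiff ℝ 1 (profile R l) := by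
  have : ContDiff ℝ 1 fun r : ℝ => max (R - r) 0 ^ 2 :=
    contDiff_sq_max.comp (contDiff_const.sub contDiff_id)
  exact this.mul (contDiff_const.mul contDiff_id).neg.exp

lemma profile_nonneg (R l r : ℝ) : 0 ≤ profile R l r := by unfold profile; positivity

lemma profile_of_le {R r : ℝ} (l : ℝ) (h : R ≤ r) : profile R l r = 0 := by
  simp [profile, max_eq_right (sub_nonpos.2 h)]

lemma hasDerivAt_profile (R l r : ℝ) :
    HasDerivAt (profile R l) (-(2 * max (R - r) 0 * Real.exp (-(l * r))) - l * profile R l r) r := by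
  have h1 : HasDerivAt (fun r : ℝ => R - r) (-1) r := by
    simpa using (hasDerivAt_id r).const_sub R
  have h2 : HasDerivAt (fun r : ℝ => max (R - r) 0 ^ 2) (2 * max (R - r) 0 * -1) r :=
    (hasDerivAt_sq_max (R - r)).comp r h1
  have h3 : HasDerivAt (fun r : ℝ => Real.exp (-(l * r))) (Real.exp (-(l * r)) * -(l * 1)) r :=
    (((hasDerivAt_id r).const_mul l).neg).exp
  refine (h2.mul h3).congr_deriv ?_
  unfold profile
  ring

variable {n : ℕ}

/-- The sum of the even powers `(x i) ^ (2 * k)` of the coordinates. -/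
noncomputable def powSum (k : ℕ) (x : Fin n → ℝ) : ℝ := ∑ i, x i ^ (2 * k)

lemma contDiff_powSum (k : ℕ) : ContDiff ℝ 1 (powSum k : (Fin n → ℝ) → ℝ) :=
  ContDiff.sum fun i _ => (contDiff_apply ℝ ℝ i).pow _

lemma powSum_nonneg (k : ℕ) (x : Fin n → ℝ) : 0 ≤ powSum k x :=
  Finset.sum_nonneg fun _ _ => (even_two_mul k).pow_nonneg _

lemma pow_le_powSum (k : ℕ) (x : Fin n → ℝ) (i : Fin n) : |x i| ^ (2 * k) ≤ powSum k x := by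
  rw [(even_two_mul k).pow_abs]
  exact Finset.single_le_sum (f := fun i => x i ^ (2 * k))
    (fun _ _ => (even_two_mul k).pow_nonneg _) (Finset.mem_univ i)

lemma pd_powSum (k : ℕ) (x : Fin n → ℝ) (i : Fin n) :
    pd i (powSum k) x = 2 * k * x i ^ (2 * k - 1) := by
  unfold powSum
  have hd : ∀ a : Fin n, DifferentiableAt ℝ (fun y : Fin n → ℝ => y a) x := fun a =>
    (contDiff_apply ℝ ℝ a (n := 1)).differentiable (by norm_num) x
  rw [pd_sum fun a _ => (hd a).fun_pow _]
  have : ∀ a : Fin n, pd i (fun y : Fin n → ℝ => y a ^ (2 * k)) x =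
      if a = i then 2 * k * x i ^ (2 * k - 1) else 0 := fun a => by
    have := pd_comp (hasDerivAt_pow (2 * k) (x a)) (hd a) i
    rw [this]
    have e : pd i (fun y : Fin n → ℝ => y a) x = if a = i then 1 else 0 := by
      unfold pd
      have := (ContinuousLinearMap.proj (R := ℝ) (φ := fun _ : Fin n => ℝ) a).hasFDerivAt (x := x)
      rw [show (fun y : Fin n → ℝ => y a) = (ContinuousLinearMap.proj (R := ℝ) (φ := fun _ : Fin n => ℝ) a) from rfl,
        this.fderiv]
      simp [Pi.single_apply]
    rw [e]
    split_ifs with h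
    · subst h; push_cast; ring
    · simp
  simp [this]

lemma pd_coord (x : Fin n → ℝ) (i : Fin n) : pd i (fun y : Fin n → ℝ => y i) x = 1 := by
  unfold pd
  rw [show (fun y : Fin n → ℝ => y i) = (ContinuousLinearMap.proj (R := ℝ) (φ := fun _ : Fin n => ℝ) i) from rfl,
    ((ContinuousLinearMap.proj (R := ℝ) (φ := fun _ : Fin n => ℝ) i).hasFDerivAt (x := x)).fderiv]
  simp

lemma sum_pd_profile (k : ℕ) (hk : 1 ≤ k) (R l : ℝ) (x : Fin n → ℝ) :
    ∑ i, pd i (fun y => profile R l (powSum k y) * y i) x =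
      2 * k * powSum k x * (-(2 * max (R - powSum k x) 0 * Real.exp (-(l * powSum k x))) -
        l * profile R l (powSum k x)) + n * profile R l (powSum k x) := by
  have hN : DifferentiableAt ℝ (powSum k) x := (contDiff_powSum k).differentiable (by norm_num) x
  have : ∀ i, pd i (fun y => profile R l (powSum k y) * y i) x =
      2 * k * x i ^ (2 * k) * (-(2 * max (R - powSum k x) 0 * Real.exp (-(l * powSum k x))) -
        l * profile R l (powSum k x)) + profile R l (powSum k x) := fun i => by
    have d1 : DifferentiableAt ℝ (fun y => profile R l (powSum k y)) x :=
      ((hasDerivAt_profile R l (powSum k x)).differentiableAt).comp x hN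
    rw [pd_mul d1 ((contDiff_apply ℝ ℝ i (n := 1)).differentiable (by norm_num) x),
      pd_comp (hasDerivAt_profile R l (powSum k x)) hN, pd_powSum, pd_coord]
    have e : x i ^ (2 * k) = x i ^ (2 * k - 1) * x i := by
      rw [← pow_succ]; congr 1; omega
    rw [e]
    ring
  simp only [this, Finset.sum_add_distrib, ← Finset.sum_mul, ← Finset.mul_sum]
  simp [powSum]

/-- A compactly supported field whose divergence is at least one on a cubical annulus. -/
lemma exists_radial_field (hn : 1 ≤ n) : ∃ (X : Fin n → (Fin n → ℝ) → ℝ) (D : ℝ), 0 < D ∧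
    (∀ i, ContDiff ℝ 1 (X i)) ∧ (∀ i, tsupport (X i) ⊆ closedBall 0 (11 / 4)) ∧
    (∀ i x, |X i x| ≤ D) ∧ (∀ x : Fin n → ℝ, 1 ≤ ‖x‖ → 0 ≤ ∑ i, pd i (X i) x) ∧
    (∀ x : Fin n → ℝ, 1 ≤ ‖x‖ → ‖x‖ ≤ 5 / 2 → 1 ≤ ∑ i, pd i (X i) x) := by
  obtain ⟨k, hk⟩ : ∃ k : ℕ, 2 * (n : ℝ) < ((11 / 10 : ℝ) ^ 2) ^ k :=
    pow_unbounded_of_one_lt _ (by norm_num)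
  rw [← pow_mul] at hk
  have hn' : (1 : ℝ) ≤ n := by exact_mod_cast hn
  have hk1 : 1 ≤ k := by
    by_contra h0
    obtain rfl : k = 0 := by omega
    norm_num at hk
    linarith
  have hk1' : (1 : ℝ) ≤ k := by exact_mod_cast hk1
  set R : ℝ := (11 / 4) ^ (2 * k) with hR
  have hR0 : 0 < R := by positivity
  set l : ℝ := n + 1 with hl
  have hl0 : 0 < l := by positivity
  have hRn : n * (5 / 2 : ℝ) ^ (2 * k) ≤ R / 2 := by
    have e : R = (11 / 10 : ℝ) ^ (2 * k) * (5 / 2 : ℝ) ^ (2 * k) := by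
      rw [hR, ← mul_pow]; norm_num
    rw [e]
    have : (0 : ℝ) < (5 / 2 : ℝ) ^ (2 * k) := by positivity
    nlinarith
  set c : ℝ := (R / 2) ^ 2 * Real.exp (-(l * R)) with hc
  have hc0 : 0 < c := by positivity
  have hsup : ∀ x : Fin n → ℝ, x ∉ closedBall (0 : Fin n → ℝ) (11 / 4) → R ≤ powSum k x := by
    intro x hx
    rw [mem_closedBall_zero_iff, pi_norm_le_iff_of_nonneg (by norm_num)] at hx
    push Not at hx
    obtain ⟨i, hi⟩ := hx
    refine le_trans ?_ (pow_le_powSum k x i)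
    rw [hR]
    exact pow_le_pow_left₀ (by norm_num) hi.le _
  have hN1 : ∀ x : Fin n → ℝ, 1 ≤ ‖x‖ → 1 ≤ powSum k x := by
    intro x hx
    by_contra! hlt
    refine absurd hx (not_le.2 ?_)
    rw [pi_norm_lt_iff one_pos]
    intro i
    by_contra! h1
    exact absurd ((one_le_pow₀ (n := 2 * k) h1).trans (pow_le_powSum k x i)) (not_le.2 hlt)
  have hdiff : ∀ x : Fin n → ℝ, ∀ i, DifferentiableAt ℝ (fun y => profile R l (powSum k y) * y i) x := fun x i =>
    ((((contDiff_profile R l).comp (contDiff_powSum k)).mul (contDiff_apply ℝ ℝ i)).differentiable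
      (by norm_num)) x
  have hdiv : ∀ x : Fin n → ℝ, 1 ≤ ‖x‖ → profile R l (powSum k x) / c ≤
      ∑ i, pd i (fun y => -(1 / c) * (profile R l (powSum k y) * y i)) x := by
    intro x hx
    have h1 := hN1 x hx
    have e : ∀ i, pd i (fun y => -(1 / c) * (profile R l (powSum k y) * y i)) x =
      -(1 / c) * pd i (fun y => profile R l (powSum k y) * y i) x := fun i =>
        pd_const_mul (hdiff x i) _ i
    simp only [e]
    rw [← Finset.mul_sum, sum_pd_profile k hk1, div_eq_mul_one_div, mul_comm, neg_mul, ← mul_neg]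
    refine mul_le_mul_of_nonneg_left ?_ (by positivity)
    have hp := profile_nonneg R l (powSum k x)
    have hp2 : 0 ≤ 2 * k * powSum k x * (2 * max (R - powSum k x) 0 * Real.exp (-(l * powSum k x))) := by
      have := powSum_nonneg k x
      positivity
    have hkN : 1 ≤ (k : ℝ) * powSum k x := one_le_mul_of_one_le_of_one_le hk1' h1
    have hkN2 : l * 1 * profile R l (powSum k x) ≤ l * (k * powSum k x) * profile R l (powSum k x) := by
      gcongr
    have hp3 : 0 ≤ (n : ℝ) * profile R l (powSum k x) := by positivity
    have : l * 1 * profile R l (powSum k x) = n * profile R l (powSum k x) + profile R l (powSum k x) := by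
      rw [hl]; ring
    linarith
  refine ⟨fun i y => -(1 / c) * (profile R l (powSum k y) * y i), 1 / c * (R ^ 2 * 3), by positivity,
    fun i => contDiff_const.mul (((contDiff_profile R l).comp (contDiff_powSum k)).mul
      (contDiff_apply ℝ ℝ i)), fun i => ?_, fun i x => ?_, fun x hx => ?_, fun x hx hx2 => ?_⟩
  · refine closure_minimal (fun x hx => ?_) isClosed_closedBall
    by_contra h0
    exact hx (by simp only [profile_of_le l (hsup x h0)]; ring)
  · rw [abs_mul, abs_neg, abs_of_pos (by positivity : 0 < 1 / c)]
    refine mul_le_mul_of_nonneg_left ?_ (by positivity)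
    by_cases hx : x ∈ closedBall (0 : Fin n → ℝ) (11 / 4)
    · rw [abs_mul, abs_of_nonneg (profile_nonneg _ _ _)]
      rw [mem_closedBall_zero_iff] at hx
      have h3 : |x i| ≤ 3 := (norm_le_pi_norm x i).trans (hx.trans (by norm_num))
      have hN := powSum_nonneg k x
      have h4 : profile R l (powSum k x) ≤ R ^ 2 := by
        unfold profile
        have e1 : max (R - powSum k x) 0 ≤ R := max_le (by linarith) hR0.le
        have e2 : Real.exp (-(l * powSum k x)) ≤ 1 := by
          rw [Real.exp_le_one_iff]
          have := mul_nonneg hl0.le hN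
          linarith
        calc _ ≤ R ^ 2 * 1 := by gcongr
          _ = _ := mul_one _
      gcongr
    · rw [profile_of_le l (hsup x hx)]
      simp; positivity
  · exact (div_nonneg (profile_nonneg _ _ _) hc0.le).trans (hdiv x hx)
  · refine le_trans ?_ (hdiv x hx)
    rw [le_div_iff₀ hc0, one_mul]
    have hN : powSum k x ≤ R / 2 := by
      refine le_trans ?_ hRn
      calc powSum k x ≤ ∑ _i : Fin n, (5 / 2 : ℝ) ^ (2 * k) := Finset.sum_le_sum fun i _ => by
            rw [← (even_two_mul k).pow_abs]
            exact pow_le_pow_left₀ (abs_nonneg _) ((norm_le_pi_norm x i).trans hx2) _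
        _ = _ := by simp
    unfold profile
    rw [hc]
    have e1 : R / 2 ≤ max (R - powSum k x) 0 := le_max_of_le_left (by linarith)
    have e2 : powSum k x ≤ R := by linarith
    gcongr

/-- Existence of cutoff functions between concentric cubes. -/
lemma exists_isCut (n : ℕ) {r r' : ℝ} (hr : 0 < r) (hr' : r < r') (h3 : r' < 3) :
    ∃ (L : ℝ) (η : (Fin n → ℝ) → ℝ), IsCut n L η ∧ (∀ x ∈ closedBall (0 : Fin n → ℝ) r, η x = 1) ∧
      tsupport η ⊆ closedBall 0 r' := by
  let b : ContDiffBump (0 : Fin n → ℝ) := ⟨r, r', hr, hr'⟩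
  have hb : ContDiff ℝ 1 b := b.contDiff
  have hcont : ∀ i, ∃ C, ∀ x, ‖pd i b x‖ ≤ C := fun i => by
    have hc : HasCompactSupport (pd i b) := b.hasCompactSupport.of_isClosed_subset
      (isClosed_tsupport _) (tsupport_pd_subset i)
    exact hc.exists_bound_of_continuous (continuous_pd hb i)
  choose C hC using hcont
  have hC0 : ∀ i, 0 ≤ C i := fun i => (norm_nonneg _).trans (hC i 0)
  refine ⟨1 + ∑ i, C i, b, ⟨?_, hb, fun x => b.nonneg, fun x => b.le_one, b.hasCompactSupport, ?_, ?_⟩, ?_, ?_⟩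
  · have := Finset.sum_nonneg fun i (_ : i ∈ Finset.univ) => hC0 i
    linarith
  · rw [b.tsupport_eq]; exact closedBall_subset_ball h3
  · intro x i
    have := Finset.single_le_sum (fun i _ => hC0 i) (Finset.mem_univ i)
    exact (hC i x).trans (by linarith)
  · exact fun x hx => b.one_of_mem_closedBall hx
  · rw [b.tsupport_eq]

end weight

lemma integral_le_of_div {n : ℕ} {V : Fin n → (Fin n → ℝ) → ℝ} {F H : (Fin n → ℝ) → ℝ}
    (hV : ∀ i, ContDiff ℝ 1 (V i)) (hc : ∀ i, HasCompactSupport (V i))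
    (hF : MeasureTheory.Integrable F) (hH : MeasureTheory.Integrable H)
    (hle : ∀ x, F x ≤ ∑ i, pd i (V i) x + H x) : ∫ x, F x ≤ ∫ x, H x := by
  have h0 := integral_div_eq_zero hV hc
  have i3 : MeasureTheory.Integrable fun x => ∑ i, pd i (V i) x :=
    MeasureTheory.integrable_finsetSum _ fun i _ =>
      (continuous_pd (hV i) i).integrable_of_hasCompactSupport
        ((hc i).of_isClosed_subset (isClosed_tsupport _) (tsupport_pd_subset i))
  have := MeasureTheory.integral_mono hF (i3.add hH) hle
  simp only [Pi.add_apply] at this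
  rw [MeasureTheory.integral_add i3 hH, h0] at this
  linarith

namespace IsAdm
variable {n : ℕ} {A K M Λ L L₁ L₂ D m s p : ℝ} {u η η₁ η₂ : (Fin n → ℝ) → ℝ} {x : Fin n → ℝ}

lemma lap_integral_le (h : IsAdm n A K M Λ u) (c : IsCut n L η) :
    ∫ x, lapFn u x * η x ≤ n * M * L * MeasureTheory.volume.real (ball (0 : Fin n → ℝ) 3) := by
  have hM := h.hM
  have hL := c.hL
  have hV : ∀ i, ContDiff ℝ 1 (fun x => pd i u x * η x) := fun i =>
    contDiff_mul_of_tsupport isOpen_ball ((h.contDiffOn_pd i).of_le (by norm_num)) c.smooth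
      (c.sub.trans sub34)
  have hc : ∀ i, HasCompactSupport (fun x => pd i u x * η x) := fun i => c.compact.mul_left
  have hF : MeasureTheory.Integrable fun x => lapFn u x * η x :=
    integrable_mul_of_tsupport isOpen_ball h.continuousOn_lap c.smooth.continuous c.compact
      (c.sub.trans sub34)
  have hb : MeasureTheory.volume (ball (0 : Fin n → ℝ) 3) ≠ ⊤ := MeasureTheory.measure_ball_lt_top.ne
  have hH : MeasureTheory.Integrable ((ball (0 : Fin n → ℝ) 3).indicator fun _ => n * M * L) :=
    (MeasureTheory.integrableOn_const hb).integrable_indicator measurableSet_ball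
  refine (integral_le_of_div hV hc hF hH fun x => ?_).trans_eq ?_
  · by_cases hx : x ∈ ball (0 : Fin n → ℝ) 3
    · rw [indicator_of_mem hx]
      have hx4 := sub34 hx
      have e : ∀ i, pd i (fun x => pd i u x * η x) x = hessFn u x i i * η x + pd i u x * pd i η x :=
        fun i => by
          rw [pd_mul ((h.contDiffOn_pd i).diffAt isOpen_ball (by norm_num) hx4) c.diff]
          rfl
      have e2 : -∑ i, pd i u x * pd i η x ≤ n * M * L := by
        rw [← Finset.sum_neg_distrib]
        calc _ ≤ ∑ _i : Fin n, M * L := Finset.sum_le_sum fun i _ => by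
              refine (neg_le_abs _).trans ?_
              rw [abs_mul]
              exact mul_le_mul (h.grad x hx i) (c.grad x i) (abs_nonneg _) hM.le
          _ = _ := by simp; ring
      simp only [e, Finset.sum_add_distrib, ← Finset.sum_mul]
      change lapFn u x * η x ≤ lapFn u x * η x + _ + _
      linarith
    · rw [indicator_of_notMem hx, c.eq_zero hx]
      have : ∀ i, pd i (fun x => pd i u x * η x) x = 0 := fun i =>
        image_eq_zero_of_notMem_tsupport fun hh => hx
          (c.sub (tsupport_mul_subset_right (tsupport_pd_subset i hh)))
      simp [this]
  · rw [MeasureTheory.integral_indicator measurableSet_ball, MeasureTheory.setIntegral_const]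
    simp; ring

/-- A majorant of the gradient of `gam (logLap u m)`. -/
noncomputable def gradMaj (K : ℝ) (u : (Fin n → ℝ) → ℝ) (m : ℝ) (x : Fin n → ℝ) : ℝ :=
  n * lapFn u x + K ^ 2 / 2 * (gamD (logLap u m x) ^ 2 * energy u x)

lemma gradMaj_nonneg (h : IsAdm n A K M Λ u) (hx : x ∈ ball (0 : Fin n → ℝ) 4) :
    0 ≤ gradMaj K u m x := by
  have := h.lap_pos x hx
  have := h.energy_nonneg hx
  unfold gradMaj
  positivity

lemma pd_gam_logLap (h : IsAdm n A K M Λ u) (hm : 0 < m) (hx : x ∈ ball (0 : Fin n → ℝ) 4)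
    (i : Fin n) : pd i (fun x => gam (logLap u m x)) x = gamD (logLap u m x) * dlogLap u x i := by
  rw [pd_comp (hasDerivAt_gam _) (h.diff_logLap hm hx), h.pd_logLap hm hx]

lemma sum_abs_pd_gam_le (h : IsAdm n A K M Λ u) (hm : 0 < m) (hx : x ∈ ball (0 : Fin n → ℝ) 4) :
    ∑ i, |pd i (fun x => gam (logLap u m x)) x| ≤ gradMaj K u m x := by
  have hB := h.lap_pos x hx
  set g := gamD (logLap u m x) with hg
  calc _ ≤ ∑ i, (lapFn u x + g ^ 2 * dlogLap u x i ^ 2 / (4 * lapFn u x)) :=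
        Finset.sum_le_sum fun i _ => by
          rw [h.pd_gam_logLap hm hx, ← mul_pow, ← sq_abs (_ * _), ← hg, ← sub_nonneg]
          have : lapFn u x + |g * dlogLap u x i| ^ 2 / (4 * lapFn u x) - |g * dlogLap u x i| =
            (2 * lapFn u x - |g * dlogLap u x i|) ^ 2 / (4 * lapFn u x) := by field_simp; ring
          rw [this]; positivity
    _ = n * lapFn u x + g ^ 2 * (∑ i, dlogLap u x i ^ 2) / (4 * lapFn u x) := by
        rw [Finset.sum_add_distrib, ← Finset.sum_div, ← Finset.mul_sum]; simp
    _ ≤ n * lapFn u x + g ^ 2 * (2 * K ^ 2 * (lapFn u x * energy u x)) / (4 * lapFn u x) := by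
        have := h.dlog_sq_le hx
        gcongr
    _ = _ := by unfold gradMaj; rw [← hg]; field_simp; ring

/-- The bound for the integral of `gradMaj`. -/
noncomputable def gradMajConst (n : ℕ) (A K M Λ L : ℝ) : ℝ :=
  (n + K ^ 2 / 2 * (16 * cacConst n A K Λ L * 9)) *
    (n * M * L * MeasureTheory.volume.real (ball (0 : Fin n → ℝ) 3))

lemma gradMaj_integrable (h : IsAdm n A K M Λ u) (c : IsCut n L η) (hm : 0 < m) :
    MeasureTheory.Integrable fun x => gradMaj K u m x * η x ^ (3 : ℝ) := by
  refine c.integrable ?_ (by norm_num)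
  have := h.continuousOn_energy_gam hm 0
  simp only [Real.rpow_zero, mul_one] at this
  exact (continuousOn_const.mul h.continuousOn_lap).add (continuousOn_const.mul this)

lemma gradMaj_integral_le (h : IsAdm n A K M Λ u) (c : IsCut n L η) (hm0 : 0 < m)
    (hm : 100 * n * offBound n A K ≤ m) :
    ∫ x, gradMaj K u m x * η x ^ (3 : ℝ) ≤ gradMajConst n A K M Λ L := by
  have E := h.energy_integral_le c hm0 hm le_rfl (le_refl (3 : ℝ))
  have hK := h.K_pos
  have hC := h.cacConst_pos c
  have e1 : ((3 : ℝ) - 2) = 1 := by norm_num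
  simp only [Real.rpow_zero, mul_one, e1, Real.rpow_one] at E
  have I0 := h.lap_integral_le c
  have i1 := h.continuousOn_energy_gam hm0 0
  simp only [Real.rpow_zero, mul_one] at i1
  have i1' := c.integrable i1 (s := 3) (by norm_num)
  have i2 := c.integrable h.continuousOn_lap (s := 3) (by norm_num)
  have i3 := c.integrable h.continuousOn_lap (s := 1) (by norm_num)
  simp only [Real.rpow_one] at i3
  have I1 : ∫ x, lapFn u x * η x ^ (3 : ℝ) ≤ ∫ x, lapFn u x * η x := by
    refine MeasureTheory.integral_mono i2 i3 fun x => ?_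
    dsimp only
    by_cases hx : x ∈ ball (0 : Fin n → ℝ) 3
    · refine mul_le_mul_of_nonneg_left ?_ (h.lap_pos x (sub34 hx)).le
      calc η x ^ (3 : ℝ) ≤ η x ^ (1 : ℝ) :=
            Real.rpow_le_rpow_of_exponent_ge' (c.nonneg x) (c.le_one x) (by norm_num) (by norm_num)
        _ = _ := Real.rpow_one _
    · rw [c.eq_zero hx, Real.zero_rpow (by norm_num)]
  have e : ∀ x, gradMaj K u m x * η x ^ (3 : ℝ) = n * (lapFn u x * η x ^ (3 : ℝ)) +
      K ^ 2 / 2 * (gamD (logLap u m x) ^ 2 * energy u x * η x ^ (3 : ℝ)) := fun x => by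
    unfold gradMaj; ring
  simp only [e]
  rw [MeasureTheory.integral_add (i2.const_mul _) (i1'.const_mul _),
    MeasureTheory.integral_const_mul, MeasureTheory.integral_const_mul]
  have E' := E.trans (mul_le_mul_of_nonneg_left I0 (by positivity))
  calc _ ≤ n * (n * M * L * MeasureTheory.volume.real (ball (0 : Fin n → ℝ) 3)) +
        K ^ 2 / 2 * (16 * cacConst n A K Λ L * (0 + 3 ^ 2) *
          (n * M * L * MeasureTheory.volume.real (ball (0 : Fin n → ℝ) 3))) := by
        gcongr
        exact I1.trans I0
    _ = _ := by unfold gradMajConst; ring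

/-- A weighted `L¹` bound for the Laplacian. -/
lemma weighted_lap_integral_le (h : IsAdm n A K M Λ u) (c₁ : IsCut n L₁ η₁) (c₂ : IsCut n L₂ η₂)
    (hη₁ : ∀ x ∈ closedBall (0 : Fin n → ℝ) (11 / 4), η₁ x = 1)
    (hη₂ : tsupport η₂ ⊆ closedBall 0 (5 / 2)) {X : Fin n → (Fin n → ℝ) → ℝ} (hD : 0 < D)
    (hX : ∀ i, ContDiff ℝ 1 (X i)) (hXs : ∀ i, tsupport (X i) ⊆ closedBall 0 (11 / 4))
    (hXD : ∀ i x, |X i x| ≤ D) (hX0 : ∀ x : Fin n → ℝ, 1 ≤ ‖x‖ → 0 ≤ ∑ i, pd i (X i) x)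
    (hX1 : ∀ x : Fin n → ℝ, 1 ≤ ‖x‖ → ‖x‖ ≤ 5 / 2 → 1 ≤ ∑ i, pd i (X i) x)
    (hm0 : 0 < m) (hm : 100 * n * offBound n A K ≤ m)
    (hm1 : ∀ x ∈ ball (0 : Fin n → ℝ) 1, lapFn u x ≤ m) :
    ∫ x, lapFn u x * gam (logLap u m x) * η₂ x ≤
      n * M * L₂ * MeasureTheory.volume.real (ball (0 : Fin n → ℝ) 3) +
        (M + n * M * L₂ * D) * gradMajConst n A K M Λ L₁ := by
  have hM := h.hM
  have hL₂ := c₂.hL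
  set β : (Fin n → ℝ) → ℝ := fun x => gam (logLap u m x) - 1 with hβ
  have hβ0 : ∀ x, 0 ≤ β x := fun x => sub_nonneg.2 (one_le_gam _)
  have hβ1 : ∀ x, ‖x‖ < 1 → β x = 0 := fun x hx => by
    have hx1 : x ∈ ball (0 : Fin n → ℝ) 1 := mem_ball_zero_iff.2 hx
    have hx4 : x ∈ ball (0 : Fin n → ℝ) 4 := ball_subset_ball (by norm_num) hx1
    have : logLap u m x ≤ 0 :=
      Real.log_nonpos (div_nonneg (h.lap_pos x hx4).le hm0.le) ((div_le_one hm0).2 (hm1 x hx1))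
    simp [hβ, gam_of_nonpos this]
  have hβc : ContDiffOn ℝ 1 β (ball 0 4) :=
    (contDiff_gam.comp_contDiffOn (h.contDiffOn_logLap hm0)).sub contDiffOn_const
  have hs1 : closedBall (0 : Fin n → ℝ) (11 / 4) ⊆ ball 0 4 := closedBall_subset_ball (by norm_num)
  have hs2 : tsupport η₂ ⊆ closedBall (0 : Fin n → ℝ) (11 / 4) :=
    hη₂.trans (closedBall_subset_closedBall (by norm_num))
  have hXc : ∀ i, HasCompactSupport (X i) := fun i =>
    (isCompact_closedBall _ _).of_isClosed_subset (isClosed_tsupport _) (hXs i)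
  have hV1 : ∀ i, ContDiff ℝ 1 (fun x => pd i u x * β x * η₂ x) := fun i =>
    contDiff_mul_of_tsupport isOpen_ball (((h.contDiffOn_pd i).of_le (by norm_num)).mul hβc) c₂.smooth
      (hs2.trans hs1)
  have hV2 : ∀ i, ContDiff ℝ 1 (fun x => β x * X i x) := fun i =>
    contDiff_mul_of_tsupport isOpen_ball hβc (hX i) ((hXs i).trans hs1)
  have hV : ∀ i, ContDiff ℝ 1 (fun x => pd i u x * β x * η₂ x + n * M * L₂ * (β x * X i x)) :=
    fun i => (hV1 i).add (contDiff_const.mul (hV2 i))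
  have hc : ∀ i, HasCompactSupport
      (fun x => pd i u x * β x * η₂ x + n * M * L₂ * (β x * X i x)) := fun i =>
    HasCompactSupport.add (f := fun x => pd i u x * β x * η₂ x) c₂.compact.mul_left
      (HasCompactSupport.mul_left (f := fun _ => n * M * L₂) ((hXc i).mul_left))
  have hFi : MeasureTheory.Integrable fun x => lapFn u x * β x * η₂ x :=
    integrable_mul_of_tsupport isOpen_ball (h.continuousOn_lap.mul hβc.continuousOn)
      c₂.smooth.continuous c₂.compact (c₂.sub.trans sub34)
  have hF0 : MeasureTheory.Integrable fun x => lapFn u x * η₂ x :=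
    integrable_mul_of_tsupport isOpen_ball h.continuousOn_lap
      c₂.smooth.continuous c₂.compact (c₂.sub.trans sub34)
  have hP := h.gradMaj_integrable c₁ hm0
  have key : ∫ x, lapFn u x * β x * η₂ x ≤
      ∫ x, (M + n * M * L₂ * D) * (gradMaj K u m x * η₁ x ^ (3 : ℝ)) := by
    refine integral_le_of_div hV hc hFi (hP.const_mul _) fun x => ?_
    by_cases hx : x ∈ closedBall (0 : Fin n → ℝ) (11 / 4)
    · have hx4 := hs1 hx
      have hx3 : x ∈ ball (0 : Fin n → ℝ) 3 := closedBall_subset_ball (by norm_num) hx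
      have hP0 : 0 ≤ gradMaj K u m x := h.gradMaj_nonneg hx4
      rw [hη₁ x hx, Real.one_rpow, mul_one]
      have dβ := hβc.diffAt isOpen_ball (by norm_num) hx4
      have du := fun i => (h.contDiffOn_pd i).diffAt isOpen_ball (by norm_num) hx4
      have dX := fun i => (hX i).differentiable (by norm_num) x
      have eβ : ∀ i, pd i β x = pd i (fun x => gam (logLap u m x)) x := fun i => by
        rw [hβ, pd_sub _ (differentiableAt_const _)]
        · simp [pd]
        · exact ((contDiff_gam.comp_contDiffOn (h.contDiffOn_logLap hm0)).diffAt isOpen_ball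
            (by norm_num) hx4 :)
      have hβP : ∑ i, |pd i β x| ≤ gradMaj K u m x := by
        simp only [eβ]; exact h.sum_abs_pd_gam_le hm0 hx4
      have e : ∀ i, pd i (fun x => pd i u x * β x * η₂ x + n * M * L₂ * (β x * X i x)) x =
          hessFn u x i i * (β x * η₂ x) + η₂ x * (pd i u x * pd i β x) +
            β x * (pd i u x * pd i η₂ x) +
            n * M * L₂ * (pd i β x * X i x + β x * pd i (X i) x) := fun i => by
        rw [pd_add (((du i).fun_mul dβ).fun_mul c₂.diff)
          (((dβ.fun_mul (dX i))).const_mul _), pd_const_mul (dβ.fun_mul (dX i)),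
          pd_mul dβ (dX i), pd_mul ((du i).fun_mul dβ) c₂.diff, pd_mul (du i) dβ]
        change (hessFn u x i i * _ + _) * _ + _ + _ = _
        ring
      simp only [e, Finset.sum_add_distrib, ← Finset.sum_mul, ← Finset.mul_sum]
      change _ ≤ lapFn u x * _ + _ + _ + _ + _
      have t1 : -(η₂ x * ∑ i, pd i u x * pd i β x) ≤ M * gradMaj K u m x := by
        have : -(∑ i, pd i u x * pd i β x) ≤ M * gradMaj K u m x := by
          rw [← Finset.sum_neg_distrib]
          calc _ ≤ ∑ i, M * |pd i β x| := Finset.sum_le_sum fun i _ => by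
                refine (neg_le_abs _).trans ?_
                rw [abs_mul]
                have := h.grad x hx3 i
                gcongr
            _ = M * ∑ i, |pd i β x| := by rw [Finset.mul_sum]
            _ ≤ _ := by gcongr
        have h2 : 0 ≤ M * gradMaj K u m x := by positivity
        have := mul_le_mul_of_nonneg_left this (c₂.nonneg x)
        have := mul_le_of_le_one_left h2 (c₂.le_one x)
        linarith
      have t2 : -(∑ i, pd i β x * X i x) ≤ D * gradMaj K u m x := by
        rw [← Finset.sum_neg_distrib]
        calc _ ≤ ∑ i, D * |pd i β x| := Finset.sum_le_sum fun i _ => by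
              refine (neg_le_abs _).trans ?_
              rw [abs_mul, mul_comm]
              have := hXD i x
              gcongr
          _ = D * ∑ i, |pd i β x| := by rw [Finset.mul_sum]
          _ ≤ _ := by gcongr
      have t3 : -(β x * ∑ i, pd i u x * pd i η₂ x) ≤ n * M * L₂ * (β x * ∑ i, pd i (X i) x) := by
        rcases lt_or_ge ‖x‖ 1 with h1 | h1
        · simp [hβ1 x h1]
        by_cases hx2 : x ∈ tsupport η₂
        · have g1 := hX1 x h1 (mem_closedBall_zero_iff.1 (hη₂ hx2))
          have g2 : -(∑ i, pd i u x * pd i η₂ x) ≤ n * M * L₂ := by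
            rw [← Finset.sum_neg_distrib]
            calc _ ≤ ∑ _i : Fin n, M * L₂ := Finset.sum_le_sum fun i _ => by
                  refine (neg_le_abs _).trans ?_
                  rw [abs_mul]
                  exact mul_le_mul (h.grad x hx3 i) (c₂.grad x i) (abs_nonneg _) hM.le
              _ = _ := by simp; ring
          have g3 : 0 ≤ n * M * L₂ := by positivity
          calc _ = β x * -(∑ i, pd i u x * pd i η₂ x) := by ring
            _ ≤ β x * (n * M * L₂ * ∑ i, pd i (X i) x) := by
                refine mul_le_mul_of_nonneg_left (g2.trans ?_) (hβ0 x)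
                exact le_mul_of_one_le_right g3 g1
            _ = _ := by ring
        · have : ∀ i, pd i η₂ x = 0 := fun i =>
            image_eq_zero_of_notMem_tsupport fun hh => hx2 (tsupport_pd_subset i hh)
          simp only [this, mul_zero, Finset.sum_const_zero, neg_zero]
          have := mul_nonneg (hβ0 x) (hX0 x h1)
          positivity
      have g3 : 0 ≤ n * M * L₂ := by positivity
      have t2' := mul_le_mul_of_nonneg_left t2 g3
      nlinarith [t1, t2', t3]
    · have hz : x ∉ tsupport η₂ := fun hh => hx (hs2 hh)
      have : ∀ i, pd i (fun x => pd i u x * β x * η₂ x + n * M * L₂ * (β x * X i x)) x = 0 := fun i =>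
        image_eq_zero_of_notMem_tsupport fun hh => by
          rcases tsupport_add _ _ (tsupport_pd_subset i hh) with h1 | h1
          · exact hz (tsupport_mul_subset_right h1)
          · exact hx (hXs i (tsupport_mul_subset_right (tsupport_mul_subset_right h1)))
      simp only [this, image_eq_zero_of_notMem_tsupport hz, Finset.sum_const_zero, mul_zero, zero_add]
      by_cases hx3 : x ∈ ball (0 : Fin n → ℝ) 3
      · have := h.gradMaj_nonneg (m := m) (sub34 hx3)
        have := c₁.nonneg x
        positivity
      · rw [c₁.eq_zero hx3, Real.zero_rpow (by norm_num)]; simp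
  rw [MeasureTheory.integral_const_mul] at key
  have key' := key.trans (mul_le_mul_of_nonneg_left (h.gradMaj_integral_le c₁ hm0 hm)
    (by positivity))
  have e : ∀ x, lapFn u x * gam (logLap u m x) * η₂ x = lapFn u x * η₂ x + lapFn u x * β x * η₂ x :=
    fun x => by simp only [hβ]; ring
  simp only [e]
  rw [MeasureTheory.integral_add hF0 hFi]
  exact add_le_add (h.lap_integral_le c₂) key'

end IsAdm

/-- Constant in the gradient bound for the Moser test functions. -/
noncomputable def testConst (n : ℕ) (A K L : ℝ) : ℝ :=
  n * cofBound n A K * (1 + 2 * ((1 + A * K / 2) * (n * L ^ 2))) + 1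

/-- Constant in the reverse Hölder inequality. -/
noncomputable def moserConst (n : ℕ) (A K Λ L : ℝ) : ℝ :=
  n * (testConst n A K L * (1 + 32 * cacConst n A K Λ L) * (2 * n + 1) ^ 2)

namespace IsAdm
variable {n : ℕ} {A K M Λ L m s p : ℝ} {u η : (Fin n → ℝ) → ℝ} {x : Fin n → ℝ}

lemma cofBound_nonneg : 0 ≤ cofBound n A K := by
  unfold cofBound
  have := (even_two_mul n).pow_nonneg (offBound n A K + A + 2)
  positivity

lemma one_le_testConst (h : IsAdm n A K M Λ u) : 1 ≤ testConst n A K L := by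
  have := h.K_pos
  have := h.A_pos
  have := cofBound_nonneg (n := n) (A := A) (K := K)
  unfold testConst
  have : 0 ≤ n * cofBound n A K * (1 + 2 * ((1 + A * K / 2) * (n * L ^ 2))) := by positivity
  linarith

lemma one_le_moserConst (h : IsAdm n A K M Λ u) (c : IsCut n L η) :
    1 ≤ moserConst n A K Λ L := by
  have h1 : (1 : ℝ) ≤ n := by exact_mod_cast h.one_le_n
  have h2 := h.one_le_testConst (L := L)
  have h3 : 1 ≤ 1 + 32 * cacConst n A K Λ L := by have := h.cacConst_pos c; linarith
  have h4 : 1 ≤ (2 * (n : ℝ) + 1) ^ 2 := one_le_pow₀ (by linarith)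
  exact one_le_mul_of_one_le_of_one_le h1
    (one_le_mul_of_one_le_of_one_le (one_le_mul_of_one_le_of_one_le h2 h3) h4)

set_option maxHeartbeats 1000000 in
/-- Pointwise gradient bound for the Moser test functions. -/
lemma test_grad_le (h : IsAdm n A K M Λ u) (c : IsCut n L η) (hm : 0 < m) (hs : 3 ≤ s)
    (hp : 0 ≤ p) (hps : p ≤ s) (hx : x ∈ ball (0 : Fin n → ℝ) 4) :
    n * cofBound n A K * (lapFn u x * linForm (lapFn u x - quotFn u x) (hessFn u x)
      (fun i => pd i (fun x => gam (logLap u m x) ^ p * η x ^ s) x)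
      (fun i => pd i (fun x => gam (logLap u m x) ^ p * η x ^ s) x)) ≤
    (testConst n A K L * (s ^ 2 * (lapFn u x * gam (logLap u m x) ^ p * η x ^ (s - 2)) +
      gamD (logLap u m x) ^ 2 * energy u x * gam (logLap u m x) ^ p * η x ^ s)) ^ 2 := by
  have hK := h.K_pos
  have hA := h.A_pos
  have hL := c.hL
  have H := h.hess x hx
  have hB := h.lap_pos x hx
  have he := h.energy_nonneg hx
  have hη := c.nonneg x
  have hη1 := c.le_one x
  set g := gam (logLap u m x) with hg
  have hg1 : 1 ≤ g := one_le_gam _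
  have hg0 : 0 < g := gam_pos _
  set d := gamD (logLap u m x) with hd
  have hd0 : 0 ≤ d := gamD_nonneg _
  set B := lapFn u x with hBd
  have dg : DifferentiableAt ℝ (fun x => gam (logLap u m x)) x :=
    ((contDiff_gam.comp_contDiffOn (h.contDiffOn_logLap hm)).diffAt isOpen_ball (by norm_num) hx :)
  have dgp : DifferentiableAt ℝ (fun x => gam (logLap u m x) ^ p) x :=
    (((contDiff_gam_rpow p).comp_contDiffOn (h.contDiffOn_logLap hm)).diffAt isOpen_ball
      (by norm_num) hx :)
  have dη : DifferentiableAt ℝ (fun x => η x ^ s) x :=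
    (c.smooth_rpow (by linarith)).differentiable (by norm_num) x
  set r := p * g ^ (p - 1) * d * η x ^ s with hr
  set q := s * g ^ p * η x ^ (s - 1) with hq
  have e : ∀ i, pd i (fun x => gam (logLap u m x) ^ p * η x ^ s) x =
      r * dlogLap u x i + q * pd i η x := fun i => by
    rw [pd_mul dgp dη, c.pd_rpow (by linarith),
      pd_comp (φ := fun t => t ^ p) (Real.hasDerivAt_rpow_const (Or.inl (gam_pos _).ne')) dg,
      h.pd_gam_logLap hm hx]
    simp only [← hg, ← hd, hr, hq]
    ring
  simp only [e]
  set a := linForm (B - quotFn u x) (hessFn u x) (fun i => pd i η x) (fun i => pd i η x) with ha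
  have ha1 : a ≤ (1 + A * K / 2) * B * (n * L ^ 2) := by
    refine (H.linForm_upper _).trans ?_
    have := c.grad_sq (x := x)
    gcongr
  have h1 : linForm (B - quotFn u x) (hessFn u x) (fun i => r * dlogLap u x i + q * pd i η x)
      (fun i => r * dlogLap u x i + q * pd i η x) ≤ 2 * r ^ 2 * energy u x + 2 * q ^ 2 * a := by
    have h2 := H.linForm_nonneg fun i => r * dlogLap u x i + (-q) * pd i η x
    rw [linForm_add_smul H.symm] at h2 ⊢
    rw [← ha] at h2 ⊢
    rw [show linForm (B - quotFn u x) (hessFn u x) (dlogLap u x) (dlogLap u x) = energy u x from rfl]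
      at h2 ⊢
    nlinarith
  set S := B * g ^ p * η x ^ (s - 2) with hS
  set T := d ^ 2 * energy u x * g ^ p * η x ^ s with hT
  have hS0 : 0 ≤ S := by positivity
  have hT0 : 0 ≤ T := by positivity
  have hr2 : B * (r ^ 2 * energy u x) ≤ s ^ 2 * (S * T) := by
    have k1 : g ^ (p - 1) ≤ g ^ p := Real.rpow_le_rpow_of_exponent_le hg1 (by linarith)
    have k2 : η x ^ s ≤ η x ^ (s - 2) :=
      Real.rpow_le_rpow_of_exponent_ge' hη hη1 (by linarith) (by linarith)
    calc B * (r ^ 2 * energy u x) =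
        p ^ 2 * (B * (g ^ (p - 1)) * η x ^ s * (d ^ 2 * energy u x * g ^ (p - 1) * η x ^ s)) := by
          rw [hr]; ring
      _ ≤ s ^ 2 * (B * g ^ p * η x ^ (s - 2) * (d ^ 2 * energy u x * g ^ p * η x ^ s)) := by
          gcongr
      _ = _ := rfl
  have hq2 : B ^ 2 * q ^ 2 ≤ s ^ 2 * S ^ 2 := by
    have k2 : η x ^ (s - 1) ≤ η x ^ (s - 2) :=
      Real.rpow_le_rpow_of_exponent_ge' hη hη1 (by linarith) (by linarith)
    calc B ^ 2 * q ^ 2 = s ^ 2 * (B * g ^ p * η x ^ (s - 1)) ^ 2 := by rw [hq]; ring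
      _ ≤ s ^ 2 * (B * g ^ p * η x ^ (s - 2)) ^ 2 := by gcongr
  set c1 := (1 + A * K / 2) * (n * L ^ 2) with hc1
  have hc0 : 0 ≤ c1 := by positivity
  have hcof := cofBound_nonneg (n := n) (A := A) (K := K)
  have hN := h.one_le_testConst (L := L)
  have hs2 : 1 ≤ s ^ 2 := by nlinarith
  have h3 : B * (2 * r ^ 2 * energy u x + 2 * q ^ 2 * a) ≤ (1 + 2 * c1) * (s ^ 2 * S + T) ^ 2 := by
    have k3 : B * (q ^ 2 * a) ≤ c1 * (s ^ 2 * S ^ 2) := by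
      calc B * (q ^ 2 * a) ≤ B * (q ^ 2 * ((1 + A * K / 2) * B * (n * L ^ 2))) := by gcongr
        _ = c1 * (B ^ 2 * q ^ 2) := by rw [hc1]; ring
        _ ≤ _ := by gcongr
    have k4 : s ^ 2 * S ^ 2 ≤ (s ^ 2 * S + T) ^ 2 := by
      calc s ^ 2 * S ^ 2 ≤ s ^ 2 * (s ^ 2 * S ^ 2) := le_mul_of_one_le_left (by positivity) hs2
        _ = (s ^ 2 * S) ^ 2 := by ring
        _ ≤ _ := by gcongr; linarith
    have k5 : 2 * (s ^ 2 * (S * T)) ≤ (s ^ 2 * S + T) ^ 2 := by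
      have : (s ^ 2 * S + T) ^ 2 - 2 * (s ^ 2 * (S * T)) = (s ^ 2 * S) ^ 2 + T ^ 2 := by ring
      have : 0 ≤ (s ^ 2 * S) ^ 2 + T ^ 2 := by positivity
      linarith
    have k6 := mul_le_mul_of_nonneg_left k4 hc0
    calc B * (2 * r ^ 2 * energy u x + 2 * q ^ 2 * a) =
        2 * (B * (r ^ 2 * energy u x)) + 2 * (B * (q ^ 2 * a)) := by ring
      _ ≤ (s ^ 2 * S + T) ^ 2 + 2 * (c1 * (s ^ 2 * S + T) ^ 2) := by linarith
      _ = _ := by ring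
  calc _ ≤ n * cofBound n A K * (B * (2 * r ^ 2 * energy u x + 2 * q ^ 2 * a)) := by gcongr
    _ ≤ n * cofBound n A K * ((1 + 2 * c1) * (s ^ 2 * S + T) ^ 2) := by gcongr
    _ = (testConst n A K L - 1) * (s ^ 2 * S + T) ^ 2 := by rw [testConst, ← hc1]; ring
    _ ≤ testConst n A K L ^ 2 * (s ^ 2 * S + T) ^ 2 := by gcongr; nlinarith
    _ = _ := by ring

/-- Reverse Hölder inequality. -/
lemma reverse_holder (h : IsAdm n A K M Λ u) (c : IsCut n L η) (hm0 : 0 < m)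
    (hm : 100 * n * offBound n A K ≤ m) (hs : 3 ≤ s) (hp : 0 ≤ p) (hps : p ≤ s) :
    ∫ x, lapFn u x * (gam (logLap u m x) ^ p * η x ^ s) ^ ((n : ℝ) / (n - 1)) ≤
      n * (testConst n A K L * (1 + 32 * cacConst n A K Λ L) * s ^ 2 *
        ∫ x, lapFn u x * gam (logLap u m x) ^ p * η x ^ (s - 2)) ^ ((n : ℝ) / (n - 1)) := by
  have hn' : (1 : ℝ) ≤ n := by exact_mod_cast h.one_le_n
  have hN := h.one_le_testConst (L := L)
  have hC := h.cacConst_pos c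
  have i1 := c.integrable (h.continuousOn_energy_gam hm0 p) (s := s) (by linarith)
  have i2 := c.integrable (h.continuousOn_lap_gam hm0 p) (s := s - 2) (by linarith)
  have hϕ : ContDiff ℝ 1 (fun x => gam (logLap u m x) ^ p * η x ^ s) :=
    contDiff_mul_of_tsupport isOpen_ball
      ((contDiff_gam_rpow p).comp_contDiffOn (h.contDiffOn_logLap hm0))
      (c.smooth_rpow (by linarith)) ((c.sub_rpow (by linarith)).trans sub34)
  have hS0 : ∀ x, 0 ≤ lapFn u x * gam (logLap u m x) ^ p * η x ^ (s - 2) := fun x => by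
    by_cases hx : x ∈ ball (0 : Fin n → ℝ) 3
    · have := h.lap_pos x (sub34 hx)
      have := gam_pos (logLap u m x)
      have := c.nonneg x
      positivity
    · rw [c.eq_zero hx, Real.zero_rpow (by linarith)]; simp
  have hT0 : ∀ x, 0 ≤ gamD (logLap u m x) ^ 2 * energy u x * gam (logLap u m x) ^ p * η x ^ s :=
    fun x => by
      by_cases hx : x ∈ ball (0 : Fin n → ℝ) 3
      · have := h.energy_nonneg (sub34 hx)
        have := gam_pos (logLap u m x)
        have := c.nonneg x
        positivity
      · rw [c.eq_zero hx, Real.zero_rpow (by linarith)]; simp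
  have S := h.sobolev hϕ (fun x => mul_nonneg (Real.rpow_nonneg (gam_pos _).le _)
      (Real.rpow_nonneg (c.nonneg x) _)) (c.compact_rpow (by linarith)).mul_left
      ((tsupport_mul_subset_right.trans (c.sub_rpow (by linarith))).trans sub34)
      (((i2.const_mul (s ^ 2)).add i1).const_mul (testConst n A K L))
      (fun x => by have := hS0 x; have := hT0 x; simp only [Pi.add_apply]; positivity)
      (fun x hx => h.test_grad_le c hm0 hs hp hps hx)
  refine S.trans ?_
  have E := h.energy_integral_le c hm0 hm hp hs
  have J0 : 0 ≤ ∫ x, lapFn u x * gam (logLap u m x) ^ p * η x ^ (s - 2) :=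
    MeasureTheory.integral_nonneg hS0
  have T0 : 0 ≤ ∫ x, gamD (logLap u m x) ^ 2 * energy u x * gam (logLap u m x) ^ p * η x ^ s :=
    MeasureTheory.integral_nonneg hT0
  rw [MeasureTheory.integral_const_mul]
  simp only [Pi.add_apply]
  rw [MeasureTheory.integral_add (i2.const_mul _) i1, MeasureTheory.integral_const_mul]
  refine mul_le_mul_of_nonneg_left (Real.rpow_le_rpow (by positivity) ?_
    (div_nonneg (by linarith) (by linarith))) (by linarith)
  set J := ∫ x, lapFn u x * gam (logLap u m x) ^ p * η x ^ (s - 2)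
  have k : p + s ^ 2 ≤ 2 * s ^ 2 := by nlinarith
  have k2 : 16 * cacConst n A K Λ L * (p + s ^ 2) * J ≤ 16 * cacConst n A K Λ L * (2 * s ^ 2) * J := by
    gcongr
  have k3 := E.trans k2
  rw [mul_assoc, mul_assoc]
  refine mul_le_mul_of_nonneg_left ?_ (by linarith)
  linarith

end IsAdm

/-- The numerical part of the Moser iteration. -/
lemma moser_iterate {n : ℕ} (hn : 2 ≤ n) {C a : ℝ} (hC : 0 < C) (ha : 0 < a) {J : ℕ → ℝ}
    (hJ : ∀ j, 0 ≤ J j) (hstep : ∀ j, J (j + 1) ≤ (C * a ^ j * J j) ^ ((n : ℝ) / (n - 1))) (j : ℕ) :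
    (a ^ n) ^ (n - 1) * C ^ n * (a ^ n) ^ j * J j ≤
      ((a ^ n) ^ (n - 1) * C ^ n * J 0) ^ (((n : ℝ) / (n - 1)) ^ j) := by
  have hn' : (1 : ℝ) < n := by exact_mod_cast hn
  have hn1 : (0 : ℝ) < n - 1 := by linarith
  induction j with
  | zero => simp
  | succ j ih =>
    set C' := (a ^ n) ^ (n - 1) * C ^ n with hC'
    have hC0 : 0 < C' := by positivity
    set E := C * a ^ n * a ^ j with hE
    have hE0 : 0 < E := by positivity
    have e1 : C' * (a ^ n) ^ (j + 1) = E ^ n := by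
      obtain ⟨k, rfl⟩ : ∃ k, n = k + 1 := ⟨n - 1, by omega⟩
      rw [hC', hE]
      simp only [Nat.add_sub_cancel]
      ring
    have e2 : C * a ^ j * J j = E / E ^ n * (C' * (a ^ n) ^ j * J j) := by
      rw [← e1, hE]
      field_simp
      ring
    have e3 : (E / E ^ n) ^ ((n : ℝ) / (n - 1)) = (E ^ n)⁻¹ := by
      have : E / E ^ n = E ^ (-((n : ℝ) - 1)) := by
        rw [neg_sub, Real.rpow_sub hE0, Real.rpow_one, Real.rpow_natCast]
      rw [this, ← Real.rpow_mul hE0.le, ← Real.rpow_natCast, ← Real.rpow_neg hE0.le]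
      congr 1
      field_simp
    have hK0 : 0 ≤ C' * (a ^ n) ^ j * J j := mul_nonneg (by positivity) (hJ j)
    rw [e1]
    calc E ^ n * J (j + 1) ≤ E ^ n * (C * a ^ j * J j) ^ ((n : ℝ) / (n - 1)) := by
          gcongr; exact hstep j
      _ = (C' * (a ^ n) ^ j * J j) ^ ((n : ℝ) / (n - 1)) := by
          rw [e2, Real.mul_rpow (by positivity) hK0, e3]
          field_simp
      _ ≤ ((C' * J 0) ^ (((n : ℝ) / (n - 1)) ^ j)) ^ ((n : ℝ) / (n - 1)) := by gcongr
      _ = _ := by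
          rw [← Real.rpow_mul (mul_nonneg hC0.le (hJ 0)), pow_succ]

namespace IsAdm
variable {n : ℕ} {A K M Λ L m Q : ℝ} {u η : (Fin n → ℝ) → ℝ} {x : Fin n → ℝ}

/-- The Moser integrals. -/
noncomputable def moserInt (u η : (Fin n → ℝ) → ℝ) (m p : ℝ) : ℝ :=
  ∫ x, lapFn u x * gam (logLap u m x) ^ p * η x ^ ((2 * n + 1) * p - 2 * n)

lemma moserInt_nonneg (h : IsAdm n A K M Λ u) (c : IsCut n L η) {p : ℝ} (hp : 1 ≤ p) :
    0 ≤ moserInt u η m p := by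
  refine MeasureTheory.integral_nonneg fun x => ?_
  have hn : (0 : ℝ) ≤ n := n.cast_nonneg
  dsimp only [Pi.zero_apply]
  by_cases hx : x ∈ ball (0 : Fin n → ℝ) 3
  · have := h.lap_pos x (sub34 hx)
    have := gam_pos (logLap u m x)
    have := c.nonneg x
    positivity
  · rw [c.eq_zero hx, Real.zero_rpow (by nlinarith)]; simp

lemma moserInt_step (h : IsAdm n A K M Λ u) (c : IsCut n L η) (hm0 : 0 < m)
    (hm : 100 * n * offBound n A K ≤ m) {p : ℝ} (hp : 1 ≤ p) :
    moserInt u η m ((n : ℝ) / (n - 1) * p) ≤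
      (moserConst n A K Λ L * p ^ 2 * moserInt u η m p) ^ ((n : ℝ) / (n - 1)) := by
  have hn' : (1 : ℝ) < n := by exact_mod_cast (h.hess 0 (by simp)).hn
  have hn1 : (0 : ℝ) < n - 1 := by linarith
  have hχ : 1 ≤ (n : ℝ) / (n - 1) := (one_le_div hn1).2 (by linarith)
  set s := (2 * (n : ℝ) + 1) * p - 2 * n + 2 with hs
  have hnp := mul_le_mul_of_nonneg_left hp (by linarith : (0 : ℝ) ≤ n)
  have R := h.reverse_holder c hm0 hm (s := s) (p := p) (by linarith) (by linarith) (by linarith)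
  have e1 : s - 2 = (2 * (n : ℝ) + 1) * p - 2 * n := by rw [hs]; ring
  rw [e1] at R
  change _ ≤ n * (_ * moserInt u η m p) ^ _ at R
  have e2 : ∀ x, lapFn u x * (gam (logLap u m x) ^ p * η x ^ s) ^ ((n : ℝ) / (n - 1)) =
      lapFn u x * gam (logLap u m x) ^ ((n : ℝ) / (n - 1) * p) *
        η x ^ ((2 * n + 1) * ((n : ℝ) / (n - 1) * p) - 2 * n) := fun x => by
    rw [Real.mul_rpow (Real.rpow_nonneg (gam_pos _).le _) (Real.rpow_nonneg (c.nonneg x) _),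
      ← Real.rpow_mul (gam_pos _).le, ← Real.rpow_mul (c.nonneg x), mul_assoc]
    congr 3
    · ring
    · rw [hs]; field_simp; ring
  simp only [e2] at R
  refine R.trans ?_
  have J0 := h.moserInt_nonneg (m := m) c hp
  have hN := h.one_le_testConst (L := L)
  have hC := h.cacConst_pos c
  have hs2 : s ^ 2 ≤ (2 * n + 1) ^ 2 * p ^ 2 := by
    rw [← mul_pow]
    refine pow_le_pow_left₀ (by linarith) (by linarith) 2
  set J := moserInt u η m p
  calc _ ≤ (n : ℝ) ^ ((n : ℝ) / (n - 1)) * (testConst n A K L * (1 + 32 * cacConst n A K Λ L) *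
        ((2 * n + 1) ^ 2 * p ^ 2) * J) ^ ((n : ℝ) / (n - 1)) := by
        gcongr
        exact Real.self_le_rpow_of_one_le hn'.le hχ
    _ = _ := by
        rw [← Real.mul_rpow (by positivity) (by positivity)]
        congr 1
        unfold moserConst
        ring

/-- The Moser constant accumulated along the iteration. -/
noncomputable def supConst (n : ℕ) (A K Λ L : ℝ) : ℝ :=
  (((((n : ℝ) / (n - 1)) ^ 2) ^ n) ^ (n - 1)) * moserConst n A K Λ L ^ n

lemma moserInt_le (h : IsAdm n A K M Λ u) (c : IsCut n L η) (hm0 : 0 < m)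
    (hm : 100 * n * offBound n A K ≤ m) (hQ : supConst n A K Λ L * moserInt u η m 1 ≤ Q) (j : ℕ) :
    moserInt u η m (((n : ℝ) / (n - 1)) ^ j) ≤ Q ^ (((n : ℝ) / (n - 1)) ^ j) := by
  have hn := (h.hess 0 (by simp)).hn
  have hn' : (1 : ℝ) < n := by exact_mod_cast hn
  have hn1 : (0 : ℝ) < n - 1 := by linarith
  set χ := (n : ℝ) / (n - 1) with hχd
  have hχ : 1 ≤ χ := (one_le_div hn1).2 (by linarith)
  have hχj : ∀ j : ℕ, 1 ≤ χ ^ j := fun j => one_le_pow₀ hχ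
  have hC1 := h.one_le_moserConst c
  have J0 := fun j => h.moserInt_nonneg (m := m) c (hχj j)
  have I := moser_iterate hn (C := moserConst n A K Λ L) (a := χ ^ 2) (by linarith) (by positivity)
    (J := fun j => moserInt u η m (χ ^ j)) J0 (fun j => by
      have := h.moserInt_step c hm0 hm (hχj j)
      rw [← hχd, ← pow_mul, mul_comm j 2, pow_mul] at this
      rw [pow_succ']
      exact this) j
  simp only [pow_zero] at I
  have hS : ((χ ^ 2) ^ n) ^ (n - 1) * moserConst n A K Λ L ^ n = supConst n A K Λ L := rfl
  rw [hS, ← hχd] at I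
  have hS1 : 1 ≤ supConst n A K Λ L := by
    rw [← hS]
    exact one_le_mul_of_one_le_of_one_le (one_le_pow₀ (one_le_pow₀ (one_le_pow₀ hχ)))
      (one_le_pow₀ hC1)
  have hle : moserInt u η m (χ ^ j) ≤
      supConst n A K Λ L * ((χ ^ 2) ^ n) ^ j * moserInt u η m (χ ^ j) :=
    le_mul_of_one_le_left (J0 j)
      (one_le_mul_of_one_le_of_one_le hS1 (one_le_pow₀ (one_le_pow₀ (one_le_pow₀ hχ))))
  refine (hle.trans I).trans (Real.rpow_le_rpow ?_ hQ (by positivity))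
  exact mul_nonneg (by linarith) (by simpa using J0 0)

/-- Local boundedness from the Moser iteration. -/
lemma gam_le_of_moserInt (h : IsAdm n A K M Λ u) (c : IsCut n L η)
    (hη : ∀ x ∈ closedBall (0 : Fin n → ℝ) 2, η x = 1) (hm0 : 0 < m)
    (hm : 100 * n * offBound n A K ≤ m) (hQ0 : 0 < Q)
    (hQ : supConst n A K Λ L * moserInt u η m 1 ≤ Q) (hx : x ∈ ball (0 : Fin n → ℝ) 2) :
    gam (logLap u m x) ≤ 2 * Q := by
  by_contra! hlt
  have hn := (h.hess 0 (by simp)).hn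
  have hn' : (1 : ℝ) < n := by exact_mod_cast hn
  have hn1 : (0 : ℝ) < n - 1 := by linarith
  have hK := h.K_pos
  set χ := (n : ℝ) / (n - 1) with hχd
  have hχ : 1 < χ := (one_lt_div hn1).2 (by linarith)
  have hχj : ∀ j : ℕ, 1 ≤ χ ^ j := fun j => one_le_pow₀ hχ.le
  have h24 : ball (0 : Fin n → ℝ) 2 ⊆ ball 0 4 := ball_subset_ball (by norm_num)
  set W : Set (Fin n → ℝ) := ball 0 2 ∩ (fun x => gam (logLap u m x)) ⁻¹' Ioi (2 * Q) with hW
  have hWo : IsOpen W := ((h.continuousOn_gam hm0).mono h24).isOpen_inter_preimage isOpen_ball isOpen_Ioi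
  have hWt : MeasureTheory.volume W ≠ ⊤ :=
    ((MeasureTheory.measure_mono inter_subset_left).trans_lt MeasureTheory.measure_ball_lt_top).ne
  have hW0 : 0 < MeasureTheory.volume.real W :=
    ENNReal.toReal_pos (hWo.measure_pos _ ⟨x, hx, hlt⟩).ne' hWt
  set v := MeasureTheory.volume.real W with hv
  have key : ∀ j : ℕ, 2 / K * v * (2 : ℝ) ^ (χ ^ j) ≤ 1 := fun j => by
    have hpj := hχj j
    set p := χ ^ j with hp
    have I := h.moserInt_le c hm0 hm hQ j
    rw [← hχd, ← hp] at I
    have hs : 0 < (2 * (n : ℝ) + 1) * p - 2 * n := by nlinarith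
    have L1 : ∫ x, W.indicator (fun _ => 2 / K * (2 * Q) ^ p) x ≤ moserInt u η m p := by
      refine MeasureTheory.integral_mono
        ((MeasureTheory.integrableOn_const hWt).integrable_indicator hWo.measurableSet)
        (c.integrable (h.continuousOn_lap_gam hm0 p) hs) fun y => ?_
      dsimp only
      by_cases hy : y ∈ W
      · rw [indicator_of_mem hy, hη y (ball_subset_closedBall hy.1), Real.one_rpow, mul_one]
        have b1 := h.one_le_lap (h24 hy.1)
        have b2 : 2 / K ≤ lapFn u y := by rw [div_le_iff₀ hK]; linarith
        have b3 : 2 * Q < gam (logLap u m y) := hy.2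
        have := h.lap_pos y (h24 hy.1)
        gcongr
      · rw [indicator_of_notMem hy]
        by_cases hy3 : y ∈ ball (0 : Fin n → ℝ) 3
        · have := h.lap_pos y (sub34 hy3)
          have := gam_pos (logLap u m y)
          have := c.nonneg y
          positivity
        · rw [c.eq_zero hy3, Real.zero_rpow hs.ne']; simp
    rw [MeasureTheory.integral_indicator hWo.measurableSet, MeasureTheory.setIntegral_const,
      smul_eq_mul, ← hv] at L1
    have L2 := L1.trans I
    rw [Real.mul_rpow (by norm_num) hQ0.le] at L2
    have hQp : 0 < Q ^ p := by positivity
    refine le_of_mul_le_mul_right ?_ hQp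
    linarith
  obtain ⟨j, hj⟩ := pow_unbounded_of_one_lt (1 / (2 / K * v)) hχ
  have h1 := key j
  have h2 : 1 + χ ^ j * 1 ≤ (1 + 1 : ℝ) ^ (χ ^ j) :=
    one_add_mul_self_le_rpow_one_add (by norm_num) (hχj j)
  have hc : 0 < 2 / K * v := by positivity
  rw [div_lt_iff₀ hc] at hj
  norm_num at h2
  nlinarith

end IsAdm

lemma offBound_pos {n : ℕ} {A K : ℝ} (hA : 0 < A) (hK : 0 < K) : 0 < offBound n A K := by
  unfold offBound; positivity

/-- The doubling inequality for admissible functions. -/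
lemma exists_doubling_const {n : ℕ} (hn : 2 ≤ n) {A K : ℝ} (hA : 0 < A) (hK : 0 < K) (M Λ : ℝ) :
    ∃ C : ℝ, 0 < C ∧ ∀ u : (Fin n → ℝ) → ℝ, IsAdm n A K M Λ u →
      ∀ m : ℝ, (∀ y ∈ ball (0 : Fin n → ℝ) 1, lapFn u y ≤ m) →
        ∀ x ∈ ball (0 : Fin n → ℝ) 2, lapFn u x ≤ C * (1 + m) := by
  obtain ⟨X, D, hD, hX, hXs, hXD, hX0, hX1⟩ := exists_radial_field (n := n) (by omega)
  obtain ⟨L₁, η₁, c₁, hη₁, -⟩ := exists_isCut n (r := 11 / 4) (r' := 29 / 10)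
    (by norm_num) (by norm_num) (by norm_num)
  obtain ⟨L₂, η₂, c₂, hη₂, hs₂⟩ := exists_isCut n (r := 2) (r' := 5 / 2)
    (by norm_num) (by norm_num) (by norm_num)
  set S := n * M * L₂ * MeasureTheory.volume.real (ball (0 : Fin n → ℝ) 3) +
        (M + n * M * L₂ * D) * IsAdm.gradMajConst n A K M Λ L₁ with hS
  set Q := |IsAdm.supConst n A K Λ L₂ * S| + 1 with hQ
  have hO : 0 ≤ 100 * n * offBound n A K := by have := offBound_pos (n := n) hA hK; positivity
  refine ⟨(1 + 100 * n * offBound n A K) * Real.exp (2 * Q), by positivity, fun u h m hm x hx => ?_⟩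
  have hx4 : x ∈ ball (0 : Fin n → ℝ) 4 := ball_subset_ball (by norm_num) hx
  have hm0 : 0 < m := (h.lap_pos 0 (by simp)).trans_le (hm 0 (by simp))
  set m' := m + 100 * n * offBound n A K with hm'
  have hm'0 : 0 < m' := by linarith
  have hm'1 : 100 * n * offBound n A K ≤ m' := by linarith
  have I := h.weighted_lap_integral_le c₁ c₂ hη₁ hs₂ hD hX hXs hXD hX0 hX1 hm'0 hm'1
    fun y hy => (hm y hy).trans (by linarith)
  rw [← hS] at I
  have hn' : (1 : ℝ) < n := by exact_mod_cast hn
  have hsup : 0 ≤ IsAdm.supConst n A K Λ L₂ := by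
    have := h.one_le_moserConst c₂
    have : (0 : ℝ) < n - 1 := by linarith
    unfold IsAdm.supConst
    positivity
  have hJ : IsAdm.supConst n A K Λ L₂ * IsAdm.moserInt u η₂ m' 1 ≤ Q := by
    have e : IsAdm.moserInt u η₂ m' 1 = ∫ x, lapFn u x * gam (logLap u m' x) * η₂ x := by
      unfold IsAdm.moserInt
      have : (2 * (n : ℝ) + 1) * 1 - 2 * n = 1 := by ring
      simp only [this, Real.rpow_one]
    rw [e]
    calc _ ≤ IsAdm.supConst n A K Λ L₂ * S := by gcongr
      _ ≤ _ := (le_abs_self _).trans (by linarith)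
  have G := h.gam_le_of_moserInt c₂ hη₂ hm'0 hm'1 (by positivity) hJ hx
  have hB := h.lap_pos x hx4
  have hl : Real.log (lapFn u x / m') ≤ 2 * Q := (le_gam _).trans G
  rw [Real.log_le_iff_le_exp (by positivity), div_le_iff₀ hm'0] at hl
  refine hl.trans ?_
  rw [mul_comm, mul_right_comm]
  gcongr
  nlinarith

lemma hessian_eq_hessFn {n : ℕ} {u : (Fin n → ℝ) → ℝ} (hu : ContDiffOn ℝ 4 u (ball 0 4))
    {x : Fin n → ℝ} (hx : x ∈ ball (0 : Fin n → ℝ) 4) : hessian n u x = hessFn u x := by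
  ext i j
  rw [hessFn_symm hu isOpen_ball hx]
  have hd : DifferentiableAt ℝ (fderiv ℝ u) x :=
    ((hu.fderiv_of_isOpen isOpen_ball (m := 1) (by norm_num)).contDiffAt
      (isOpen_ball.mem_nhds hx)).differentiableAt (by norm_num)
  unfold hessian hessFn pd
  rw [iteratedFDeriv_two_apply, fderiv_clm_apply hd (differentiableAt_const _)]
  simp

lemma lapl_eq_lapFn {n : ℕ} {u : (Fin n → ℝ) → ℝ} (hu : ContDiffOn ℝ 4 u (ball 0 4))
    {x : Fin n → ℝ} (hx : x ∈ ball (0 : Fin n → ℝ) 4) : lapl n u x = lapFn u x := by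
  unfold lapl lapFn
  rw [hessian_eq_hessFn hu hx]

lemma sigma2_div_lapl_eq_quotFn {n : ℕ} {u : (Fin n → ℝ) → ℝ}
    (hu : ContDiffOn ℝ 4 u (ball 0 4)) {x : Fin n → ℝ} (hx : x ∈ ball (0 : Fin n → ℝ) 4) :
    sigma2 n u x / lapl n u x = quotFn u x := by
  unfold sigma2 quotFn
  rw [lapl_eq_lapFn hu hx, hessian_eq_hessFn hu hx]

lemma abs_pd_le_norm_fderiv {n : ℕ} (g : (Fin n → ℝ) → ℝ) (x : Fin n → ℝ) (i : Fin n) :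
    |pd i g x| ≤ ‖fderiv ℝ g x‖ := by
  refine ((fderiv ℝ g x).le_opNorm (Pi.single i 1)).trans ?_
  rw [Pi.norm_single]
  simp

lemma isAdm_of_solution {n : ℕ} (hn : 2 ≤ n) {M K A : ℝ} (hM : 0 < M) (hK : 0 < K) (hA : 0 < A)
    {u : (Fin n → ℝ) → ℝ} {ψ : (Fin n → ℝ) → ℝ → ℝ} (hu : ContDiffOn ℝ 4 u (ball 0 4))
    (hψ0 : ∀ x ∈ ball (0 : Fin n → ℝ) 4, ∀ s : ℝ, 0 < ψ x s)
    (hψ : ContDiffOn ℝ 1 (Function.uncurry ψ) (ball (0 : Fin n → ℝ) 4 ×ˢ (univ : Set ℝ)))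
    (hψK : ∀ p ∈ ball (0 : Fin n → ℝ) 4 ×ˢ (univ : Set ℝ), |Function.uncurry ψ p| ≤ K ∧
      ‖fderivWithin ℝ (Function.uncurry ψ) (ball (0 : Fin n → ℝ) 4 ×ˢ (univ : Set ℝ)) p‖ ≤ K)
    (hψi : ∀ x ∈ ball (0 : Fin n → ℝ) 4, ∀ s : ℝ, 1 / ψ x s ≤ K)
    (huM : ∀ x ∈ ball (0 : Fin n → ℝ) 3, |u x| + ‖fderiv ℝ u x‖ ≤ M)
    (heq : ∀ x ∈ ball (0 : Fin n → ℝ) 4, 0 < lapl n u x ∧ 0 < sigma2 n u x ∧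
      sigma2 n u x / lapl n u x = ψ x (u x))
    (hlow : ∀ x ∈ ball (0 : Fin n → ℝ) 4, ∀ v : Fin n → ℝ,
      -A * ∑ i, (v i) ^ 2 ≤ ∑ i, ∑ j, v i * hessian n u x i j * v j) :
    IsAdm n A K M (K * (1 + M)) u := by
  have hq : EqOn (quotFn u) (fun x => ψ x (u x)) (ball 0 4) := fun x hx =>
    (sigma2_div_lapl_eq_quotFn hu hx).symm.trans (heq x hx).2.2
  have hpu : ∀ x ∈ ball (0 : Fin n → ℝ) 3, ∀ i, |pd i u x| ≤ M := fun x hx i =>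
    (abs_pd_le_norm_fderiv u x i).trans (by have := huM x hx; have := abs_nonneg (u x); linarith)
  refine ⟨hM, by positivity, hu, hpu, fun x hx i => ?_, fun x hx => ?_⟩
  · have hx4 := IsAdm.sub34 hx
    have hO : IsOpen (ball (0 : Fin n → ℝ) 4 ×ˢ (univ : Set ℝ)) := isOpen_ball.prod isOpen_univ
    have hmem : (x, u x) ∈ ball (0 : Fin n → ℝ) 4 ×ˢ (univ : Set ℝ) := ⟨hx4, mem_univ _⟩
    rw [pd_congr isOpen_ball hq hx4]
    have d1 : DifferentiableAt ℝ (Function.uncurry ψ) (x, u x) :=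
      (hψ.contDiffAt (hO.mem_nhds hmem)).differentiableAt (by norm_num)
    have d2 : HasFDerivAt u (fderiv ℝ u x) x :=
      (hu.diffAt isOpen_ball (by norm_num) hx4).hasFDerivAt
    have d3 := d1.hasFDerivAt.comp x ((hasFDerivAt_id x).prodMk d2)
    have hn1 := (hψK _ hmem).2
    rw [fderivWithin_of_isOpen hO hmem] at hn1
    unfold pd
    rw [show (fun x => ψ x (u x)) = Function.uncurry ψ ∘ fun x => (id x, u x) from rfl, d3.fderiv]
    refine (ContinuousLinearMap.le_opNorm (fderiv ℝ (Function.uncurry ψ) (x, u x))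
      (Pi.single i 1, pd i u x)).trans ?_
    refine mul_le_mul hn1 ?_ (norm_nonneg _) hK.le
    rw [Prod.norm_def, Pi.norm_single]
    refine max_le ?_ ?_
    · simp [hM.le]
    · exact (hpu x hx i).trans (by linarith)
  · have hl := lapl_eq_lapFn hu hx
    have hpos : 0 < lapFn u x := hl ▸ (heq x hx).1
    have hqx : quotFn u x = ψ x (u x) := hq hx
    refine ⟨hn, hA, hK, fun i j => hessFn_symm hu isOpen_ball hx i j, fun v => ?_, rfl, hpos, ?_, ?_, ?_⟩
    · rw [← hessian_eq_hessFn hu hx]; exact hlow x hx v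
    · unfold quotFn; field_simp
    · rw [hqx, one_div_le hK (hψ0 x hx _)]
      exact hψi x hx _
    · rw [hqx]
      exact (le_abs_self _).trans (hψK (x, u x) ⟨hx, mem_univ _⟩).1

/-- doubling inequality for semi-convex solutions in all dimensions: if
`u ∈ C⁴(B₄)` is a 2-convex solution of `(σ₂/σ₁)(λ(D²u)) = ψ(x,u)` in `B₄(0) ⊂ ℝⁿ` with `ψ`
positive of class `C^{1,1}`, and `u` is semi-convex (`D²u ≥ −A·Id`), then
`sup_{B₂} Δu ≤ C(1 + sup_{B₁} Δu)` with `C` depending only on `n`, `A`, `‖ψ‖_{C¹} ≤ K`,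
`‖1/ψ‖_{L^∞} ≤ K` and `‖u‖_{C¹(B₃)} ≤ M`. -/
theorem stmt3 (n : ℕ) (hn : 2 ≤ n) (M K A : ℝ) (hM : 0 < M) (hK : 0 < K) (hA : 0 < A) :
    ∃ C : ℝ, 0 < C ∧
      ∀ (u : (Fin n → ℝ) → ℝ) (ψ : (Fin n → ℝ) → ℝ → ℝ),
        -- u ∈ C⁴(B₄)
        ContDiffOn ℝ 4 u (ball 0 4) →
        -- ψ positive and of class C^{1,1}
        (∀ x ∈ ball (0 : Fin n → ℝ) 4, ∀ s : ℝ, 0 < ψ x s) →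
        ContDiffOn ℝ 1 (Function.uncurry ψ) (ball (0 : Fin n → ℝ) 4 ×ˢ (univ : Set ℝ)) →
        (∃ L : NNReal, LipschitzOnWith L
          (fderivWithin ℝ (Function.uncurry ψ) (ball (0 : Fin n → ℝ) 4 ×ˢ (univ : Set ℝ)))
          (ball (0 : Fin n → ℝ) 4 ×ˢ (univ : Set ℝ))) →
        -- ‖ψ‖_{C¹} ≤ K and ‖1/ψ‖_{L^∞} ≤ K
        (∀ p ∈ ball (0 : Fin n → ℝ) 4 ×ˢ (univ : Set ℝ),
          |Function.uncurry ψ p| ≤ K ∧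
          ‖fderivWithin ℝ (Function.uncurry ψ)
              (ball (0 : Fin n → ℝ) 4 ×ˢ (univ : Set ℝ)) p‖ ≤ K) →
        (∀ x ∈ ball (0 : Fin n → ℝ) 4, ∀ s : ℝ, 1 / ψ x s ≤ K) →
        -- ‖u‖_{C¹(B₃)} ≤ M
        (∀ x ∈ ball (0 : Fin n → ℝ) 3, |u x| + ‖fderiv ℝ u x‖ ≤ M) →
        -- u is 2-convex and solves (σ₂/σ₁)(D²u) = ψ(x,u) in B₄
        (∀ x ∈ ball (0 : Fin n → ℝ) 4,
          0 < lapl n u x ∧ 0 < sigma2 n u x ∧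
            sigma2 n u x / lapl n u x = ψ x (u x)) →
        -- u is semi-convex: D²u ≥ −A·Id on B₄ (as quadratic forms)
        (∀ x ∈ ball (0 : Fin n → ℝ) 4, ∀ v : Fin n → ℝ,
          -A * ∑ i, (v i) ^ 2 ≤ ∑ i, ∑ j, v i * hessian n u x i j * v j) →
        -- doubling inequality: sup_{B₂} Δu ≤ C (1 + sup_{B₁} Δu)
        ∀ m : ℝ, (∀ y ∈ ball (0 : Fin n → ℝ) 1, lapl n u y ≤ m) →
          ∀ x ∈ ball (0 : Fin n → ℝ) 2, lapl n u x ≤ C * (1 + m) := by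
  obtain ⟨C, hC, H⟩ := exists_doubling_const hn hA hK M (K * (1 + M))
  refine ⟨C, hC, fun u ψ hu hψ0 hψ _ hψK hψi huM heq hlow m hm x hx => ?_⟩
  have hadm := isAdm_of_solution hn hM hK hA hu hψ0 hψ hψK hψi huM heq hlow
  rw [lapl_eq_lapFn hu (ball_subset_ball (by norm_num) hx)]
  refine H u hadm m (fun y hy => ?_) x hx
  rw [← lapl_eq_lapFn hu (ball_subset_ball (by norm_num) hy)]
  exact hm y hy
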